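/- Let u ≥ 2 and let F be a fixed nice u-graph with r = v(F) ≥ 4 vertices. Then for every n one may couple the random u-graph process (G_t)_{t=0}^{N} on [n] (N = binom(n,u)) with the random F-graph process (H_t)_{t=0}^{M} on [n], i.e., there is a probability measure on pairs of orderings whose marginals are the two uniform orderings, such that with probability tending to 1 as n → ∞, every F-edge of H_{T_H} is present as a copy of F (a subgraph) in G_{T_G}. -/

import Mathlib

open Classical Filter Asymptotics MeasureTheory
open scoped ENNReal

noncomputable section

/-- The type of potential `F`-edges on vertex set `Fin n`: a pair consisting of the
`r`-element vertex set of the copy and the `u`-edge set of the copy. -/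
abbrev FE (n : ℕ) := Finset (Fin n) × Finset (Finset (Fin n))

/-- `F` (a `u`-graph on `Fin r`) is strictly 1-balanced: every proper subgraph `(V', E')`
with more than one vertex has strictly smaller 1-density, i.e.
`e'/(v'-1) < e(F)/(r-1)`, written multiplicatively. -/
def StrictlyOneBalanced {r : ℕ} (F : Finset (Finset (Fin r))) : Prop :=
  ∀ (V' : Finset (Fin r)) (E' : Finset (Finset (Fin r))),
    E' ⊆ F → (∀ e ∈ E', e ⊆ V') → 1 < V'.card → ¬(V' = Finset.univ ∧ E' = F) →
      E'.card * (r - 1) < F.card * (V'.card - 1)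

/-- After deleting the vertices in `S`, the hypergraph `F` is connected. -/
def ConnectedAvoiding {r : ℕ} (F : Finset (Finset (Fin r))) (S : Finset (Fin r)) : Prop :=
  ∀ x y : Fin r, x ∉ S → y ∉ S →
    Relation.ReflTransGen (fun a b => ∃ e ∈ F, Disjoint e S ∧ a ∈ e ∧ b ∈ e) x y

/-- `F` is 3-connected: at least 4 vertices, and no set of at most 2 vertices disconnects it. -/
def ThreeConnected {r : ℕ} (F : Finset (Finset (Fin r))) : Prop :=
  4 ≤ r ∧ ∀ S : Finset (Fin r), S.card ≤ 2 → ConnectedAvoiding F S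

/-- Two edge sets on `Fin r` are isomorphic via a permutation of the vertices. -/
def EdgeIso {r : ℕ} (F F' : Finset (Finset (Fin r))) : Prop :=
  ∃ σ : Equiv.Perm (Fin r), F.image (fun e => e.image (fun x => σ x)) = F'

/-- `F` is nice: strictly 1-balanced, 3-connected and either `u ≥ 3` or `u = 2` and `F`
cannot be transformed into an isomorphic graph by adding one edge and deleting one edge. -/
def Nice {r : ℕ} (u : ℕ) (F : Finset (Finset (Fin r))) : Prop :=
  StrictlyOneBalanced F ∧ ThreeConnected F ∧
    (3 ≤ u ∨ (u = 2 ∧ ¬ ∃ a b : Finset (Fin r), a.card = u ∧ a ∉ F ∧ b ∈ F ∧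
      EdgeIso (insert a (F.erase b)) F))

/-- `h` is an `F`-edge on `[n]`: a copy of `F`, recorded as its (`r`-element) vertex set
together with its `u`-edge set. -/
def IsFEdge {r : ℕ} (F : Finset (Finset (Fin r))) (n : ℕ) (h : FE n) : Prop :=
  ∃ φ : Fin r ↪ Fin n, h.1 = Finset.univ.map φ ∧ h.2 = F.image (fun e => e.map φ)

/-- All possible `F`-edges on `[n]`. -/
def allFEdges {r : ℕ} (F : Finset (Finset (Fin r))) (n : ℕ) : Finset (FE n) :=
  Finset.univ.filter (fun h => IsFEdge F n h)

/-- `M`, the total number of `F`-edges on `[n]`. -/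
def Mnum {r : ℕ} (F : Finset (Finset (Fin r))) (n : ℕ) : ℕ := (allFEdges F n).card

/-- All `u`-element subsets of `[n]`. -/
def allUEdges (u n : ℕ) : Finset (Finset (Fin n)) :=
  Finset.univ.filter (fun e : Finset (Fin n) => e.card = u)

/-- The number of automorphisms of `F`. -/
def autCard {r : ℕ} (F : Finset (Finset (Fin r))) : ℕ :=
  Fintype.card {σ : Equiv.Perm (Fin r) // F.image (fun e => e.image (fun x => σ x)) = F}

/-- The degree of a vertex `v` in an `F`-graph `H`. -/
def degFE {n : ℕ} (H : Finset (FE n)) (v : Fin n) : ℕ :=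
  (H.filter (fun h => v ∈ h.1)).card

/-- Two `F`-edges are partners if their vertex sets share exactly `u` vertices. -/
def Partner (u : ℕ) {n : ℕ} (h h' : FE n) : Prop :=
  h ≠ h' ∧ (h.1 ∩ h'.1).card = u

/-- The state at time `t` of the process induced by the ordering `f`. -/
def proc {α : Type*} [DecidableEq α] {m : ℕ} (f : Fin m → α) (t : ℕ) : Finset α :=
  (Finset.univ.filter (fun i : Fin m => (i : ℕ) < t)).image f

/-- A valid ordering of all `u`-element subsets of `[n]`. -/
def ValidOrdU (u n : ℕ) (f : Fin (Nat.choose n u) → Finset (Fin n)) : Prop :=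
  Function.Injective f ∧ ∀ e : Finset (Fin n), e.card = u → ∃ i, f i = e

/-- A valid ordering of all `r`-element subsets of `[n]`. -/
def ValidOrdR (r n : ℕ) (f : Fin (Nat.choose n r) → Finset (Fin n)) : Prop :=
  Function.Injective f ∧ ∀ e : Finset (Fin n), e.card = r → ∃ i, f i = e

/-- A valid ordering of all `F`-edges on `[n]`. -/
def ValidOrdH {r : ℕ} (F : Finset (Finset (Fin r))) (n : ℕ)
    (f : Fin (Mnum F n) → FE n) : Prop :=
  Function.Injective f ∧ ∀ h : FE n, IsFEdge F n h → ∃ i, f i = h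

/-- `T_H`: the first time at which the `F`-graph process has no isolated vertices. -/
def THit {r : ℕ} (F : Finset (Finset (Fin r))) (n : ℕ) (f : Fin (Mnum F n) → FE n) : ℕ :=
  sInf {t : ℕ | ∀ v : Fin n, ∃ h ∈ proc f t, v ∈ h.1}

/-- `T_E`: the first time at which the `r`-uniform hypergraph process has no isolated
vertices. -/
def TEHit (r n : ℕ) (f : Fin (Nat.choose n r) → Finset (Fin n)) : ℕ :=
  sInf {t : ℕ | ∀ v : Fin n, ∃ e ∈ proc f t, v ∈ e}

/-- `T_G`: the first time at which every vertex of `[n]` lies in a copy of `F` in the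
`u`-graph process. -/
def TGHit (u : ℕ) {r : ℕ} (F : Finset (Finset (Fin r))) (n : ℕ)
    (f : Fin (Nat.choose n u) → Finset (Fin n)) : ℕ :=
  sInf {t : ℕ | ∀ v : Fin n, ∃ h : FE n, IsFEdge F n h ∧ v ∈ h.1 ∧ h.2 ⊆ proc f t}

/-- The random variable `X` is uniformly distributed over `{a | P a}` under `μ`. -/
def UniformOn {Ω α : Type*} (μ : PMF Ω) (X : Ω → α) (P : α → Prop) : Prop :=
  μ.toOuterMeasure {ω | P (X ω)} = 1 ∧
    ∀ a b : α, P a → P b →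
      μ.toOuterMeasure {ω | X ω = a} = μ.toOuterMeasure {ω | X ω = b}

/-- Under `μ`, the random set `X` contains each element of `all` independently with
probability `p` (a Bernoulli product / binomial random subset distribution). -/
def BernoulliVia {Ω E : Type*} (μ : PMF Ω) (X : Ω → Finset E)
    (all : Finset E) (p : ℝ) : Prop :=
  ∀ A : Finset E, μ.toOuterMeasure {ω | X ω = A} =
    if A ⊆ all then ENNReal.ofReal (p ^ A.card * (1 - p) ^ (all.card - A.card)) else 0

/-- The function `g` tends to infinity and is `o(log n / log log n)`. -/
def GoodG (g : ℕ → ℝ) : Prop :=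
  Tendsto g atTop atTop ∧ g =o[atTop] fun n : ℕ => Real.log n / Real.log (Real.log n)

/-- `π₊`, the probability at the end of the critical window. -/
def piPlus {r : ℕ} (F : Finset (Finset (Fin r))) (g : ℕ → ℝ) (n : ℕ) : ℝ :=
  ((autCard F : ℝ) / (Nat.factorial r : ℝ)) *
    ((Real.log n + g n) / ((n - 1).choose (r - 1) : ℝ))

/-- `π₋`, the probability at the start of the critical window. -/
def piMinus {r : ℕ} (F : Finset (Finset (Fin r))) (g : ℕ → ℝ) (n : ℕ) : ℝ :=
  ((autCard F : ℝ) / (Nat.factorial r : ℝ)) *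
    ((Real.log n - g n) / ((n - 1).choose (r - 1) : ℝ))

/-- `p₊ = (π₊/(1-n^{-δ}))^{1/s}` where `s = e(F)`. -/
def pPlus {r : ℕ} (F : Finset (Finset (Fin r))) (g : ℕ → ℝ) (δ : ℝ) (n : ℕ) : ℝ :=
  (piPlus F g n / (1 - (n : ℝ) ^ (-δ))) ^ ((1 : ℝ) / (F.card : ℝ))

/-- Connectivity (as a multihypergraph of vertex sets) of a set of `F`-edges. -/
def ConnFE {n : ℕ} (S : Finset (FE n)) : Prop :=
  ∀ a ∈ S, ∀ b ∈ S,
    Relation.ReflTransGen (fun x y : FE n => x ∈ S ∧ y ∈ S ∧ (x.1 ∩ y.1).Nonempty) a b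

/-- The multihypergraph of vertex sets of the `F`-edges of `H` contains an avoidable
configuration: a connected `S ⊆ H` with nullity `(r-1)e(S)+1-v(S) > 1` and
`e(S) ≤ 2^(r+1)`. -/
def HasAvoidable (r : ℕ) {n : ℕ} (H : Finset (FE n)) : Prop :=
  ∃ S ⊆ H, S.Nonempty ∧ ConnFE S ∧
    (S.sup Prod.fst).card < (r - 1) * S.card ∧ S.card ≤ 2 ^ (r + 1)

/-- `G` contains an `F`-factor: pairwise vertex-disjoint copies of `F`, each a subgraph
of `G`, whose vertex sets partition `[n]`. -/
def HasFFactor {r : ℕ} (F : Finset (Finset (Fin r))) (n : ℕ)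
    (G : Finset (Finset (Fin n))) : Prop :=
  ∃ C : Finset (FE n), (∀ h ∈ C, IsFEdge F n h ∧ h.2 ⊆ G) ∧
    (∀ h ∈ C, ∀ h' ∈ C, h ≠ h' → Disjoint h.1 h'.1) ∧
    C.sup Prod.fst = Finset.univ ∧ C.card * r = n

set_option linter.unusedSectionVars false

/-! ## Part 1: Bernoulli product weights on finite sets -/

/-- Real valued indicator of a proposition. -/
def ind (P : Prop) : ℝ := if P then 1 else 0

lemma ind_nonneg (P : Prop) : 0 ≤ ind P := by unfold ind; split_ifs <;> norm_num
lemma ind_le_one (P : Prop) : ind P ≤ 1 := by unfold ind; split_ifs <;> norm_num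
lemma ind_pos {P : Prop} (h : P) : ind P = 1 := by simp [ind, h]
lemma ind_neg {P : Prop} (h : ¬ P) : ind P = 0 := by simp [ind, h]
lemma ind_mono {P Q : Prop} (h : P → Q) : ind P ≤ ind Q := by
  by_cases hP : P
  · rw [ind_pos hP, ind_pos (h hP)]
  · rw [ind_neg hP]; exact ind_nonneg _
lemma ind_and (P Q : Prop) : ind (P ∧ Q) = ind P * ind Q := by
  by_cases hP : P <;> by_cases hQ : Q <;> simp [ind, hP, hQ]
lemma ind_not (P : Prop) : ind (¬ P) = 1 - ind P := by
  by_cases hP : P <;> simp [ind, hP]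
lemma ind_or_le (P Q : Prop) : ind (P ∨ Q) ≤ ind P + ind Q := by
  by_cases hP : P <;> by_cases hQ : Q <;> simp [ind, hP, hQ]
lemma ind_exists_le {ι : Type*} (s : Finset ι) (P : ι → Prop) :
    ind (∃ i ∈ s, P i) ≤ ∑ i ∈ s, ind (P i) := by
  by_cases h : ∃ i ∈ s, P i
  · obtain ⟨i, hi, hP⟩ := h
    rw [ind_pos ⟨i, hi, hP⟩, ← ind_pos hP]
    exact Finset.single_le_sum (f := fun i => ind (P i)) (fun i _ => ind_nonneg _) hi
  · rw [ind_neg h]; exact Finset.sum_nonneg (fun i _ => ind_nonneg _)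
lemma ind_congr {P Q : Prop} (h : P ↔ Q) : ind P = ind Q := by rw [propext h]

/-- Weight of the set `A` when `e` is included independently with probability `q e`. -/
def bw {E : Type*} [Fintype E] [DecidableEq E] (q : E → ℝ) (A : Finset E) : ℝ :=
  ∏ e, if e ∈ A then q e else 1 - q e

/-- Expectation under the Bernoulli product weights. -/
def ex {E : Type*} [Fintype E] [DecidableEq E] (q : E → ℝ) (f : Finset E → ℝ) : ℝ :=
  ∑ A, bw q A * f A

section Bern
variable {E : Type*} [Fintype E] [DecidableEq E]

/-- All inclusion probabilities are in the unit interval. -/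
def Pq (q : E → ℝ) : Prop := ∀ e, 0 ≤ q e ∧ q e ≤ 1

lemma bw_nonneg {q : E → ℝ} (hq : Pq q) (A : Finset E) : 0 ≤ bw q A := by
  unfold bw
  refine Finset.prod_nonneg (fun e _ => ?_)
  split_ifs
  · exact (hq e).1
  · linarith [(hq e).2]

lemma sum_prod_ite (f g : E → ℝ) :
    ∑ A : Finset E, ∏ e, (if e ∈ A then f e else g e) = ∏ e, (f e + g e) := by
  rw [Fintype.prod_add]
  refine Finset.sum_congr rfl (fun A _ => ?_)
  rw [Finset.prod_ite]
  congr 1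
  · apply Finset.prod_congr _ (fun _ _ => rfl)
    ext; simp
  · apply Finset.prod_congr _ (fun _ _ => rfl)
    ext; simp

lemma ex_prod (q a b : E → ℝ) :
    ex q (fun A => ∏ e, if e ∈ A then a e else b e) = ∏ e, (q e * a e + (1 - q e) * b e) := by
  unfold ex bw
  rw [← sum_prod_ite]
  refine Finset.sum_congr rfl (fun A _ => ?_)
  rw [← Finset.prod_mul_distrib]
  refine Finset.prod_congr rfl (fun e _ => ?_)
  split_ifs <;> rfl

lemma ex_const (q : E → ℝ) (c : ℝ) : ex q (fun _ => c) = c := by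
  have h := ex_prod q (fun _ => 1) (fun _ => 1)
  simp only [ite_self, Finset.prod_const_one, mul_one, add_sub_cancel] at h
  have h2 : ex q (fun _ => c) = ex q (fun _ => 1) * c := by
    unfold ex; rw [Finset.sum_mul]; simp
  rw [h2, h, one_mul]

lemma sum_bw (q : E → ℝ) : ∑ A, bw q A = 1 := by
  have := ex_const q 1
  simpa [ex] using this

lemma ex_mono {q : E → ℝ} (hq : Pq q) {f g : Finset E → ℝ} (h : ∀ A, f A ≤ g A) :
    ex q f ≤ ex q g :=
  Finset.sum_le_sum (fun A _ => mul_le_mul_of_nonneg_left (h A) (bw_nonneg hq A))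

lemma ex_nonneg {q : E → ℝ} (hq : Pq q) {f : Finset E → ℝ} (h : ∀ A, 0 ≤ f A) : 0 ≤ ex q f :=
  Finset.sum_nonneg (fun A _ => mul_nonneg (bw_nonneg hq A) (h A))

lemma ex_add (q : E → ℝ) (f g : Finset E → ℝ) :
    ex q (fun A => f A + g A) = ex q f + ex q g := by
  unfold ex; rw [← Finset.sum_add_distrib]; exact Finset.sum_congr rfl (fun A _ => by ring)

lemma ex_sub (q : E → ℝ) (f g : Finset E → ℝ) :
    ex q (fun A => f A - g A) = ex q f - ex q g := by
  unfold ex; rw [← Finset.sum_sub_distrib]; exact Finset.sum_congr rfl (fun A _ => by ring)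

lemma ex_mul_left (q : E → ℝ) (c : ℝ) (f : Finset E → ℝ) :
    ex q (fun A => c * f A) = c * ex q f := by
  unfold ex; rw [Finset.mul_sum]; exact Finset.sum_congr rfl (fun A _ => by ring)

lemma ex_sum {ι : Type*} (q : E → ℝ) (s : Finset ι) (f : ι → Finset E → ℝ) :
    ex q (fun A => ∑ i ∈ s, f i A) = ∑ i ∈ s, ex q (f i) := by
  unfold ex; rw [Finset.sum_comm]; exact Finset.sum_congr rfl (fun A _ => by rw [Finset.mul_sum])

lemma ex_congr (q : E → ℝ) {f g : Finset E → ℝ} (h : ∀ A, f A = g A) : ex q f = ex q g := by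
  unfold ex; exact Finset.sum_congr rfl (fun A _ => by rw [h A])

lemma ind_subset_eq (T A : Finset E) :
    ind (T ⊆ A) = ∏ e, if e ∈ A then (1:ℝ) else (if e ∈ T then 0 else 1) := by
  by_cases h : T ⊆ A
  · rw [ind_pos h]; symm; apply Finset.prod_eq_one
    intro e _
    by_cases he : e ∈ A
    · simp [he]
    · have : e ∉ T := fun h' => he (h h')
      simp [he, this]
  · rw [ind_neg h]; symm
    obtain ⟨e, heT, heA⟩ := Finset.not_subset.1 h
    apply Finset.prod_eq_zero (Finset.mem_univ e)
    simp [heT, heA]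

lemma ind_disj_eq (T A : Finset E) :
    ind (Disjoint T A) = ∏ e, if e ∈ A then (if e ∈ T then (0:ℝ) else 1) else 1 := by
  by_cases h : Disjoint T A
  · rw [ind_pos h]; symm; apply Finset.prod_eq_one
    intro e _
    by_cases he : e ∈ A
    · have : e ∉ T := fun h' => (Finset.disjoint_left.1 h h') he
      simp [he, this]
    · simp [he]
  · rw [ind_neg h]; symm
    obtain ⟨e, heT, heA⟩ := Finset.not_disjoint_iff.1 h
    apply Finset.prod_eq_zero (Finset.mem_univ e)
    simp [heT, heA]

lemma ex_subset (q : E → ℝ) (T : Finset E) :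
    ex q (fun A => ind (T ⊆ A)) = ∏ e ∈ T, q e := by
  rw [ex_congr q (ind_subset_eq T), ex_prod, ← Finset.prod_subset (Finset.subset_univ T)]
  · exact Finset.prod_congr rfl (fun e he => by simp [he])
  · intro e _ he; simp [he]

lemma ex_disj (q : E → ℝ) (T : Finset E) :
    ex q (fun A => ind (Disjoint T A)) = ∏ e ∈ T, (1 - q e) := by
  rw [ex_congr q (ind_disj_eq T), ex_prod, ← Finset.prod_subset (Finset.subset_univ T)]
  · exact Finset.prod_congr rfl (fun e he => by simp [he])
  · intro e _ he; simp [he]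

lemma ex_mem (q : E → ℝ) (e : E) : ex q (fun A => ind (e ∈ A)) = q e := by
  have := ex_subset q {e}
  simpa using this

lemma bw_mul (q : E → ℝ) (A B : Finset E) : bw q A * bw q B = bw q (A ∩ B) * bw q (A ∪ B) := by
  unfold bw
  rw [← Finset.prod_mul_distrib, ← Finset.prod_mul_distrib]
  refine Finset.prod_congr rfl (fun e _ => ?_)
  by_cases h1 : e ∈ A <;> by_cases h2 : e ∈ B <;> simp [h1, h2, mul_comm]

lemma harris {q : E → ℝ} (hq : Pq q) {f g : Finset E → ℝ} (hf0 : ∀ A, 0 ≤ f A)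
    (hg0 : ∀ A, 0 ≤ g A) (hf : ∀ A B, A ⊆ B → f A ≤ f B) (hg : ∀ A B, A ⊆ B → g A ≤ g B) :
    ex q f * ex q g ≤ ex q (fun A => f A * g A) := by
  have := fkg (μ := bw q) (f := f) (g := g) (fun A => bw_nonneg hq A) hf0 hg0 (fun A B h => hf A B h)
    (fun A B h => hg A B h) (fun A B => (bw_mul q A B).le)
  rw [sum_bw, one_mul] at this
  exact this

/-- Increasing times decreasing event. -/
lemma harris_ud {q : E → ℝ} (hq : Pq q) {P Q : Finset E → Prop}
    (hP : ∀ A B, A ⊆ B → P A → P B) (hQ : ∀ A B, A ⊆ B → Q B → Q A) :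
    ex q (fun A => ind (P A ∧ Q A)) ≤ ex q (fun A => ind (P A)) * ex q (fun A => ind (Q A)) := by
  have h := harris hq (f := fun A => ind (P A)) (g := fun A => ind (¬ Q A))
    (fun _ => ind_nonneg _) (fun _ => ind_nonneg _) (fun A B h => ind_mono (hP A B h))
    (fun A B h => ind_mono (fun h1 h2 => h1 (hQ A B h h2)))
  have e1 : ex q (fun A => ind (¬ Q A)) = 1 - ex q (fun A => ind (Q A)) := by
    rw [ex_congr q (fun A => ind_not (Q A)), ex_sub, ex_const]
  have e2 : ex q (fun A => ind (P A) * ind (¬ Q A)) =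
      ex q (fun A => ind (P A)) - ex q (fun A => ind (P A ∧ Q A)) := by
    rw [← ex_sub]
    exact ex_congr q (fun A => by rw [ind_not, ind_and]; ring)
  rw [e1, e2] at h
  linarith

/-- Two decreasing events. -/
lemma harris_dd {q : E → ℝ} (hq : Pq q) {P Q : Finset E → Prop}
    (hP : ∀ A B, A ⊆ B → P B → P A) (hQ : ∀ A B, A ⊆ B → Q B → Q A) :
    ex q (fun A => ind (P A)) * ex q (fun A => ind (Q A)) ≤ ex q (fun A => ind (P A ∧ Q A)) := by
  have h := harris_ud hq (P := fun A => ¬ P A) (Q := Q)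
    (fun A B h h1 h2 => h1 (hP A B h h2)) hQ
  have e1 : ex q (fun A => ind (¬ P A)) = 1 - ex q (fun A => ind (P A)) := by
    rw [ex_congr q (fun A => ind_not (P A)), ex_sub, ex_const]
  have e2 : ex q (fun A => ind (¬ P A ∧ Q A)) =
      ex q (fun A => ind (Q A)) - ex q (fun A => ind (P A ∧ Q A)) := by
    rw [← ex_sub]
    exact ex_congr q (fun A => by rw [ind_and, ind_and, ind_not]; ring)
  rw [e1, e2] at h
  linarith

lemma harris_avoid {q : E → ℝ} (hq : Pq q) {ι : Type*} (J : Finset ι) (a : ι → Finset E) :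
    ∏ j ∈ J, (1 - ∏ e ∈ a j, q e) ≤ ex q (fun A => ind (∀ j ∈ J, ¬ a j ⊆ A)) := by
  induction J using Finset.induction_on with
  | empty => simp [ind, ex_const]
  | insert j J hj ih =>
    rw [Finset.prod_insert hj]
    have h1 : ex q (fun A => ind (¬ a j ⊆ A)) = 1 - ∏ e ∈ a j, q e := by
      rw [ex_congr q (fun A => ind_not (a j ⊆ A)), ex_sub, ex_const, ex_subset]
    have h0 : 0 ≤ 1 - ∏ e ∈ a j, q e := by
      rw [← h1]; exact ex_nonneg hq (fun _ => ind_nonneg _)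
    refine (mul_le_mul_of_nonneg_left ih h0).trans ?_
    rw [← h1]
    refine (harris_dd hq (fun A B h h1 h2 => h1 (h2.trans h))
      (fun A B h h1 j hj h2 => h1 j hj (h2.trans h))).trans (le_of_eq ?_)
    exact ex_congr q (fun A => ind_congr (by simp))

/-- Conditioning on `U ⊆ A`. -/
def qon (q : E → ℝ) (U : Finset E) : E → ℝ := fun e => if e ∈ U then 1 else q e

lemma Pq_qon {q : E → ℝ} (hq : Pq q) (U : Finset E) : Pq (qon q U) := by
  intro e; unfold qon; split_ifs
  · norm_num
  · exact hq e

lemma bw_qon (q : E → ℝ) (U A : Finset E) :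
    bw q A * ind (U ⊆ A) = (∏ e ∈ U, q e) * bw (qon q U) A := by
  have hU : (∏ e ∈ U, q e) = ∏ e, if e ∈ U then q e else 1 := by
    rw [Finset.prod_ite_mem, Finset.univ_inter]
  rw [ind_subset_eq, hU]
  unfold bw qon
  rw [← Finset.prod_mul_distrib, ← Finset.prod_mul_distrib]
  refine Finset.prod_congr rfl (fun e _ => ?_)
  by_cases h1 : e ∈ A <;> by_cases h2 : e ∈ U <;> simp [h1, h2]

lemma ex_qon (q : E → ℝ) (U : Finset E) (f : Finset E → ℝ) :
    ex q (fun A => ind (U ⊆ A) * f A) = (∏ e ∈ U, q e) * ex (qon q U) f := by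
  unfold ex
  rw [Finset.mul_sum]
  refine Finset.sum_congr rfl (fun A _ => ?_)
  rw [← mul_assoc, bw_qon, mul_assoc]

lemma bw_split (q : E → ℝ) (e : E) (A : Finset E) :
    bw q A = q e * bw (Function.update q e 1) A + (1 - q e) * bw (Function.update q e 0) A := by
  have key : ∀ q' : E → ℝ, bw q' A = (if e ∈ A then q' e else 1 - q' e) *
      ∏ x ∈ Finset.univ.erase e, (if x ∈ A then q' x else 1 - q' x) := by
    intro q'; unfold bw
    exact (Finset.mul_prod_erase Finset.univ (fun x => if x ∈ A then q' x else 1 - q' x)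
      (Finset.mem_univ e)).symm
  have rest : ∀ x0 : ℝ, ∏ x ∈ Finset.univ.erase e, (if x ∈ A then Function.update q e x0 x
      else 1 - Function.update q e x0 x) =
      ∏ x ∈ Finset.univ.erase e, (if x ∈ A then q x else 1 - q x) := by
    intro x0
    refine Finset.prod_congr rfl (fun x hx => ?_)
    rw [Function.update_of_ne (Finset.ne_of_mem_erase hx)]
  rw [key q, key, key (Function.update q e 0), rest, rest]
  simp only [Function.update_self]
  split_ifs <;> ring

lemma ex_indep_one (q : E → ℝ) (e : E) (x : ℝ) (f : Finset E → ℝ)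
    (hf : ∀ A, f (insert e A) = f (A.erase e)) : ex q f = ex (Function.update q e x) f := by
  have h01 : ex (Function.update q e 1) f = ex (Function.update q e 0) f := by
    unfold ex
    refine Finset.sum_nbij' (fun A => if e ∈ A then A.erase e else insert e A)
      (fun A => if e ∈ A then A.erase e else insert e A) ?_ ?_ ?_ ?_ ?_
    · intro _ _; exact Finset.mem_univ _
    · intro _ _; exact Finset.mem_univ _
    · intro A _; by_cases h : e ∈ A <;> simp [h]
    · intro A _; by_cases h : e ∈ A <;> simp [h]
    · intro A _
      congr 1
      · unfold bw
        refine Finset.prod_congr rfl (fun y _ => ?_)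
        by_cases hy : y = e
        · subst hy; by_cases h : y ∈ A <;> simp [h]
        · by_cases h : e ∈ A <;> simp [h, hy]
      · by_cases h : e ∈ A
        · simp only [h, if_true]
          rw [← hf A, Finset.insert_eq_of_mem h]
        · simp only [h, if_false]
          rw [hf A, Finset.erase_eq_of_notMem h]
  have gen : ∀ q' : E → ℝ, ex q' f = q' e * ex (Function.update q' e 1) f +
      (1 - q' e) * ex (Function.update q' e 0) f := by
    intro q'
    unfold ex
    rw [Finset.mul_sum, Finset.mul_sum, ← Finset.sum_add_distrib]
    refine Finset.sum_congr rfl (fun A _ => ?_)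
    rw [bw_split q' e A]; ring
  rw [gen q, gen (Function.update q e x)]
  simp only [Function.update_idem, h01]
  ring

lemma ex_indep (q : E → ℝ) (T : Finset E) (f : Finset E → ℝ)
    (hf : ∀ e ∈ T, ∀ A, f (insert e A) = f (A.erase e)) : ex q f = ex (qon q T) f := by
  induction T using Finset.induction_on with
  | empty => congr 1
  | insert e T _ ih =>
    rw [ih (fun e' he' => hf e' (Finset.mem_insert_of_mem he')),
      ex_indep_one _ e 1 f (hf e (Finset.mem_insert_self _ _))]
    congr 1
    ext x
    by_cases hx : x = e
    · subst hx; simp [qon]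
    · simp [qon, hx]

/-- Union of two independent Bernoulli sets. -/
lemma ex_union (q q' : E → ℝ) (f : Finset E → ℝ) :
    ex (fun e => 1 - (1 - q e) * (1 - q' e)) f = ex q (fun A => ex q' (fun B => f (A ∪ B))) := by
  have key : ∀ C : Finset E, bw (fun e => 1 - (1 - q e) * (1 - q' e)) C =
      ∑ A, ∑ B, bw q A * bw q' B * ind (A ∪ B = C) := by
    intro C
    have h1 : ∀ A B : Finset E, bw q A * bw q' B * ind (A ∪ B = C) =
        ∏ e, (if e ∈ B then (if e ∈ A then q e * q' e * ind (e ∈ C) else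
          (1 - q e) * q' e * ind (e ∈ C)) else
          (if e ∈ A then q e * (1 - q' e) * ind (e ∈ C) else
            (1 - q e) * (1 - q' e) * ind (e ∉ C))) := by
      intro A B
      have h2 : ind (A ∪ B = C) = ∏ e, ind (e ∈ A ∪ B ↔ e ∈ C) := by
        by_cases h : A ∪ B = C
        · rw [ind_pos h]; symm; apply Finset.prod_eq_one; intro e _; rw [h]; exact ind_pos Iff.rfl
        · rw [ind_neg h]; symm
          have : ∃ e, ¬ (e ∈ A ∪ B ↔ e ∈ C) := by
            by_contra hc; push Not at hc; exact h (Finset.ext hc)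
          obtain ⟨e, he⟩ := this
          exact Finset.prod_eq_zero (Finset.mem_univ e) (ind_neg he)
      rw [h2]; unfold bw
      rw [← Finset.prod_mul_distrib, ← Finset.prod_mul_distrib]
      refine Finset.prod_congr rfl (fun e _ => ?_)
      by_cases hA : e ∈ A <;> by_cases hB : e ∈ B <;> by_cases hC : e ∈ C <;>
        simp [hA, hB, hC, ind]
    simp_rw [h1]
    have h3 : ∀ A : Finset E, ∑ B : Finset E, ∏ e, (if e ∈ B then (if e ∈ A then
          q e * q' e * ind (e ∈ C) else
          (1 - q e) * q' e * ind (e ∈ C)) else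
          (if e ∈ A then q e * (1 - q' e) * ind (e ∈ C) else
            (1 - q e) * (1 - q' e) * ind (e ∉ C))) =
        ∏ e, (if e ∈ A then q e * ind (e ∈ C) else
          (1 - q e) * (q' e * ind (e ∈ C) + (1 - q' e) * ind (e ∉ C))) := by
      intro A
      rw [sum_prod_ite]
      refine Finset.prod_congr rfl (fun e _ => ?_)
      split_ifs <;> ring
    simp_rw [h3]
    rw [sum_prod_ite]
    unfold bw
    refine Finset.prod_congr rfl (fun e _ => ?_)
    by_cases hC : e ∈ C <;> simp [hC, ind]
    ring
  unfold ex
  simp_rw [key, Finset.sum_mul, Finset.mul_sum]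
  rw [Finset.sum_comm]
  refine Finset.sum_congr rfl (fun A _ => ?_)
  rw [Finset.sum_comm]
  refine Finset.sum_congr rfl (fun B _ => ?_)
  rw [Finset.sum_eq_single (A ∪ B)]
  · rw [ind_pos rfl]; ring
  · intro C _ hC; rw [ind_neg (fun h => hC h.symm)]; ring
  · intro h; exact absurd (Finset.mem_univ _) h

/-- Cauchy-Schwarz. -/
lemma ex_cs {q : E → ℝ} (hq : Pq q) (f g : Finset E → ℝ) :
    (ex q (fun A => f A * g A)) ^ 2 ≤ ex q (fun A => f A ^ 2) * ex q (fun A => g A ^ 2) := by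
  unfold ex
  refine Finset.sum_sq_le_sum_mul_sum_of_sq_le_mul _
    (fun A _ => mul_nonneg (bw_nonneg hq A) (sq_nonneg _))
    (fun A _ => mul_nonneg (bw_nonneg hq A) (sq_nonneg _)) (fun A _ => le_of_eq (by ring))

end Bern

/-! ## Part 2: the conditional lower bound and the abstract coupling -/

section Key
variable {E : Type*} [Fintype E] [DecidableEq E]

lemma prod_qon (q : E → ℝ) (U T : Finset E) :
    ∏ e ∈ T, qon q U e = ∏ e ∈ T \ U, q e := by
  unfold qon
  rw [Finset.prod_ite]
  simp only [Finset.prod_const_one, one_mul]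
  apply Finset.prod_congr _ (fun _ _ => rfl)
  ext; simp

lemma prod_le_one' {q : E → ℝ} (hq : Pq q) (T : Finset E) : ∏ e ∈ T, q e ≤ 1 :=
  Finset.prod_le_one (fun e _ => (hq e).1) (fun e _ => (hq e).2)

lemma prod_nonneg' {q : E → ℝ} (hq : Pq q) (T : Finset E) : 0 ≤ ∏ e ∈ T, q e :=
  Finset.prod_nonneg (fun e _ => (hq e).1)

lemma key_lower {ι : Type*} {q : E → ℝ} (hq : Pq q) (U h : Finset E) (N : Finset ι)
    (a : ι → Finset E) (η : ℝ) (hη : η ≤ 1)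
    (hQ : ∑ g ∈ N.filter (fun g => ¬ (a g ∩ h ⊆ U)), ∏ e ∈ a g \ (U ∪ h), q e ≤ η) :
    ((1 - η) * ∏ e ∈ h, q e) * ex q (fun A => ind (U ⊆ A ∧ ∀ g ∈ N, ¬ a g ⊆ A)) ≤
      ex q (fun A => ind (h ⊆ A ∧ U ⊆ A ∧ ∀ g ∈ N, ¬ a g ⊆ A)) := by
  set q' := qon q U with hq'def
  have hq' : Pq q' := Pq_qon hq U
  set N0 := N.filter (fun g => a g ∩ h ⊆ U) with hN0
  set N1 := N.filter (fun g => ¬ (a g ∩ h ⊆ U)) with hN1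
  have hl : ex q (fun A => ind (U ⊆ A ∧ ∀ g ∈ N, ¬ a g ⊆ A)) =
      (∏ e ∈ U, q e) * ex q' (fun A => ind (∀ g ∈ N, ¬ a g ⊆ A)) := by
    rw [hq'def, ← ex_qon]; exact ex_congr q (fun A => ind_and _ _)
  have hr : ex q (fun A => ind (h ⊆ A ∧ U ⊆ A ∧ ∀ g ∈ N, ¬ a g ⊆ A)) =
      (∏ e ∈ U, q e) * ex q' (fun A => ind (h ⊆ A ∧ ∀ g ∈ N, ¬ a g ⊆ A)) := by
    rw [hq'def, ← ex_qon]
    exact ex_congr q (fun A => by rw [← ind_and]; exact ind_congr (by tauto))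
  rw [hl, hr]
  set c0 := ex q' (fun A => ind (∀ g ∈ N0, ¬ a g ⊆ A)) with hc0
  have hc0n : 0 ≤ c0 := ex_nonneg hq' (fun _ => ind_nonneg _)
  have s1 : ex q' (fun A => ind (h ⊆ A ∧ ∀ g ∈ N0, ¬ a g ⊆ A)) = (∏ e ∈ h, q' e) * c0 := by
    have : ex q' (fun A => ind (h ⊆ A ∧ ∀ g ∈ N0, ¬ a g ⊆ A)) =
        (∏ e ∈ h, q' e) * ex (qon q' h) (fun A => ind (∀ g ∈ N0, ¬ a g ⊆ A)) := by
      rw [← ex_qon]; exact ex_congr q' (fun A => ind_and _ _)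
    rw [this, hc0]
    congr 1
    rw [ex_indep q' (h \ U)]
    · congr 1
      ext e
      by_cases h1 : e ∈ U <;> by_cases h2 : e ∈ h <;> simp [qon, hq'def, h1, h2]
    · intro e he A
      apply ind_congr
      have hne : ∀ g ∈ N0, e ∉ a g := by
        intro g hg heg
        have := (Finset.mem_filter.1 hg).2
        rw [Finset.mem_sdiff] at he
        exact he.2 (this (Finset.mem_inter.2 ⟨heg, he.1⟩))
      constructor
      · intro H g hg hs
        exact H g hg ((hs.trans (Finset.erase_subset _ _)).trans (Finset.subset_insert _ _))
      · intro H g hg hs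
        refine H g hg (fun x hx => ?_)
        have hxe : x ≠ e := fun hh => hne g hg (hh ▸ hx)
        rcases Finset.mem_insert.1 (hs hx) with h' | h'
        · exact absurd h' hxe
        · exact Finset.mem_erase.2 ⟨hxe, h'⟩
  have s2 : ∀ g, ex q' (fun A => ind (h ∪ a g ⊆ A ∧ ∀ g ∈ N0, ¬ a g ⊆ A)) ≤
      (∏ e ∈ h, q' e) * (∏ e ∈ a g \ (U ∪ h), q e) * c0 := by
    intro g
    refine (harris_ud hq' (fun A B hAB h1 => h1.trans hAB)
      (fun A B hAB h1 g hg hs => h1 g hg (hs.trans hAB))).trans (le_of_eq ?_)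
    rw [ex_subset, ← Finset.union_sdiff_self_eq_union, Finset.prod_union Finset.disjoint_sdiff]
    congr 2
    rw [hq'def, prod_qon]
    apply Finset.prod_congr _ (fun _ _ => rfl)
    ext; simp; tauto
  have s3 : ex q' (fun A => ind (h ⊆ A ∧ ∀ g ∈ N0, ¬ a g ⊆ A)) -
      ∑ g ∈ N1, ex q' (fun A => ind (h ∪ a g ⊆ A ∧ ∀ g ∈ N0, ¬ a g ⊆ A)) ≤
      ex q' (fun A => ind (h ⊆ A ∧ ∀ g ∈ N, ¬ a g ⊆ A)) := by
    rw [← ex_sum, ← ex_sub]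
    apply ex_mono hq'
    intro A
    have hcov : ind (h ⊆ A ∧ ∀ g ∈ N0, ¬ a g ⊆ A) ≤
        ind ((h ⊆ A ∧ ∀ g ∈ N, ¬ a g ⊆ A) ∨
          ∃ g ∈ N1, (h ∪ a g ⊆ A ∧ ∀ g ∈ N0, ¬ a g ⊆ A)) := by
      apply ind_mono
      rintro ⟨h1, h2⟩
      by_cases h3 : ∀ g ∈ N, ¬ a g ⊆ A
      · exact Or.inl ⟨h1, h3⟩
      · push Not at h3
        obtain ⟨g, hg, hgA⟩ := h3
        refine Or.inr ⟨g, ?_, Finset.union_subset h1 hgA, h2⟩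
        refine Finset.mem_filter.2 ⟨hg, fun hh => h2 g (Finset.mem_filter.2 ⟨hg, hh⟩) hgA⟩
    have := hcov.trans ((ind_or_le _ _).trans (add_le_add le_rfl (ind_exists_le N1 _)))
    linarith
  have s4 : ∑ g ∈ N1, ex q' (fun A => ind (h ∪ a g ⊆ A ∧ ∀ g ∈ N0, ¬ a g ⊆ A)) ≤
      (∏ e ∈ h, q' e) * η * c0 := by
    refine (Finset.sum_le_sum (fun g _ => s2 g)).trans ?_
    rw [← Finset.sum_mul, ← Finset.mul_sum]
    gcongr
    exact prod_nonneg' hq' h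
  have s5 : ex q' (fun A => ind (∀ g ∈ N, ¬ a g ⊆ A)) ≤ c0 :=
    ex_mono hq' (fun A => ind_mono (fun H g hg => H g (Finset.mem_filter.1 hg).1))
  have s6 : ∏ e ∈ h, q e ≤ ∏ e ∈ h, q' e := by
    refine Finset.prod_le_prod (fun e _ => (hq e).1) (fun e _ => ?_)
    rw [hq'def]; unfold qon; split_ifs
    · exact (hq e).2
    · exact le_rfl
  have s7 : ((1 - η) * ∏ e ∈ h, q e) * ex q' (fun A => ind (∀ g ∈ N, ¬ a g ⊆ A)) ≤
      ex q' (fun A => ind (h ⊆ A ∧ ∀ g ∈ N, ¬ a g ⊆ A)) := by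
    calc ((1 - η) * ∏ e ∈ h, q e) * ex q' (fun A => ind (∀ g ∈ N, ¬ a g ⊆ A))
        ≤ ((1 - η) * ∏ e ∈ h, q' e) * c0 := by
          apply mul_le_mul _ s5 (ex_nonneg hq' (fun _ => ind_nonneg _))
          · exact mul_nonneg (by linarith) (prod_nonneg' hq' h)
          · exact mul_le_mul_of_nonneg_left s6 (by linarith)
      _ ≤ _ := by rw [s1] at s3; nlinarith [s3, s4]
  calc _ = (∏ e ∈ U, q e) * (((1 - η) * ∏ e ∈ h, q e) *
        ex q' (fun A => ind (∀ g ∈ N, ¬ a g ⊆ A))) := by ring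
    _ ≤ _ := mul_le_mul_of_nonneg_left s7 (prod_nonneg' hq U)

end Key

section Couple
variable {Ω ι : Type*} [Fintype Ω] [Fintype ι] [DecidableEq ι]

/-- Bernoulli probabilities equal to `x` on `J` and `0` outside. -/
def qJ (J : Finset ι) (x : ℝ) : ι → ℝ := fun i => if i ∈ J then x else 0

lemma Pq_qJ (J : Finset ι) {x : ℝ} (h0 : 0 ≤ x) (h1 : x ≤ 1) : Pq (qJ J x) := by
  intro i; unfold qJ; split_ifs
  · exact ⟨h0, h1⟩
  · norm_num

lemma bw_qJ_insert {j : ι} {J : Finset ι} (hj : j ∉ J) (x : ℝ) (H : Finset ι) :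
    bw (qJ (insert j J) x) H =
      if j ∈ H then x * bw (qJ J x) (H.erase j) else (1 - x) * bw (qJ J x) H := by
  have key : ∀ (q' : ι → ℝ) (K : Finset ι), bw q' K = (if j ∈ K then q' j else 1 - q' j) *
      ∏ y ∈ Finset.univ.erase j, (if y ∈ K then q' y else 1 - q' y) := by
    intro q' K; unfold bw
    exact (Finset.mul_prod_erase Finset.univ (fun y => if y ∈ K then q' y else 1 - q' y)
      (Finset.mem_univ j)).symm
  have hqj : qJ J x j = 0 := by simp [qJ, hj]
  have hqj' : qJ (insert j J) x j = x := by simp [qJ]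
  have e1 : ∀ y ∈ Finset.univ.erase j, qJ (insert j J) x y = qJ J x y := by
    intro y hy
    simp [qJ, Finset.ne_of_mem_erase hy]
  split_ifs with h
  · rw [key, key (qJ J x), hqj, hqj']
    simp only [h, if_true, Finset.mem_erase, ne_eq, not_true_eq_false, false_and, if_false,
      sub_zero, one_mul]
    congr 1
    refine Finset.prod_congr rfl (fun y hy => ?_)
    rw [e1 y hy]
    have : y ≠ j := Finset.ne_of_mem_erase hy
    simp [this]
  · rw [key, key (qJ J x), hqj, hqj']
    simp only [h, if_false, sub_zero, one_mul]
    congr 1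
    refine Finset.prod_congr rfl (fun y hy => ?_)
    rw [e1 y hy]

lemma bw_qJ_empty (x : ℝ) (H : Finset ι) : bw (qJ (∅ : Finset ι) x) H = ind (H = ∅) := by
  unfold bw qJ
  by_cases h : H = ∅
  · subst h; simp [ind]
  · rw [ind_neg h]
    obtain ⟨e, he⟩ := Finset.nonempty_iff_ne_empty.2 h
    exact Finset.prod_eq_zero (Finset.mem_univ e) (by simp [he])

lemma sum_split (j : ι) (f : Finset ι → ℝ) :
    ∑ H, f H = ∑ H ∈ Finset.univ.filter (fun H => j ∉ H), (f (insert j H) + f H) := by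
  rw [Finset.sum_add_distrib, ← Finset.sum_filter_add_sum_filter_not Finset.univ (fun H => j ∈ H)]
  congr 1
  refine Finset.sum_nbij' (fun H => H.erase j) (fun H => insert j H) ?_ ?_ ?_ ?_ ?_
  · intro H hH; simp
  · intro H hH; simp
  · intro H hH; simp only [Finset.mem_filter, Finset.mem_univ, true_and] at hH
    exact Finset.insert_erase hH
  · intro H hH; simp only [Finset.mem_filter, Finset.mem_univ, true_and] at hH
    exact Finset.erase_insert hH
  · intro H hH; simp only [Finset.mem_filter, Finset.mem_univ, true_and] at hH
    rw [Finset.insert_erase hH]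

/-- The abstract one-by-one revealing coupling. -/
lemma couple (A : ι → Ω → Prop) (x : ℝ) (hx0 : 0 ≤ x) (hx1 : x ≤ 1) (J : Finset ι) :
    ∀ (P : Ω → ℝ) (_ : ∀ ω, 0 ≤ P ω) (good : Finset ι → Prop)
      (_ : ∀ S T, S ⊆ T → good T → good S)
      (_ : ∀ j ∈ J, ∀ R ⊆ J, ∀ N ⊆ J, j ∉ R → j ∉ N → Disjoint R N → good (insert j R) →
        x * ∑ ω, P ω * ind ((∀ i ∈ R, A i ω) ∧ ∀ i ∈ N, ¬ A i ω) ≤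
          ∑ ω, P ω * ind (A j ω ∧ (∀ i ∈ R, A i ω) ∧ ∀ i ∈ N, ¬ A i ω)),
      ∃ γ : Ω → Finset ι → ℝ, (∀ ω H, 0 ≤ γ ω H) ∧ (∀ ω, ∑ H, γ ω H = P ω) ∧
        (∀ H, ∑ ω, γ ω H = (∑ ω, P ω) * bw (qJ J x) H) ∧
        (∀ ω H, γ ω H ≠ 0 → good H → ∀ j ∈ H, A j ω) := by
  induction J using Finset.induction_on with
  | empty =>
    intro P hP good hdown hyp
    refine ⟨fun ω H => P ω * ind (H = ∅), fun ω H => mul_nonneg (hP ω) (ind_nonneg _), ?_, ?_, ?_⟩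
    · intro ω
      rw [← Finset.mul_sum, Finset.sum_eq_single ∅]
      · rw [ind_pos rfl, mul_one]
      · intro H _ hH; exact ind_neg hH
      · intro h; exact absurd (Finset.mem_univ _) h
    · intro H
      rw [bw_qJ_empty, Finset.sum_mul]
    · intro ω H hne _ j hj
      exfalso; apply hne
      show P ω * ind (H = ∅) = 0
      rw [ind_neg (Finset.ne_empty_of_mem hj), mul_zero]
  | insert j J hj ih =>
    intro P hP good hdown hyp
    have hsubJ : J ⊆ insert j J := Finset.subset_insert _ _
    -- the coupling for the unchanged measure
    obtain ⟨γ2, h2n, h2a, h2b, h2c⟩ := ih P hP good hdown (by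
      intro j' hj' R hR N hN h1 h2 h3 h4
      exact hyp j' (hsubJ hj') R (hR.trans hsubJ) N (hN.trans hsubJ) h1 h2 h3 h4)
    by_cases hg : good {j}
    · set P1 : Ω → ℝ := fun ω => P ω * ind (A j ω) with hP1
      set P0 : Ω → ℝ := fun ω => P ω * ind (¬ A j ω) with hP0
      obtain ⟨γ1, h1n, h1a, h1b, h1c⟩ := ih P1 (fun ω => mul_nonneg (hP ω) (ind_nonneg _))
        (fun H => good (insert j H))
        (fun S T hST hT => hdown _ _ (Finset.insert_subset_insert j hST) hT) (by
          intro j' hj' R hR N hN h1 h2 h3 h4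
          have hne : j' ≠ j := fun h => hj (h ▸ hj')
          have := hyp j' (hsubJ hj') (insert j R) (Finset.insert_subset_insert j hR) N
            (hN.trans hsubJ) (by simp [hne, h1]) h2
            (by rw [Finset.disjoint_insert_left]; exact ⟨fun h => hj (hN h), h3⟩)
            (by rwa [Finset.insert_comm])
          refine le_trans (le_of_eq ?_) (this.trans (le_of_eq ?_))
          · congr 1
            refine Finset.sum_congr rfl (fun ω _ => ?_)
            rw [hP1]; simp only; rw [mul_assoc, ← ind_and]; congr 1; apply ind_congr
            simp only [Finset.forall_mem_insert]; tauto
          · refine Finset.sum_congr rfl (fun ω _ => ?_)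
            rw [hP1]; simp only; rw [mul_assoc, ← ind_and]; congr 1; apply ind_congr
            simp only [Finset.forall_mem_insert]; tauto)
      obtain ⟨γ3, h3n, h3a, h3b, h3c⟩ := ih P0 (fun ω => mul_nonneg (hP ω) (ind_nonneg _))
        good hdown (by
          intro j' hj' R hR N hN h1 h2 h3 h4
          have hne : j' ≠ j := fun h => hj (h ▸ hj')
          have := hyp j' (hsubJ hj') R (hR.trans hsubJ) (insert j N)
            (Finset.insert_subset_insert j hN) h1 (by simp [hne, h2])
            (by rw [Finset.disjoint_insert_right]; exact ⟨fun h => hj (hR h), h3⟩) h4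
          refine le_trans (le_of_eq ?_) (this.trans (le_of_eq ?_))
          · congr 1
            refine Finset.sum_congr rfl (fun ω _ => ?_)
            rw [hP0]; simp only; rw [mul_assoc, ← ind_and]; congr 1; apply ind_congr
            simp only [Finset.forall_mem_insert]; tauto
          · refine Finset.sum_congr rfl (fun ω _ => ?_)
            rw [hP0]; simp only; rw [mul_assoc, ← ind_and]; congr 1; apply ind_congr
            simp only [Finset.forall_mem_insert]; tauto)
      have hP10 : ∑ ω, P ω = ∑ ω, P1 ω + ∑ ω, P0 ω := by
        rw [← Finset.sum_add_distrib]
        refine Finset.sum_congr rfl (fun ω _ => ?_)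
        rw [hP1, hP0]; simp only; rw [ind_not]; ring
      have hP1n : 0 ≤ ∑ ω, P1 ω := Finset.sum_nonneg (fun ω _ => mul_nonneg (hP ω) (ind_nonneg _))
      have hPn : 0 ≤ ∑ ω, P ω := Finset.sum_nonneg (fun ω _ => hP ω)
      have hbase : x * ∑ ω, P ω ≤ ∑ ω, P1 ω := by
        have := hyp j (Finset.mem_insert_self _ _) ∅ (by simp) ∅ (by simp) (by simp) (by simp)
          (by simp) (by simpa using hg)
        simpa [ind_pos] using this
      set θ := x * (∑ ω, P ω) / ∑ ω, P1 ω with hθ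
      have hθ0 : 0 ≤ θ := div_nonneg (mul_nonneg hx0 hPn) hP1n
      have hθ1 : θ ≤ 1 := div_le_one_of_le₀ hbase hP1n
      have hθm : θ * ∑ ω, P1 ω = x * ∑ ω, P ω := by
        by_cases h0 : ∑ ω, P1 ω = 0
        · rw [h0, mul_zero]
          rw [h0] at hbase
          exact (le_antisymm hbase (mul_nonneg hx0 hPn)).symm
        · rw [hθ]; field_simp
      refine ⟨fun ω H => if j ∈ H then θ * γ1 ω (H.erase j) else
        (1 - θ) * γ2 ω H + θ * γ3 ω H, ?_, ?_, ?_, ?_⟩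
      · intro ω H
        simp only
        split_ifs
        · exact mul_nonneg hθ0 (h1n _ _)
        · exact add_nonneg (mul_nonneg (by linarith) (h2n _ _)) (mul_nonneg hθ0 (h3n _ _))
      · intro ω
        -- all three couplings are supported on sets not containing `j`
        have supp : ∀ (γ : Ω → Finset ι → ℝ) (c : ℝ), (∀ ω H, 0 ≤ γ ω H) →
            (∀ H, ∑ ω, γ ω H = c * bw (qJ J x) H) → ∀ H, j ∈ H → γ ω H = 0 := by
          intro γ c hn hb H hH
          have h0 : bw (qJ J x) H = 0 := by
            unfold bw
            exact Finset.prod_eq_zero (Finset.mem_univ j) (by simp [hH, qJ, hj])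
          have hs := hb H
          rw [h0, mul_zero] at hs
          exact (Finset.sum_eq_zero_iff_of_nonneg (fun ω _ => hn ω H)).1 hs ω (Finset.mem_univ _)
        have tot : ∀ γ : Ω → Finset ι → ℝ, (∀ H, j ∈ H → γ ω H = 0) →
            ∑ H, γ ω H = ∑ H ∈ Finset.univ.filter (fun H => j ∉ H), γ ω H := by
          intro γ h
          rw [sum_split j]
          refine Finset.sum_congr rfl (fun H _ => ?_)
          rw [h _ (Finset.mem_insert_self _ _), zero_add]
        have t1 := tot γ1 (supp γ1 _ h1n h1b)
        have t2 := tot γ2 (supp γ2 _ h2n h2b)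
        have t3 := tot γ3 (supp γ3 _ h3n h3b)
        rw [h1a] at t1; rw [h2a] at t2; rw [h3a] at t3
        rw [sum_split j]
        have : ∀ H ∈ Finset.univ.filter (fun H : Finset ι => j ∉ H),
            ((if j ∈ insert j H then θ * γ1 ω ((insert j H).erase j) else
              (1 - θ) * γ2 ω (insert j H) + θ * γ3 ω (insert j H)) +
            (if j ∈ H then θ * γ1 ω (H.erase j) else
              (1 - θ) * γ2 ω H + θ * γ3 ω H)) =
            θ * γ1 ω H + ((1 - θ) * γ2 ω H + θ * γ3 ω H) := by
          intro H hH
          simp only [Finset.mem_filter, Finset.mem_univ, true_and] at hH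
          rw [if_pos (Finset.mem_insert_self _ _), if_neg hH, Finset.erase_insert hH]
        rw [Finset.sum_congr rfl this, Finset.sum_add_distrib, Finset.sum_add_distrib,
          ← Finset.mul_sum, ← Finset.mul_sum, ← Finset.mul_sum, ← t1, ← t2, ← t3, hP1, hP0]
        simp only; rw [ind_not]; ring
      · intro H
        beta_reduce
        rw [bw_qJ_insert hj]
        split_ifs with h
        · rw [← Finset.mul_sum, h1b, ← mul_assoc, hθm]; ring
        · rw [Finset.sum_add_distrib, ← Finset.mul_sum, ← Finset.mul_sum, h2b, h3b]
          have : θ * ∑ ω, P0 ω = θ * ∑ ω, P ω - x * ∑ ω, P ω := by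
            rw [← hθm, hP10]; ring
          calc _ = ((1 - θ) * ∑ ω, P ω + θ * ∑ ω, P0 ω) * bw (qJ J x) H := by ring
            _ = _ := by rw [this]; ring
      · intro ω H hne hgood i hi
        simp only at hne
        split_ifs at hne with h
        · have hne' : γ1 ω (H.erase j) ≠ 0 := fun h0 => hne (by rw [h0, mul_zero])
          by_cases hij : i = j
          · subst hij
            -- `γ1 ≤ P1`, so the event holds
            by_contra hA
            have hP1z : P1 ω = 0 := by rw [hP1]; simp only; rw [ind_neg hA, mul_zero]
            have := h1a ω
            rw [hP1z] at this
            exact hne' ((Finset.sum_eq_zero_iff_of_nonneg (fun H _ => h1n ω H)).1 this _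
              (Finset.mem_univ _))
          · exact h1c ω _ hne' (by rwa [Finset.insert_erase h]) i (Finset.mem_erase.2 ⟨hij, hi⟩)
        · by_cases hz : γ2 ω H = 0
          · have : γ3 ω H ≠ 0 := fun h0 => hne (by rw [h0, hz]; ring)
            exact h3c ω H this hgood i hi
          · exact h2c ω H hz hgood i hi
    · refine ⟨fun ω H => if j ∈ H then x * (P ω * bw (qJ J x) (H.erase j)) else
        (1 - x) * γ2 ω H, ?_, ?_, ?_, ?_⟩
      · intro ω H
        simp only
        split_ifs
        · exact mul_nonneg hx0 (mul_nonneg (hP ω) (bw_nonneg (Pq_qJ J hx0 hx1) _))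
        · exact mul_nonneg (by linarith) (h2n _ _)
      · intro ω
        have hz : ∀ H, j ∈ H → bw (qJ J x) H = 0 := fun H hH => by
          unfold bw
          exact Finset.prod_eq_zero (Finset.mem_univ j) (by simp [hH, qJ, hj])
        have hz2 : ∀ H, j ∈ H → γ2 ω H = 0 := by
          intro H hH
          have hs := h2b H
          rw [hz H hH, mul_zero] at hs
          exact (Finset.sum_eq_zero_iff_of_nonneg (fun ω _ => h2n ω H)).1 hs ω (Finset.mem_univ _)
        have t1 := sum_bw (qJ J x)
        rw [sum_split j] at t1
        have t2 := h2a ω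
        rw [sum_split j] at t2
        rw [sum_split j]
        have : ∀ H ∈ Finset.univ.filter (fun H : Finset ι => j ∉ H),
            ((if j ∈ insert j H then x * (P ω * bw (qJ J x) ((insert j H).erase j)) else
              (1 - x) * γ2 ω (insert j H)) +
            (if j ∈ H then x * (P ω * bw (qJ J x) (H.erase j)) else (1 - x) * γ2 ω H)) =
            x * P ω * (bw (qJ J x) (insert j H) + bw (qJ J x) H) +
              (1 - x) * (γ2 ω (insert j H) + γ2 ω H) := by
          intro H hH
          simp only [Finset.mem_filter, Finset.mem_univ, true_and] at hH
          rw [if_pos (Finset.mem_insert_self _ _), if_neg hH, Finset.erase_insert hH,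
            hz _ (Finset.mem_insert_self _ _), hz2 _ (Finset.mem_insert_self _ _)]
          ring
        rw [Finset.sum_congr rfl this, Finset.sum_add_distrib, ← Finset.mul_sum,
          ← Finset.mul_sum, t1, t2]
        ring
      · intro H
        beta_reduce
        rw [bw_qJ_insert hj]
        split_ifs with h
        · rw [← Finset.mul_sum, ← Finset.sum_mul]; ring
        · rw [← Finset.mul_sum, h2b]; ring
      · intro ω H hne hgood i hi
        simp only at hne
        split_ifs at hne with h
        · exact absurd (hdown _ _ (Finset.singleton_subset_iff.2 h) hgood) hg
        · exact h2c ω H (fun h0 => hne (by rw [h0, mul_zero])) hgood i hi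

lemma avoid_le (A : ι → Ω → Prop) (x : ℝ) (hx1 : x ≤ 1) (P : Ω → ℝ) (K : Finset ι)
    (hyp : ∀ j ∈ K, ∀ N ⊆ K, j ∉ N →
        x * ∑ ω, P ω * ind (∀ i ∈ N, ¬ A i ω) ≤
          ∑ ω, P ω * ind (A j ω ∧ ∀ i ∈ N, ¬ A i ω)) (J : Finset ι) (hJ : J ⊆ K) :
    ∑ ω, P ω * ind (∀ i ∈ J, ¬ A i ω) ≤ (1 - x) ^ J.card * ∑ ω, P ω := by
  induction J using Finset.induction_on with
  | empty => simp [ind_pos]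
  | insert j J hj ih =>
    rw [Finset.card_insert_of_notMem hj, pow_succ]
    have ih' := ih ((Finset.subset_insert _ _).trans hJ)
    have h1 := hyp j (hJ (Finset.mem_insert_self _ _)) J ((Finset.subset_insert _ _).trans hJ) hj
    have h2 : ∑ ω, P ω * ind (∀ i ∈ insert j J, ¬ A i ω) =
        ∑ ω, P ω * ind (∀ i ∈ J, ¬ A i ω) - ∑ ω, P ω * ind (A j ω ∧ ∀ i ∈ J, ¬ A i ω) := by
      rw [← Finset.sum_sub_distrib]
      refine Finset.sum_congr rfl (fun ω _ => ?_)
      rw [← mul_sub]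
      congr 1
      have : ind (∀ i ∈ insert j J, ¬ A i ω) = ind (¬ A j ω ∧ ∀ i ∈ J, ¬ A i ω) :=
        ind_congr (by simp)
      rw [this, ind_and, ind_and, ind_not]; ring
    rw [h2]
    calc _ ≤ (1 - x) * ∑ ω, P ω * ind (∀ i ∈ J, ¬ A i ω) := by linarith
      _ ≤ (1 - x) * ((1 - x) ^ J.card * ∑ ω, P ω) :=
        mul_le_mul_of_nonneg_left ih' (by linarith)
      _ = _ := by ring

end Couple

/-! ## Part 3: the component inequality and the bound on `Q` -/

section Comp
variable {r : ℕ}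

lemma comp_ineq {F : Finset (Finset (Fin r))} (hB : StrictlyOneBalanced F)
    (hF2 : ∀ e ∈ F, 2 ≤ e.card) {E' : Finset (Finset (Fin r))} (hsub : E' ⊆ F) (hne : E' ≠ F)
    (hE : E'.Nonempty) (c : Fin r → Fin r) (hc : ∀ e ∈ E', ∀ x ∈ e, ∀ y ∈ e, c x = c y) :
    E'.card * (r - 1) < F.card * (r - (Finset.univ.image c).card) := by
  set I := Finset.univ.image c with hI
  set K : Fin r → Finset (Fin r) := fun i => Finset.univ.filter (fun x => c x = i) with hK
  set Ei : Fin r → Finset (Finset (Fin r)) := fun i => E'.filter (fun e => e ⊆ K i) with hEi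
  have hKsum : ∑ i ∈ I, (K i).card = r := by
    have := Finset.card_eq_sum_card_image c (Finset.univ : Finset (Fin r))
    simpa using this.symm
  have hKpos : ∀ i ∈ I, 1 ≤ (K i).card := by
    intro i hi
    obtain ⟨x, _, hx⟩ := Finset.mem_image.1 hi
    exact Finset.card_pos.2 ⟨x, by simp [hK, hx]⟩
  have hcov : E' ⊆ I.biUnion Ei := by
    intro e he
    have h2 := hF2 e (hsub he)
    obtain ⟨x, hx⟩ := Finset.card_pos.1 (by omega : 0 < e.card)
    refine Finset.mem_biUnion.2 ⟨c x, Finset.mem_image_of_mem _ (Finset.mem_univ _), ?_⟩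
    refine Finset.mem_filter.2 ⟨he, fun y hy => ?_⟩
    simp only [hK, Finset.mem_filter, Finset.mem_univ, true_and]
    exact hc e he y hy x hx
  have hEsum : E'.card ≤ ∑ i ∈ I, (Ei i).card :=
    (Finset.card_le_card hcov).trans Finset.card_biUnion_le
  have hsum' : ∑ i ∈ I, ((K i).card - 1) = r - I.card := by
    have : ∑ i ∈ I, ((K i).card - 1) + I.card = r := by
      refine Eq.trans ?_ hKsum
      rw [Finset.card_eq_sum_ones, ← Finset.sum_add_distrib]
      exact Finset.sum_congr rfl (fun i hi => Nat.sub_add_cancel (hKpos i hi))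
    omega
  have hstr : ∀ i, 1 < (K i).card → (Ei i).card * (r - 1) < F.card * ((K i).card - 1) := by
    intro i hi
    refine hB (K i) (Ei i) ((Finset.filter_subset _ _).trans hsub)
      (fun e he => (Finset.mem_filter.1 he).2) hi ?_
    rintro ⟨-, h⟩
    exact hne (Finset.Subset.antisymm hsub (h ▸ Finset.filter_subset _ _))
  have hle : ∀ i ∈ I, (Ei i).card * (r - 1) ≤ F.card * ((K i).card - 1) := by
    intro i hi
    rcases (hKpos i hi).lt_or_eq with h | h
    · exact (hstr i h).le
    · have : Ei i = ∅ := by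
        apply Finset.eq_empty_of_forall_notMem
        intro e he
        have h1 := Finset.card_le_card (Finset.mem_filter.1 he).2
        have h2 := hF2 e (hsub (Finset.mem_filter.1 he).1)
        omega
      simp [this]
  obtain ⟨e, he⟩ := hE
  obtain ⟨i, hi, hei⟩ := Finset.mem_biUnion.1 (hcov he)
  have h1 : 1 < (K i).card := by
    have h1 := Finset.card_le_card (Finset.mem_filter.1 hei).2
    have h2 := hF2 e (hsub (Finset.mem_filter.1 hei).1)
    omega
  calc E'.card * (r - 1) ≤ (∑ i ∈ I, (Ei i).card) * (r - 1) := Nat.mul_le_mul_right _ hEsum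
    _ = ∑ i ∈ I, (Ei i).card * (r - 1) := Finset.sum_mul _ _ _
    _ < ∑ i ∈ I, F.card * ((K i).card - 1) := Finset.sum_lt_sum hle ⟨i, hi, hstr i h1⟩
    _ = _ := by rw [← Finset.mul_sum, hsum']

/-- `y` is reached from `x` by exactly `k` steps inside edges of `E'`. -/
def stepR (E' : Finset (Finset (Fin r))) : ℕ → Fin r → Fin r → Prop
  | 0, x, y => x = y
  | k + 1, x, y => ∃ z, stepR E' k x z ∧ ∃ e ∈ E', z ∈ e ∧ y ∈ e

lemma exists_comp (E' : Finset (Finset (Fin r))) :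
    ∃ c : Fin r → Fin r, (∀ e ∈ E', ∀ x ∈ e, ∀ y ∈ e, c x = c y) ∧
      (∀ x, c (c x) = c x) ∧ ∀ x, (∃ k ≤ r, stepR E' k (c x) x) ∧ ∃ k ≤ r, stepR E' k x (c x) := by
  let G : SimpleGraph (Fin r) := SimpleGraph.fromRel (fun x y => ∃ e ∈ E', x ∈ e ∧ y ∈ e)
  have hG : ∀ x y, G.Adj x y → ∃ e ∈ E', x ∈ e ∧ y ∈ e := by
    intro x y h
    rw [SimpleGraph.fromRel_adj] at h
    rcases h with ⟨_, h | ⟨e, he, h1, h2⟩⟩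
    · exact h
    · exact ⟨e, he, h2, h1⟩
  have hw : ∀ x y (w : G.Walk y x), stepR E' w.length x y := by
    intro x y w
    induction w with
    | nil => exact rfl
    | cons h p ih =>
      obtain ⟨e, he, h1, h2⟩ := hG _ _ h
      exact ⟨_, ih, e, he, h2, h1⟩
  have hreach : ∀ x y, G.Reachable x y → ∃ k ≤ r, stepR E' k x y := by
    intro x y h
    obtain ⟨p, hp⟩ := h.symm.exists_isPath
    refine ⟨p.length, ?_, hw _ _ p⟩
    have := hp.length_lt
    simp at this
    omega
  refine ⟨fun x => (G.connectedComponentMk x).out, ?_, ?_, ?_⟩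
  · intro e he x hx y hy
    by_cases hxy : x = y
    · rw [hxy]
    · have : G.Adj x y := by
        rw [SimpleGraph.fromRel_adj]; exact ⟨hxy, Or.inl ⟨e, he, hx, hy⟩⟩
      have : G.connectedComponentMk x = G.connectedComponentMk y :=
        SimpleGraph.ConnectedComponent.eq.2 this.reachable
      simp only [this]
  · intro x
    have : G.connectedComponentMk (G.connectedComponentMk x).out = G.connectedComponentMk x :=
      Quot.out_eq _
    simp only [this]
  · intro x
    have : G.connectedComponentMk (G.connectedComponentMk x).out = G.connectedComponentMk x :=
      Quot.out_eq _
    have h := SimpleGraph.ConnectedComponent.eq.1 this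
    exact ⟨hreach _ _ h, hreach _ _ h.symm⟩

end Comp

section Ball
variable {V : Type*} [Fintype V] [DecidableEq V]

/-- Iterated closed neighbourhoods. -/
def ballN (Nb : V → Finset V) : ℕ → V → Finset V
  | 0, x => {x}
  | k + 1, x => (ballN Nb k x).biUnion Nb

lemma ballN_card {Nb : V → Finset V} {m : ℕ} (hm : ∀ x, (Nb x).card ≤ m) (k : ℕ) (x : V) :
    (ballN Nb k x).card ≤ m ^ k := by
  induction k with
  | zero => simp [ballN]
  | succ k ih =>
    rw [pow_succ]
    exact (Finset.card_biUnion_le_card_mul _ _ m (fun y _ => hm y)).trans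
      (Nat.mul_le_mul_right _ ih)

lemma ballN_mono {Nb : V → Finset V} (h : ∀ x, x ∈ Nb x) {k l : ℕ} (hkl : k ≤ l) (x : V) :
    ballN Nb k x ⊆ ballN Nb l x := by
  induction hkl with
  | refl => exact Finset.Subset.refl _
  | step _ ih => exact ih.trans (fun y hy => Finset.mem_biUnion.2 ⟨y, hy, h y⟩)

lemma stepR_ball {r : ℕ} {E' : Finset (Finset (Fin r))} {Nb : V → Finset V} {φ : Fin r → V}
    (hφ : ∀ e ∈ E', ∀ x ∈ e, ∀ y ∈ e, φ y ∈ Nb (φ x)) {k : ℕ} :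
    ∀ {x y : Fin r}, stepR E' k x y → φ y ∈ ballN Nb k (φ x) := by
  induction k with
  | zero => intro x y h; rw [show x = y from h]; simp [ballN]
  | succ k ih =>
    rintro x y ⟨z, hz, e, he, h1, h2⟩
    exact Finset.mem_biUnion.2 ⟨φ z, ih hz, hφ e he z h1 y h2⟩

/-- Counting maps that respect a neighbourhood structure. -/
lemma count_maps {r : ℕ} (E' : Finset (Finset (Fin r))) (Nb : V → Finset V)
    (hself : ∀ x, x ∈ Nb x) {m : ℕ} (hm : ∀ x, (Nb x).card ≤ m) (W : Finset V)
    (c : Fin r → Fin r) (hcc : ∀ x, c (c x) = c x)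
    (hst : ∀ x, (∃ k ≤ r, stepR E' k (c x) x) ∧ ∃ k ≤ r, stepR E' k x (c x)) :
    (Finset.univ.filter (fun φ : Fin r → V =>
      (∀ e ∈ E', ∀ x ∈ e, ∀ y ∈ e, φ y ∈ Nb (φ x)) ∧ ∃ x, φ x ∈ W)).card ≤
      r * W.card * ((m ^ r) ^ (r + 1) *
        (Fintype.card V) ^ ((Finset.univ.image c).card - 1)) := by
  set b := m ^ r with hb
  set I := Finset.univ.image c with hI
  set B : V → Finset V := ballN Nb r with hBdef
  have hBc : ∀ x, (B x).card ≤ b := fun x => ballN_card hm r x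
  let A : Fin r → V → Fin r → Finset V := fun x0 y i =>
    if i = c x0 then B y else if i ∈ I then Finset.univ else {y}
  have hA : ∀ x0 y, (Fintype.piFinset (A x0 y)).card ≤ b * (Fintype.card V) ^ (I.card - 1) := by
    intro x0 y
    rw [Fintype.card_piFinset]
    have hmem : c x0 ∈ I := Finset.mem_image_of_mem _ (Finset.mem_univ _)
    rw [← Finset.mul_prod_erase Finset.univ _ (Finset.mem_univ (c x0))]
    refine Nat.mul_le_mul ?_ ?_
    · simp only [A, if_true]; exact hBc y
    · have : ∀ i ∈ Finset.univ.erase (c x0), (A x0 y i).card =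
          if i ∈ I then Fintype.card V else 1 := by
        intro i hi
        simp only [A, if_neg (Finset.ne_of_mem_erase hi)]
        split_ifs <;> simp
      rw [Finset.prod_congr rfl this, Finset.prod_ite, Finset.prod_const, Finset.prod_const_one,
        mul_one]
      apply le_of_eq
      congr 1
      rw [← Finset.card_erase_of_mem hmem]
      congr 1
      ext i; simp
  have hsub : (Finset.univ.filter (fun φ : Fin r → V =>
      (∀ e ∈ E', ∀ x ∈ e, ∀ y ∈ e, φ y ∈ Nb (φ x)) ∧ ∃ x, φ x ∈ W)) ⊆
      ((Finset.univ : Finset (Fin r)) ×ˢ W).biUnion (fun z =>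
        (Fintype.piFinset (A z.1 z.2)).biUnion (fun ρ =>
          Fintype.piFinset (fun x => B (ρ (c x))))) := by
    intro φ hφ
    obtain ⟨h1, x0, hx0⟩ := (Finset.mem_filter.1 hφ).2
    refine Finset.mem_biUnion.2 ⟨(x0, φ x0), by simp [hx0], ?_⟩
    refine Finset.mem_biUnion.2 ⟨fun i => if i ∈ I then φ i else φ x0, ?_, ?_⟩
    · rw [Fintype.mem_piFinset]
      intro i
      simp only [A]
      split_ifs with h2 h3
      · obtain ⟨k, hk, hs⟩ := (hst x0).2
        rw [h2]
        exact ballN_mono hself hk _ (stepR_ball h1 hs)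
      · have : i ∈ I := by rw [h2]; exact Finset.mem_image_of_mem _ (Finset.mem_univ _)
        exact absurd this h3
      · simp
      · simp
    · rw [Fintype.mem_piFinset]
      intro x
      have hcx : c x ∈ I := Finset.mem_image_of_mem _ (Finset.mem_univ _)
      beta_reduce
      rw [if_pos hcx]
      obtain ⟨k, hk, hs⟩ := (hst x).1
      exact ballN_mono hself hk _ (stepR_ball h1 hs)
  refine (Finset.card_le_card hsub).trans ?_
  refine (Finset.card_biUnion_le_card_mul _ _ (b ^ (r+1) * (Fintype.card V) ^ (I.card - 1)) ?_).trans ?_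
  · intro z _
    refine (Finset.card_biUnion_le_card_mul _ _ (b ^ r) ?_).trans ?_
    · intro ρ _
      rw [Fintype.card_piFinset]
      refine (Finset.prod_le_prod' (fun x _ => hBc _)).trans ?_
      simp
    · refine (Nat.mul_le_mul_right _ (hA z.1 z.2)).trans (le_of_eq ?_)
      rw [pow_succ]; ring
  · rw [Finset.card_product]; simp

end Ball

/-! ## Part 4: basic facts on copies and the bound on `Q` for copies -/

lemma sum_ind {ι : Type*} (s : Finset ι) (P : ι → Prop) [DecidablePred P] :
    ∑ i ∈ s, ind (P i) = ((s.filter P).card : ℝ) := by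
  rw [Finset.card_filter]; push_cast
  refine Finset.sum_congr rfl (fun i _ => ?_)
  by_cases h : P i <;> simp [ind, h]

/-- The standing hypotheses on `F`. -/
structure NF (u : ℕ) {r : ℕ} (F : Finset (Finset (Fin r))) : Prop where
  hu : 2 ≤ u
  hr : 4 ≤ r
  card : ∀ e ∈ F, e.card = u
  nice : Nice u F

section Copies
variable {u r : ℕ} {F : Finset (Finset (Fin r))}

lemma NF.cover (hF : NF u F) (x : Fin r) : ∃ e ∈ F, x ∈ e := by
  have hr := hF.hr
  have : Nontrivial (Fin r) := Fin.nontrivial_iff_two_le.2 (by omega)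
  obtain ⟨y, hy⟩ := exists_ne x
  have h := hF.nice.2.1.2 ∅ (by simp) x y (by simp) (by simp)
  rcases Relation.ReflTransGen.cases_head h with h1 | ⟨z, ⟨e, he, _, hx, _⟩, _⟩
  · exact absurd h1.symm hy
  · exact ⟨e, he, hx⟩

lemma NF.pos (hF : NF u F) : 0 < F.card := by
  have hr := hF.hr
  obtain ⟨e, he, _⟩ := hF.cover ⟨0, by omega⟩
  exact Finset.card_pos.2 ⟨e, he⟩

variable {n : ℕ} {g h : FE n}

lemma mem_all : h ∈ allFEdges F n ↔ IsFEdge F n h := by simp [allFEdges]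

lemma fe_card1 (hh : h ∈ allFEdges F n) : h.1.card = r := by
  obtain ⟨φ, h1, _⟩ := mem_all.1 hh
  rw [h1]; simp

lemma fe_card2 (hh : h ∈ allFEdges F n) : h.2.card = F.card := by
  obtain ⟨φ, _, h2⟩ := mem_all.1 hh
  rw [h2, Finset.card_image_of_injective]
  exact Finset.map_injective φ

lemma fe_edge_card (hF : NF u F) (hh : h ∈ allFEdges F n) {e : Finset (Fin n)} (he : e ∈ h.2) :
    e.card = u := by
  obtain ⟨φ, _, h2⟩ := mem_all.1 hh
  rw [h2] at he
  obtain ⟨e', he', rfl⟩ := Finset.mem_image.1 he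
  rw [Finset.card_map]; exact hF.card e' he'

lemma fe_edge_sub (hh : h ∈ allFEdges F n) {e : Finset (Fin n)} (he : e ∈ h.2) : e ⊆ h.1 := by
  obtain ⟨φ, h1, h2⟩ := mem_all.1 hh
  rw [h2] at he
  obtain ⟨e', he', rfl⟩ := Finset.mem_image.1 he
  rw [h1]; exact Finset.map_subset_map.2 (Finset.subset_univ _)

lemma fe_sub_all (hF : NF u F) (hh : h ∈ allFEdges F n) : h.2 ⊆ allUEdges u n := by
  intro e he
  simp [allUEdges, fe_edge_card hF hh he]

lemma fe_cover (hF : NF u F) (hh : h ∈ allFEdges F n) {v : Fin n} (hv : v ∈ h.1) :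
    ∃ e ∈ h.2, v ∈ e := by
  obtain ⟨φ, h1, h2⟩ := mem_all.1 hh
  rw [h1] at hv
  obtain ⟨x, _, rfl⟩ := Finset.mem_map.1 hv
  obtain ⟨e, he, hx⟩ := hF.cover x
  exact ⟨e.map φ, by rw [h2]; exact Finset.mem_image_of_mem _ he, Finset.mem_map_of_mem _ hx⟩

lemma fe_eq (hF : NF u F) (hg : g ∈ allFEdges F n) (hh : h ∈ allFEdges F n) (hs : g.2 ⊆ h.2) :
    g = h := by
  have h2 : g.2 = h.2 :=
    Finset.eq_of_subset_of_card_le hs (by rw [fe_card2 hg, fe_card2 hh])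
  have h1 : g.1 = h.1 := by
    ext v; constructor
    · intro hv
      obtain ⟨e, he, hve⟩ := fe_cover hF hg hv
      exact fe_edge_sub hh (hs he) hve
    · intro hv
      obtain ⟨e, he, hve⟩ := fe_cover hF hh hv
      exact fe_edge_sub hg (h2 ▸ he) hve
  exact Prod.ext h1 h2

lemma prod_qJ {ι : Type*} [DecidableEq ι] {J T : Finset ι} (h : T ⊆ J) (p : ℝ) :
    ∏ e ∈ T, qJ J p e = p ^ T.card := by
  rw [Finset.prod_congr rfl (fun e he => by rw [qJ, if_pos (h he)]), Finset.prod_const]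

/-- The good `F`-graphs: bounded degrees, and no extra copies. -/
def Good (F : Finset (Finset (Fin r))) (d : ℕ) (H : Finset (FE n)) : Prop :=
  (∀ v, degFE H v ≤ d) ∧ ∀ h ∈ allFEdges F n, ¬ h.2 ⊆ (H.erase h).biUnion Prod.snd

lemma good_down {d : ℕ} {S T : Finset (FE n)} (hST : S ⊆ T) (hT : Good F d T) : Good F d S := by
  refine ⟨fun v => (Finset.card_le_card (Finset.filter_subset_filter _ hST)).trans (hT.1 v),
    fun h hh hs => hT.2 h hh (hs.trans ?_)⟩
  exact Finset.biUnion_subset_biUnion_of_subset_left _ (Finset.erase_subset_erase _ hST)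

/-- The error term. -/
def etaB (r s d : ℕ) (Λ : ℝ) (n : ℕ) : ℝ :=
  2 ^ s * (r * r * ((((r * d + 1) ^ r) ^ (r + 1) : ℕ) : ℝ)) * (Λ * (n : ℝ) ^ (-(1 / (s : ℝ))))

lemma term_bound {s e i R n : ℕ} {p Λ : ℝ} (hs : 0 < s) (hn : 1 ≤ n) (hp0 : 0 ≤ p)
    (hΛ : 1 ≤ Λ) (hpn : (n : ℝ) ^ R * p ^ s ≤ Λ) (he : e ≤ s)
    (hlt : s * i + 1 ≤ R * (s - e)) :
    p ^ (s - e) * (n : ℝ) ^ i ≤ Λ * (n : ℝ) ^ (-(1 / (s : ℝ))) := by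
  have hn0 : (0 : ℝ) < n := by exact_mod_cast hn
  have hn1 : (1 : ℝ) ≤ n := by exact_mod_cast hn
  have hR0 : 0 ≤ Λ * (n : ℝ) ^ (-(1 / (s : ℝ))) := by positivity
  refine le_of_pow_le_pow_left₀ hs.ne' hR0 ?_
  have h1 : ((n : ℝ) ^ (-(1 / (s : ℝ)))) ^ s = (n : ℝ)⁻¹ := by
    rw [← Real.rpow_natCast, ← Real.rpow_mul hn0.le]
    have : -(1 / (s : ℝ)) * s = -1 := by
      have : (s : ℝ) ≠ 0 := by exact_mod_cast hs.ne'
      field_simp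
    rw [this, Real.rpow_neg_one]
  rw [mul_pow Λ, h1]
  rw [← div_eq_mul_inv, le_div_iff₀ hn0]
  calc (p ^ (s - e) * (n : ℝ) ^ i) ^ s * n = (p ^ s) ^ (s - e) * (n : ℝ) ^ (s * i + 1) := by ring
    _ ≤ (p ^ s) ^ (s - e) * (n : ℝ) ^ (R * (s - e)) := by gcongr
    _ = ((n : ℝ) ^ R * p ^ s) ^ (s - e) := by rw [pow_mul]; ring
    _ ≤ Λ ^ (s - e) := by gcongr
    _ ≤ Λ ^ s := pow_le_pow_right₀ hΛ (Nat.sub_le _ _)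

lemma Q_bound (hF : NF u F) {d : ℕ} {R N : Finset (FE n)} (hR : R ⊆ allFEdges F n)
    (hN : N ⊆ allFEdges F n) (hh : h ∈ allFEdges F n) (hhN : h ∉ N) (hRN : Disjoint R N)
    (hg : Good F d (insert h R)) {p Λ : ℝ} (hp0 : 0 ≤ p) (hΛ : 1 ≤ Λ)
    (hpn : (n : ℝ) ^ (r - 1) * p ^ F.card ≤ Λ) :
    ∑ g ∈ N.filter (fun g => ¬ (g.2 ∩ h.2 ⊆ R.biUnion Prod.snd)),
      ∏ e ∈ g.2 \ (R.biUnion Prod.snd ∪ h.2), qJ (allUEdges u n) p e ≤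
      etaB r F.card d Λ n := by
  set U' := R.biUnion Prod.snd ∪ h.2 with hU'
  have hU'eq : U' = (insert h R).biUnion Prod.snd := by
    rw [Finset.biUnion_insert, Finset.union_comm]
  set N1 := N.filter (fun g => ¬ (g.2 ∩ h.2 ⊆ R.biUnion Prod.snd)) with hN1
  have hr := hF.hr
  have hn : 1 ≤ n := by
    have h1 := fe_card1 hh
    have h2 := Finset.card_le_univ h.1
    simp at h2; omega
  -- choose an embedding for each copy
  have hΦ : ∀ g : FE n, ∃ φ : Fin r → Fin n, g ∈ allFEdges F n →
      Function.Injective φ ∧ g.1 = Finset.univ.image φ ∧ g.2 = F.image (fun e => e.image φ) := by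
    intro g
    by_cases hgm : g ∈ allFEdges F n
    · obtain ⟨φ, h1, h2⟩ := mem_all.1 hgm
      refine ⟨φ, fun _ => ⟨φ.injective, ?_, ?_⟩⟩
      · rw [h1, Finset.map_eq_image]
      · rw [h2]; simp only [Finset.map_eq_image]
    · exact ⟨fun _ => ⟨0, by omega⟩, fun hgm' => absurd hgm' hgm⟩
  choose Φ hΦ using hΦ
  -- neighbourhoods
  let Nb : Fin n → Finset (Fin n) := fun x =>
    insert x (((insert h R).filter (fun k => x ∈ k.1)).biUnion Prod.fst)
  have hNbself : ∀ x, x ∈ Nb x := fun x => Finset.mem_insert_self _ _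
  have hall : insert h R ⊆ allFEdges F n := Finset.insert_subset hh hR
  have hNbc : ∀ x, (Nb x).card ≤ r * d + 1 := by
    intro x
    refine (Finset.card_insert_le _ _).trans (Nat.add_le_add_right ?_ 1)
    refine (Finset.card_biUnion_le_card_mul _ _ r ?_).trans ?_
    · intro k hk
      exact (fe_card1 (hall (Finset.mem_filter.1 hk).1)).le
    · rw [mul_comm]; exact Nat.mul_le_mul_left _ (hg.1 x)
  let Ee : (Fin r → Fin n) → Finset (Finset (Fin r)) := fun φ => F.filter (fun e => e.image φ ∈ U')
  let cnd : Finset (Finset (Fin r)) → (Fin r → Fin n) → Prop := fun E' φ =>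
    (∀ e ∈ E', ∀ x ∈ e, ∀ y ∈ e, φ y ∈ Nb (φ x)) ∧ ∃ x, φ x ∈ h.1
  let PS := F.powerset.filter (fun E' => E' ≠ F ∧ E'.Nonempty)
  have hterm : ∀ g ∈ N1, ∏ e ∈ g.2 \ U', qJ (allUEdges u n) p e ≤
      ∑ E' ∈ PS, p ^ (F.card - E'.card) * ind (cnd E' (Φ g)) := by
    intro g hg1
    have hgN := (Finset.mem_filter.1 hg1).1
    have hgx := (Finset.mem_filter.1 hg1).2
    obtain ⟨hinj, he1, he2⟩ := hΦ g (hN hgN)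
    have hginsert : g ∉ insert h R := by
      intro hh'
      rcases Finset.mem_insert.1 hh' with h1 | h1
      · exact hhN (h1 ▸ hgN)
      · exact (Finset.disjoint_left.1 hRN h1) hgN
    have himinj : Function.Injective (fun e : Finset (Fin r) => e.image (Φ g)) :=
      Finset.image_injective hinj
    have hcard : (g.2 \ U').card = F.card - (Ee (Φ g)).card := by
      have : g.2 \ U' = (F \ Ee (Φ g)).image (fun e => e.image (Φ g)) := by
        ext e
        simp only [Finset.mem_sdiff, he2, Finset.mem_image, Ee, Finset.mem_filter]
        constructor
        · rintro ⟨⟨e', h1, rfl⟩, h2⟩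
          exact ⟨e', ⟨h1, fun h3 => h2 h3.2⟩, rfl⟩
        · rintro ⟨e', ⟨h1, h2⟩, rfl⟩
          exact ⟨⟨e', h1, rfl⟩, fun h3 => h2 ⟨h1, h3⟩⟩
      rw [this, Finset.card_image_of_injective _ himinj,
        Finset.card_sdiff_of_subset (Finset.filter_subset _ _)]
    rw [prod_qJ (Finset.sdiff_subset.trans (fe_sub_all hF (hN hgN))), hcard]
    -- an edge in common with `h`
    obtain ⟨e0, he0, he0'⟩ := Finset.not_subset.1 hgx
    rw [Finset.mem_inter] at he0
    have he0g := he0.1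
    rw [he2] at he0g
    obtain ⟨e0', he0F, he0eq⟩ := Finset.mem_image.1 he0g
    have he0mem : e0' ∈ Ee (Φ g) := by
      refine Finset.mem_filter.2 ⟨he0F, ?_⟩
      rw [he0eq]; exact Finset.mem_union_right _ he0.2
    have hPS : Ee (Φ g) ∈ PS := by
      refine Finset.mem_filter.2 ⟨Finset.mem_powerset.2 (Finset.filter_subset _ _), ?_, ⟨_, he0mem⟩⟩
      intro heq
      refine hg.2 g (hN hgN) ?_
      rw [Finset.erase_eq_of_notMem hginsert, ← hU'eq, he2]
      intro e he
      obtain ⟨e', he', rfl⟩ := Finset.mem_image.1 he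
      rw [← heq] at he'
      exact (Finset.mem_filter.1 he').2
    have hc : cnd (Ee (Φ g)) (Φ g) := by
      constructor
      · intro e he x hx y hy
        have h1 := (Finset.mem_filter.1 he).2
        rw [hU'eq] at h1
        obtain ⟨k, hk, hek⟩ := Finset.mem_biUnion.1 h1
        have hsub := fe_edge_sub (hall hk) hek
        refine Finset.mem_insert_of_mem (Finset.mem_biUnion.2 ⟨k, Finset.mem_filter.2 ⟨hk, ?_⟩, ?_⟩)
        · exact hsub (Finset.mem_image_of_mem _ hx)
        · exact hsub (Finset.mem_image_of_mem _ hy)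
      · have hu := hF.hu
        obtain ⟨x, hx⟩ := Finset.card_pos.1 (by rw [hF.card e0' he0F]; omega : 0 < e0'.card)
        refine ⟨x, fe_edge_sub hh he0.2 ?_⟩
        rw [← he0eq]; exact Finset.mem_image_of_mem _ hx
    refine le_trans (le_of_eq ?_) (Finset.single_le_sum (f := fun E' =>
      p ^ (F.card - E'.card) * ind (cnd E' (Φ g)))
      (fun E' _ => mul_nonneg (pow_nonneg hp0 _) (ind_nonneg _)) hPS)
    rw [ind_pos hc, mul_one]
  have hinj : Set.InjOn Φ (N1 : Set (FE n)) := by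
    intro g hg1 g' hg2 heq
    obtain ⟨_, a1, a2⟩ := hΦ g (hN (Finset.mem_filter.1 hg1).1)
    obtain ⟨_, b1, b2⟩ := hΦ g' (hN (Finset.mem_filter.1 hg2).1)
    exact Prod.ext (by rw [a1, b1, heq]) (by rw [a2, b2, heq])
  have hs := hF.pos
  have hcount : ∀ E' ∈ PS, ∑ φ : Fin r → Fin n, p ^ (F.card - E'.card) * ind (cnd E' φ) ≤
      (r * r * ((((r * d + 1) ^ r) ^ (r + 1) : ℕ) : ℝ)) * (Λ * (n : ℝ) ^ (-(1 / (F.card : ℝ)))) := by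
    intro E' hE'
    obtain ⟨h1, h2, h3⟩ := Finset.mem_filter.1 hE'
    have h1 := Finset.mem_powerset.1 h1
    obtain ⟨c, hc1, hc2, hc3⟩ := exists_comp E'
    have hci := comp_ineq hF.nice.1 (fun e he => by rw [hF.card e he]; exact hF.hu) h1 h2 h3 c hc1
    have hcm := count_maps E' Nb hNbself hNbc h.1 c hc2 hc3
    rw [fe_card1 hh, Fintype.card_fin] at hcm
    set i := (Finset.univ.image c).card with hi
    have hi1 : 1 ≤ i := Finset.card_pos.2
      ⟨c ⟨0, by omega⟩, Finset.mem_image_of_mem _ (Finset.mem_univ _)⟩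
    have hir : i ≤ r := by
      have := Finset.card_le_univ (Finset.univ.image c); simpa using this
    have hecard : E'.card ≤ F.card := Finset.card_le_card h1
    have hlt : F.card * (i - 1) + 1 ≤ (r - 1) * (F.card - E'.card) := by
      clear_value i
      obtain ⟨i', rfl⟩ : ∃ i', i = i' + 1 := ⟨i - 1, by omega⟩
      obtain ⟨r', hr'⟩ : ∃ r', r = i' + 1 + r' := ⟨r - (i' + 1), by omega⟩
      obtain ⟨t, ht⟩ : ∃ t, F.card = E'.card + t := ⟨F.card - E'.card, by omega⟩
      have e1 : r - 1 = i' + r' := by omega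
      have e2 : r - (i' + 1) = r' := by omega
      have e3 : F.card - E'.card = t := by omega
      rw [e1, e2] at hci
      rw [e1, e3, Nat.add_sub_cancel]
      rw [ht] at hci ⊢
      nlinarith
    have htb := term_bound hs hn hp0 hΛ hpn hecard hlt
    have hsumeq : ∑ φ : Fin r → Fin n, p ^ (F.card - E'.card) * ind (cnd E' φ) =
        p ^ (F.card - E'.card) * ((Finset.univ.filter (fun φ => cnd E' φ)).card : ℝ) := by
      rw [← Finset.mul_sum, sum_ind]
    rw [hsumeq]
    have hcm' : ((Finset.univ.filter (fun φ => cnd E' φ)).card : ℝ) ≤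
        (r * r * (((((r * d + 1) ^ r) ^ (r + 1) : ℕ) : ℝ) * (n : ℝ) ^ (i - 1))) := by
      have : (Finset.univ.filter (fun φ => cnd E' φ)).card ≤
        r * r * (((r * d + 1) ^ r) ^ (r + 1) * n ^ (i - 1)) := by
          convert hcm using 2
      exact_mod_cast this
    calc _ ≤ p ^ (F.card - E'.card) *
          (r * r * (((((r * d + 1) ^ r) ^ (r + 1) : ℕ) : ℝ) * (n : ℝ) ^ (i - 1))) :=
          mul_le_mul_of_nonneg_left hcm' (pow_nonneg hp0 _)
      _ = (r * r * ((((r * d + 1) ^ r) ^ (r + 1) : ℕ) : ℝ)) *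
          (p ^ (F.card - E'.card) * (n : ℝ) ^ (i - 1)) := by ring
      _ ≤ _ := mul_le_mul_of_nonneg_left htb (by positivity)
  calc _ ≤ ∑ g ∈ N1, ∑ E' ∈ PS, p ^ (F.card - E'.card) * ind (cnd E' (Φ g)) :=
        Finset.sum_le_sum hterm
    _ = ∑ φ ∈ N1.image Φ, ∑ E' ∈ PS, p ^ (F.card - E'.card) * ind (cnd E' φ) := by
        rw [Finset.sum_image hinj]
    _ ≤ ∑ φ : Fin r → Fin n, ∑ E' ∈ PS, p ^ (F.card - E'.card) * ind (cnd E' φ) :=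
        Finset.sum_le_sum_of_subset_of_nonneg (Finset.subset_univ _) (fun φ _ _ =>
          Finset.sum_nonneg (fun E' _ => mul_nonneg (pow_nonneg hp0 _) (ind_nonneg _)))
    _ = ∑ E' ∈ PS, ∑ φ : Fin r → Fin n, p ^ (F.card - E'.card) * ind (cnd E' φ) :=
        Finset.sum_comm
    _ ≤ ∑ E' ∈ PS, (r * r * ((((r * d + 1) ^ r) ^ (r + 1) : ℕ) : ℝ)) *
          (Λ * (n : ℝ) ^ (-(1 / (F.card : ℝ)))) := Finset.sum_le_sum hcount
    _ = (PS.card : ℝ) * ((r * r * ((((r * d + 1) ^ r) ^ (r + 1) : ℕ) : ℝ)) *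
          (Λ * (n : ℝ) ^ (-(1 / (F.card : ℝ))))) := by rw [Finset.sum_const, nsmul_eq_mul]
    _ ≤ 2 ^ F.card * ((r * r * ((((r * d + 1) ^ r) ^ (r + 1) : ℕ) : ℝ)) *
          (Λ * (n : ℝ) ^ (-(1 / (F.card : ℝ))))) := by
        refine mul_le_mul_of_nonneg_right ?_ (by positivity)
        have : PS.card ≤ 2 ^ F.card := by
          rw [← Finset.card_powerset]; exact Finset.card_filter_le _ _
        exact_mod_cast this
    _ = _ := by unfold etaB; ring

end Copies

/-! ## Part 5: structure of extra copies -/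

section Extra
variable {u r : ℕ} {F : Finset (Finset (Fin r))}

lemma cover_lemma (hF : NF u F) {ι : Type*} [DecidableEq ι] (C : Finset ι)
    (V : ι → Finset (Fin r)) (hcov : ∀ e ∈ F, ∃ i ∈ C, e ⊆ V i)
    (hV : ∀ i ∈ C, V i ≠ Finset.univ) (hV2 : ∀ i ∈ C, 2 ≤ (V i).card) :
    r + 1 + C.card ≤ ∑ i ∈ C, (V i).card := by
  by_contra hcon
  push Not at hcon
  have hr := hF.hr
  set d : Fin r → ℕ := fun x => (C.filter (fun i => x ∈ V i)).card with hd
  have hd1 : ∀ x, 1 ≤ d x := by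
    intro x
    obtain ⟨e, he, hx⟩ := hF.cover x
    obtain ⟨i, hi, hs⟩ := hcov e he
    exact Finset.card_pos.2 ⟨i, Finset.mem_filter.2 ⟨hi, hs hx⟩⟩
  have hdouble : ∀ W : ι → Finset (Fin r), ∑ i ∈ C, (W i).card =
      ∑ x, (C.filter (fun i => x ∈ W i)).card := by
    intro W
    have h1 : ∀ i ∈ C, (W i).card = ∑ x, if x ∈ W i then 1 else 0 := by
      intro i _; simp
    rw [Finset.sum_congr rfl h1, Finset.sum_comm]
    refine Finset.sum_congr rfl (fun x _ => ?_)
    rw [Finset.card_filter]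
  have hsum := hdouble V
  set D : ι → Finset (Fin r) := fun i => (V i).filter (fun x => 2 ≤ d x) with hD
  have hsumD := hdouble D
  have huniq : ∀ x i j, i ∈ C → j ∈ C → x ∈ V i → x ∈ V j → d x < 2 → i = j := by
    intro x i j hi hj h1 h2 h3
    exact Finset.card_le_one.1 (Nat.lt_succ_iff.1 h3 : (C.filter (fun i => x ∈ V i)).card ≤ 1) i
      (Finset.mem_filter.2 ⟨hi, h1⟩) j (Finset.mem_filter.2 ⟨hj, h2⟩)
  have hD3 : ∀ i ∈ C, V i ≠ D i → 3 ≤ (D i).card := by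
    intro i hi hne
    by_contra hlt
    have hDsub : D i ⊆ V i := Finset.filter_subset _ _
    obtain ⟨x, hx, hxD⟩ : ∃ x ∈ V i, x ∉ D i := by
      by_contra hall; push Not at hall
      exact hne (Finset.Subset.antisymm hall hDsub)
    obtain ⟨y, hy⟩ : ∃ y, y ∉ V i := by
      by_contra hall; push Not at hall
      exact hV i hi (Finset.eq_univ_iff_forall.2 hall)
    have hconn := hF.nice.2.1.2 (D i) (by omega) x y hxD (fun h => hy (hDsub h))
    apply hy
    induction hconn with
    | refl => exact hx
    | tail hab hbc ih =>
      rename_i b c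
      have hbV : b ∈ V i := by
        by_contra hb
        exact hb (ih hb)
      obtain ⟨e, he, hdisj, hbe, hce⟩ := hbc
      obtain ⟨j, hj, hs⟩ := hcov e he
      have hbD : b ∉ D i := fun h => (Finset.disjoint_left.1 hdisj hbe) h
      have hdb : d b < 2 := by
        by_contra h; push Not at h
        exact hbD (Finset.mem_filter.2 ⟨hbV, h⟩)
      rw [huniq b i j hi hj hbV (hs hbe) hdb]
      exact hs hce
  have hD2 : ∀ i ∈ C, 2 ≤ (D i).card := by
    intro i hi
    by_cases h : V i = D i
    · rw [← h]; exact hV2 i hi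
    · have := hD3 i hi h; omega
  -- compare the sums pointwise
  have hpt : ∀ x, (C.filter (fun i => x ∈ D i)).card + 2 ≤ 2 * d x := by
    intro x
    have h1 := hd1 x
    by_cases h2 : 2 ≤ d x
    · have : (C.filter (fun i => x ∈ D i)).card ≤ d x :=
        Finset.card_le_card (fun i hi => by
          rw [Finset.mem_filter] at hi ⊢
          exact ⟨hi.1, (Finset.mem_filter.1 hi.2).1⟩)
      omega
    · have : C.filter (fun i => x ∈ D i) = ∅ := by
        apply Finset.eq_empty_of_forall_notMem
        intro i hi
        exact h2 (Finset.mem_filter.1 (Finset.mem_filter.1 hi).2).2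
      rw [this]; simp; omega
  have hS1 : ∑ x, ((C.filter (fun i => x ∈ D i)).card + 2) ≤ ∑ x, 2 * d x :=
    Finset.sum_le_sum (fun x _ => hpt x)
  have hS2 : ∑ i ∈ C, 2 ≤ ∑ i ∈ C, (D i).card := Finset.sum_le_sum hD2
  have hS3 : ∑ x : Fin r, ((C.filter (fun i => x ∈ D i)).card + 2) =
      ∑ i ∈ C, (D i).card + 2 * r := by
    rw [Finset.sum_add_distrib, ← hsumD]; simp [mul_comm]
  have hS4 : ∑ x, 2 * d x = 2 * ∑ i ∈ C, (V i).card := by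
    rw [← Finset.mul_sum, hsum]
  have hS5 : ∑ i ∈ C, 2 = 2 * C.card := by simp [mul_comm]
  have hDeq : ∀ i ∈ C, 2 = (D i).card :=
    (Finset.sum_eq_sum_iff_of_le hD2).1 (by omega)
  have hpteq : ∀ x ∈ (Finset.univ : Finset (Fin r)),
      (C.filter (fun i => x ∈ D i)).card + 2 = 2 * d x :=
    (Finset.sum_eq_sum_iff_of_le (fun x _ => hpt x)).1 (by omega)
  have hVD : ∀ i ∈ C, V i = D i := by
    intro i hi
    by_contra h
    have := hD3 i hi h
    have := hDeq i hi
    omega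
  have hV2' : ∀ i ∈ C, (V i).card = 2 := fun i hi => by rw [hVD i hi, ← hDeq i hi]
  have hdle : ∀ x, d x ≤ 2 := by
    intro x
    have h1 := hpteq x (Finset.mem_univ x)
    have : (C.filter (fun i => x ∈ D i)).card ≤ d x :=
        Finset.card_le_card (fun i hi => by
          rw [Finset.mem_filter] at hi ⊢
          exact ⟨hi.1, (Finset.mem_filter.1 hi.2).1⟩)
    omega
  -- contradiction from connectivity
  set x : Fin r := ⟨0, by omega⟩
  set S := (C.filter (fun i => x ∈ V i)).biUnion (fun i => (V i).erase x) with hS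
  have hScard : S.card ≤ 2 := by
    refine (Finset.card_biUnion_le_card_mul _ _ 1 ?_).trans ?_
    · intro i hi
      rw [Finset.mem_filter] at hi
      rw [Finset.card_erase_of_mem hi.2, hV2' i hi.1]
    · rw [mul_one]; exact hdle x
  have hxS : x ∉ S := by simp [hS]
  obtain ⟨y, hy⟩ : ∃ y, y ∉ insert x S := by
    by_contra hall; push Not at hall
    have h1 : (insert x S).card = r := by
      rw [Finset.eq_univ_iff_forall.2 hall]; simp
    have := Finset.card_insert_le x S
    omega
  have hconn := hF.nice.2.1.2 S hScard x y hxS (fun h => hy (Finset.mem_insert_of_mem h))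
  apply hy
  have : ∀ z, Relation.ReflTransGen (fun a b => ∃ e ∈ F, Disjoint e S ∧ a ∈ e ∧ b ∈ e) x z →
      z = x := by
    intro z hz
    induction hz with
    | refl => rfl
    | tail _ hbc ih =>
      obtain ⟨e, he, hdisj, hbe, hce⟩ := hbc
      rw [ih] at hbe
      obtain ⟨j, hj, hs⟩ := hcov e he
      by_contra hne
      exact Finset.disjoint_left.1 hdisj hce (Finset.mem_biUnion.2
        ⟨j, Finset.mem_filter.2 ⟨hj, hs hbe⟩, Finset.mem_erase.2 ⟨hne, hs hce⟩⟩)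
  rw [this y hconn]; exact Finset.mem_insert_self _ _

/-- Two copies on the same vertex set do not differ by one edge. -/
lemma no_swap (hF : NF u F) (hu2 : u = 2) {n : ℕ} {g h : FE n} (hg : g ∈ allFEdges F n)
    (hh : h ∈ allFEdges F n) (h1 : g.1 = h.1) {a b : Finset (Fin n)} (ha : a ∈ h.2)
    (hag : a ∉ g.2) (hb : b ∈ g.2) (heq : h.2 = insert a (g.2.erase b)) : False := by
  have hr := hF.hr
  obtain ⟨φ, f1, f2⟩ := mem_all.1 hg
  obtain ⟨ψ, p1, p2⟩ := mem_all.1 hh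
  rcases hF.nice.2.2 with h3 | ⟨_, hno⟩
  · omega
  apply hno
  -- the permutation
  have hσ : ∀ x : Fin r, ∃ y : Fin r, ψ y = φ x := by
    intro x
    have : φ x ∈ h.1 := by rw [← h1, f1]; exact Finset.mem_map_of_mem _ (Finset.mem_univ _)
    rw [p1] at this
    obtain ⟨y, _, hy⟩ := Finset.mem_map.1 this
    exact ⟨y, hy⟩
  choose σ hσ using hσ
  have hinj : Function.Injective σ := by
    intro x y hxy
    apply φ.injective
    rw [← hσ x, ← hσ y, hxy]
  let τ : Equiv.Perm (Fin r) := Equiv.ofBijective σ (Finite.injective_iff_bijective.1 hinj)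
  have hτ : ∀ x, τ x = σ x := fun x => rfl
  have himg : ∀ e : Finset (Fin r), (e.image (fun x => τ x)).map ψ = e.map φ := by
    intro e
    rw [Finset.map_eq_image, Finset.map_eq_image, Finset.image_image]
    apply Finset.image_congr
    intro x _
    simp [hτ, hσ]
  have hasub : a ⊆ Finset.univ.map φ := by
    rw [← f1, h1]; exact fe_edge_sub hh ha
  obtain ⟨a', -, ha'⟩ := Finset.subset_map_iff.1 hasub
  rw [f2] at hb
  obtain ⟨b', hb', hb'e⟩ := Finset.mem_image.1 hb
  refine ⟨a', b', ?_, ?_, hb', τ, ?_⟩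
  · have := fe_edge_card hF hh ha
    rw [ha', Finset.card_map] at this; exact this
  · intro haF
    apply hag
    rw [f2, ha']
    exact Finset.mem_image_of_mem _ haF
  · apply Finset.image_injective (Finset.map_injective ψ)
    rw [Finset.image_image]
    have : (Finset.map ψ ∘ fun e : Finset (Fin r) => e.image (fun x => τ x)) =
        fun e => e.map φ := by
      funext e; exact himg e
    rw [this, Finset.image_insert, Finset.image_erase (Finset.map_injective φ)]
    have e1 : Finset.image (fun e : Finset (Fin r) => e.map φ) F = g.2 := f2.symm
    rw [e1]
    have e2 : Finset.image (Finset.map ψ) F = h.2 := p2.symm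
    rw [e2, heq, ha', ← hb'e]

lemma extra_struct (hF : NF u F) {n : ℕ} {H : Finset (FE n)} (hH : H ⊆ allFEdges F n)
    {h : FE n} (hh : h ∈ allFEdges F n) (hs : h.2 ⊆ (H.erase h).biUnion Prod.snd) :
    ∃ C ⊆ H.erase h, C.card ≤ F.card + 1 ∧ (∀ g ∈ C, 1 ≤ (g.1 ∩ h.1).card) ∧
      r + 1 + C.card ≤ ∑ g ∈ C, (g.1 ∩ h.1).card := by
  have hu := hF.hu
  have hr := hF.hr
  have hch : ∀ e : Finset (Fin n), ∃ g : FE n, e ∈ h.2 → g ∈ H.erase h ∧ e ∈ g.2 := by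
    intro e
    by_cases he : e ∈ h.2
    · obtain ⟨g, hg, heg⟩ := Finset.mem_biUnion.1 (hs he)
      exact ⟨g, fun _ => ⟨hg, heg⟩⟩
    · exact ⟨h, fun h' => absurd h' he⟩
  choose ge hge using hch
  have hu_le : ∀ e ∈ h.2, ∀ g ∈ allFEdges F n, e ∈ g.2 → u ≤ (g.1 ∩ h.1).card := by
    intro e he g hg heg
    rw [← fe_edge_card hF hh he]
    exact Finset.card_le_card (Finset.subset_inter (fe_edge_sub hg heg) (fe_edge_sub hh he))
  by_cases hB : ∃ g1 ∈ H.erase h, g1.1 = h.1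
  · obtain ⟨g1, hg1, hg1e⟩ := hB
    have hg1a : g1 ∈ allFEdges F n := hH (Finset.mem_of_mem_erase hg1)
    have hne : g1 ≠ h := Finset.ne_of_mem_erase hg1
    set X := h.2 \ g1.2 with hX
    set C' := X.image ge with hC'
    have hXne : X.Nonempty := by
      rw [Finset.nonempty_iff_ne_empty]
      intro h0
      rw [hX, Finset.sdiff_eq_empty_iff_subset] at h0
      exact hne (fe_eq hF hh hg1a h0).symm
    have hg1C : g1 ∉ C' := by
      intro hm
      obtain ⟨e, he, hee⟩ := Finset.mem_image.1 hm
      rw [Finset.mem_sdiff] at he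
      exact he.2 (hee ▸ (hge e he.1).2)
    have hC'sub : C' ⊆ H.erase h := by
      intro g hg
      obtain ⟨e, he, rfl⟩ := Finset.mem_image.1 hg
      exact (hge e (Finset.mem_sdiff.1 he).1).1
    have hC'2 : ∀ g ∈ C', u ≤ (g.1 ∩ h.1).card := by
      intro g hg
      have hga := hH (Finset.mem_of_mem_erase (hC'sub hg))
      obtain ⟨e, he, rfl⟩ := Finset.mem_image.1 hg
      have he := (Finset.mem_sdiff.1 he).1
      exact hu_le e he _ hga (hge e he).2
    have hg1card : (g1.1 ∩ h.1).card = r := by rw [hg1e, Finset.inter_self, fe_card1 hh]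
    refine ⟨insert g1 C', Finset.insert_subset hg1 hC'sub, ?_, ?_, ?_⟩
    · rw [Finset.card_insert_of_notMem hg1C]
      have h1 : C'.card ≤ X.card := Finset.card_image_le
      have h2 : X.card ≤ h.2.card := Finset.card_le_card Finset.sdiff_subset
      rw [fe_card2 hh] at h2
      omega
    · intro g hg
      rcases Finset.mem_insert.1 hg with rfl | hg
      · omega
      · have := hC'2 g hg; omega
    · rw [Finset.card_insert_of_notMem hg1C, Finset.sum_insert hg1C, hg1card]
      suffices h : C'.card + 2 ≤ ∑ g ∈ C', (g.1 ∩ h.1).card by omega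
      by_contra hlt
      push Not at hlt
      have h1 : ∑ g ∈ C', u ≤ ∑ g ∈ C', (g.1 ∩ h.1).card := Finset.sum_le_sum hC'2
      rw [Finset.sum_const, smul_eq_mul] at h1
      have hpos : 0 < C'.card := Finset.card_pos.2 (hXne.image _)
      have hC1 : C'.card = 1 := by nlinarith
      have hu2 : u = 2 := by rw [hC1] at h1; omega
      obtain ⟨g2, hg2⟩ := Finset.card_eq_one.1 hC1
      rw [hg2, Finset.sum_singleton, Finset.card_singleton] at hlt
      have hXeq : ∀ e ∈ X, e = g2.1 ∩ h.1 := by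
        intro e he
        have heh := (Finset.mem_sdiff.1 he).1
        have hgm : ge e ∈ C' := Finset.mem_image_of_mem _ he
        rw [hg2, Finset.mem_singleton] at hgm
        have hga : g2 ∈ allFEdges F n := hH (Finset.mem_of_mem_erase (hC'sub (by rw [hg2]; simp)))
        have heg : e ∈ g2.2 := hgm ▸ (hge e heh).2
        refine Finset.eq_of_subset_of_card_le
          (Finset.subset_inter (fe_edge_sub hga heg) (fe_edge_sub hh heh)) ?_
        rw [fe_edge_card hF hh heh]; omega
      obtain ⟨a, haX⟩ := hXne
      have hX1 : X = {a} := by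
        ext e; rw [Finset.mem_singleton]
        constructor
        · intro he; rw [hXeq e he, hXeq a haX]
        · rintro rfl; exact haX
      have hcardeq : (g1.2 \ h.2).card = 1 := by
        have c1 := Finset.card_sdiff_add_card_inter h.2 g1.2
        have c2 := Finset.card_sdiff_add_card_inter g1.2 h.2
        rw [← hX, hX1, Finset.card_singleton, fe_card2 hh] at c1
        rw [fe_card2 hg1a, Finset.inter_comm] at c2
        omega
      obtain ⟨b, hb⟩ := Finset.card_eq_one.1 hcardeq
      have hbm : b ∈ g1.2 \ h.2 := by rw [hb]; simp
      have haX' := Finset.mem_sdiff.1 haX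
      have hbm' := Finset.mem_sdiff.1 hbm
      refine no_swap hF hu2 hg1a hh hg1e haX'.1 haX'.2 hbm'.1 ?_
      ext e
      rw [Finset.mem_insert, Finset.mem_erase]
      constructor
      · intro he
        by_cases hg : e ∈ g1.2
        · exact Or.inr ⟨fun h => hbm'.2 (h ▸ he), hg⟩
        · left
          have : e ∈ X := Finset.mem_sdiff.2 ⟨he, hg⟩
          rw [hX1, Finset.mem_singleton] at this; exact this
      · rintro (rfl | ⟨h1, h2⟩)
        · exact haX'.1
        · by_contra he
          have : e ∈ g1.2 \ h.2 := Finset.mem_sdiff.2 ⟨h2, he⟩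
          rw [hb, Finset.mem_singleton] at this
          exact h1 this
  · push Not at hB
    set C := h.2.image ge with hC
    have hCsub : C ⊆ H.erase h := by
      intro g hg
      obtain ⟨e, he, rfl⟩ := Finset.mem_image.1 hg
      exact (hge e he).1
    have hC2 : ∀ g ∈ C, u ≤ (g.1 ∩ h.1).card := by
      intro g hg
      have hga := hH (Finset.mem_of_mem_erase (hCsub hg))
      obtain ⟨e, he, rfl⟩ := Finset.mem_image.1 hg
      exact hu_le e he _ hga (hge e he).2
    obtain ⟨ψ, p1, p2⟩ := mem_all.1 hh
    let V : FE n → Finset (Fin r) := fun g => Finset.univ.filter (fun x => ψ x ∈ g.1)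
    have hVcard : ∀ g, (V g).card = (g.1 ∩ h.1).card := by
      intro g
      rw [← Finset.card_map ψ]
      congr 1
      ext v
      simp only [V, Finset.mem_map, Finset.mem_filter, Finset.mem_univ, true_and,
        Finset.mem_inter, p1]
      constructor
      · rintro ⟨x, hx, rfl⟩; exact ⟨hx, x, rfl⟩
      · rintro ⟨hx, x, rfl⟩; exact ⟨x, hx, rfl⟩
    refine ⟨C, hCsub, ?_, fun g hg => by have := hC2 g hg; omega, ?_⟩
    · have : C.card ≤ h.2.card := Finset.card_image_le
      rw [fe_card2 hh] at this; omega
    · have := cover_lemma hF C V ?_ ?_ ?_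
      · simpa only [hVcard] using this
      · intro e he
        have hem : e.map ψ ∈ h.2 := by rw [p2]; exact Finset.mem_image_of_mem _ he
        refine ⟨ge (e.map ψ), Finset.mem_image_of_mem _ hem, fun x hx => ?_⟩
        have hga := hH (Finset.mem_of_mem_erase (hge _ hem).1)
        exact Finset.mem_filter.2 ⟨Finset.mem_univ _,
          fe_edge_sub hga (hge _ hem).2 (Finset.mem_map_of_mem _ hx)⟩
      · intro g hg hu'
        have hga := hH (Finset.mem_of_mem_erase (hCsub hg))
        apply hB g (hCsub hg)
        have hc : (g.1 ∩ h.1).card = r := by rw [← hVcard, hu']; simp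
        have e1 : g.1 ∩ h.1 = g.1 := Finset.eq_of_subset_of_card_le Finset.inter_subset_left
          (by rw [hc, fe_card1 hga])
        have e2 : g.1 ∩ h.1 = h.1 := Finset.eq_of_subset_of_card_le Finset.inter_subset_right
          (by rw [hc, fe_card1 hh])
        rw [← e1, e2]
      · intro g hg
        rw [hVcard]; have := hC2 g hg; omega

end Extra

/-! ## Part 6: counting copies, and the probability of a bad `F`-graph -/

section Supp
variable {ι : Type*} [Fintype ι] [DecidableEq ι]

lemma bw_qJ_zero {J A : Finset ι} (h : ¬ A ⊆ J) (x : ℝ) : bw (qJ J x) A = 0 := by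
  obtain ⟨e, he, hJ⟩ := Finset.not_subset.1 h
  unfold bw
  exact Finset.prod_eq_zero (Finset.mem_univ e) (by simp [he, qJ, hJ])

lemma ex_mono_on {J : Finset ι} {x : ℝ} (hx0 : 0 ≤ x) (hx1 : x ≤ 1) {f g : Finset ι → ℝ}
    (h : ∀ A ⊆ J, f A ≤ g A) : ex (qJ J x) f ≤ ex (qJ J x) g := by
  refine Finset.sum_le_sum (fun A _ => ?_)
  by_cases hA : A ⊆ J
  · exact mul_le_mul_of_nonneg_left (h A hA) (bw_nonneg (Pq_qJ J hx0 hx1) A)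
  · rw [bw_qJ_zero hA]; simp

lemma ex_congr_on {J : Finset ι} {x : ℝ} {f g : Finset ι → ℝ}
    (h : ∀ A ⊆ J, f A = g A) : ex (qJ J x) f = ex (qJ J x) g := by
  refine Finset.sum_congr rfl (fun A _ => ?_)
  by_cases hA : A ⊆ J
  · rw [h A hA]
  · rw [bw_qJ_zero hA]; simp

lemma esymm_le (J : Finset ι) (w : ι → ℝ) (hw : ∀ i, 0 ≤ w i) (k : ℕ) :
    ∑ C ∈ J.powersetCard k, ∏ i ∈ C, w i ≤ (∑ i ∈ J, w i) ^ k := by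
  induction J using Finset.induction_on generalizing k with
  | empty =>
    cases k with
    | zero => simp
    | succ k => rw [Finset.powersetCard_eq_empty.2 (by simp)]; simp
  | insert j J hj ih =>
    cases k with
    | zero => simp
    | succ k =>
      rw [Finset.powersetCard_succ_insert hj, Finset.sum_union, Finset.sum_image,
        Finset.sum_insert hj]
      · have h1 : ∀ C ∈ J.powersetCard k, ∏ i ∈ insert j C, w i = w j * ∏ i ∈ C, w i := by
          intro C hC
          rw [Finset.prod_insert]
          exact fun h => hj ((Finset.mem_powersetCard.1 hC).1 h)
        rw [Finset.sum_congr rfl h1, ← Finset.mul_sum]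
        have hS : 0 ≤ ∑ i ∈ J, w i := Finset.sum_nonneg (fun i _ => hw i)
        set S := ∑ i ∈ J, w i
        have hj0 := hw j
        calc _ ≤ S ^ (k+1) + w j * S ^ k :=
              add_le_add (ih (k+1)) (mul_le_mul_of_nonneg_left (ih k) hj0)
          _ = (w j + S) * S ^ k := by ring
          _ ≤ (w j + S) * (w j + S) ^ k := by
              apply mul_le_mul_of_nonneg_left _ (by linarith)
              exact pow_le_pow_left₀ hS (by linarith) k
          _ = _ := by ring
      · intro C hC C' hC' h
        have h1 : j ∉ C := fun h => hj ((Finset.mem_powersetCard.1 hC).1 h)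
        have h2 : j ∉ C' := fun h => hj ((Finset.mem_powersetCard.1 hC').1 h)
        rw [← Finset.erase_insert h1, ← Finset.erase_insert h2]
        rw [h]
      · rw [Finset.disjoint_left]
        intro C hC hC'
        obtain ⟨C'', _, rfl⟩ := Finset.mem_image.1 hC'
        exact hj ((Finset.mem_powersetCard.1 hC).1 (Finset.mem_insert_self _ _))

end Supp

section Count
variable {u r : ℕ} {F : Finset (Finset (Fin r))} {n : ℕ}

lemma exists_Phi (F : Finset (Finset (Fin r))) (n : ℕ) (hn : 1 ≤ n) :
    ∃ Φ : FE n → Fin r → Fin n, (∀ g ∈ allFEdges F n,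
      Function.Injective (Φ g) ∧ g.1 = Finset.univ.image (Φ g) ∧
        g.2 = F.image (fun e => e.image (Φ g))) ∧
      Set.InjOn Φ (allFEdges F n : Set (FE n)) := by
  have hΦ : ∀ g : FE n, ∃ φ : Fin r → Fin n, g ∈ allFEdges F n →
      Function.Injective φ ∧ g.1 = Finset.univ.image φ ∧ g.2 = F.image (fun e => e.image φ) := by
    intro g
    by_cases hgm : g ∈ allFEdges F n
    · obtain ⟨φ, h1, h2⟩ := mem_all.1 hgm
      refine ⟨φ, fun _ => ⟨φ.injective, ?_, ?_⟩⟩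
      · rw [h1, Finset.map_eq_image]
      · rw [h2]; simp only [Finset.map_eq_image]
    · exact ⟨fun _ => ⟨0, by omega⟩, fun hgm' => absurd hgm' hgm⟩
  choose Φ hΦ using hΦ
  refine ⟨Φ, hΦ, ?_⟩
  intro g hg1 g' hg2 heq
  obtain ⟨_, a1, a2⟩ := hΦ g hg1
  obtain ⟨_, b1, b2⟩ := hΦ g' hg2
  exact Prod.ext (by rw [a1, b1, heq]) (by rw [a2, b2, heq])

/-- The number of copies containing a vertex. -/
def Dv (F : Finset (Finset (Fin r))) (n : ℕ) (v : Fin n) : ℕ :=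
  ((allFEdges F n).filter (fun g => v ∈ g.1)).card

lemma Dv_le_aux (F : Finset (Finset (Fin r))) (σ : Equiv.Perm (Fin n)) (v : Fin n) :
    Dv F n v ≤ Dv F n (σ v) := by
  unfold Dv
  refine Finset.card_le_card_of_injOn
    (fun g => (g.1.map σ.toEmbedding, g.2.image (fun e => e.map σ.toEmbedding))) ?_ ?_
  · intro g hg
    simp only [Finset.coe_filter, Set.mem_ofPred_eq] at hg ⊢
    obtain ⟨φ, h1, h2⟩ := mem_all.1 hg.1
    refine ⟨mem_all.2 ⟨φ.trans σ.toEmbedding, ?_, ?_⟩, ?_⟩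
    · simp only [h1, Finset.map_map]
    · simp only [h2, Finset.image_image]
      congr 1
      funext e
      simp [Finset.map_map]
    · simpa using hg.2
  · intro g _ g' _ heq
    simp only [Prod.mk.injEq] at heq
    refine Prod.ext (Finset.map_injective _ heq.1)
      (Finset.image_injective (Finset.map_injective _) heq.2)

lemma Dv_eq (F : Finset (Finset (Fin r))) (v w : Fin n) : Dv F n v = Dv F n w := by
  apply le_antisymm
  · have := Dv_le_aux F (Equiv.swap v w) v; simpa using this
  · have := Dv_le_aux F (Equiv.swap v w) w; simpa using this

lemma card_all_le (F : Finset (Finset (Fin r))) (hn : 1 ≤ n) :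
    (allFEdges F n).card ≤ n ^ r := by
  obtain ⟨Φ, _, h2⟩ := exists_Phi F n hn
  have := Finset.card_le_card_of_injOn (t := Finset.univ) Φ (by intro g _; simp) h2
  simpa using this

lemma n_mul_Dv (F : Finset (Finset (Fin r))) (v : Fin n) :
    n * Dv F n v = r * (allFEdges F n).card := by
  have h1 : ∑ w : Fin n, Dv F n w = n * Dv F n v := by
    rw [Finset.sum_congr rfl (fun w _ => Dv_eq F w v)]; simp
  rw [← h1]
  unfold Dv
  simp only [Finset.card_filter]
  rw [Finset.sum_comm]
  have : ∀ g ∈ allFEdges F n, ∑ w : Fin n, (if w ∈ g.1 then 1 else 0) = r := by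
    intro g hg; rw [← fe_card1 hg]; simp
  rw [Finset.sum_congr rfl this]; simp [mul_comm]

lemma Dv_le (F : Finset (Finset (Fin r))) (hr : 4 ≤ r) (v : Fin n) :
    Dv F n v ≤ r * n ^ (r - 1) := by
  have hn : 1 ≤ n := by have := v.2; omega
  have h1 := n_mul_Dv F v
  have h2 := card_all_le F hn
  have h3 : n ^ r = n * n ^ (r - 1) := by
    obtain ⟨k, rfl⟩ : ∃ k, r = k + 1 := ⟨r - 1, by omega⟩
    simp [pow_succ, mul_comm]
  rw [h3] at h2
  have : n * Dv F n v ≤ n * (r * n ^ (r - 1)) := by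
    rw [h1]; calc _ ≤ r * (n * n ^ (r-1)) := Nat.mul_le_mul_left _ h2
      _ = _ := by ring
  exact Nat.le_of_mul_le_mul_left this (by omega)

lemma Dv_ge (F : Finset (Finset (Fin r))) (hr : 4 ≤ r) (hn : 2 * r ≤ n) (v : Fin n) :
    (n : ℝ) ^ (r - 1) / (2 * r) ^ r ≤ Dv F n v := by
  have hn0 : 1 ≤ n := by omega
  -- embeddings map to copies with fibres of size at most r^r
  let f : (Fin r ↪ Fin n) → FE n := fun φ =>
    (Finset.univ.map φ, F.image (fun e => e.map φ))
  have hf : ∀ φ ∈ (Finset.univ : Finset (Fin r ↪ Fin n)), f φ ∈ allFEdges F n := by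
    intro φ _; exact mem_all.2 ⟨φ, rfl, rfl⟩
  have hfib : ∀ g ∈ allFEdges F n, (Finset.univ.filter (fun φ => f φ = g)).card ≤ r ^ r := by
    intro g hg
    have : (Finset.univ.filter (fun φ => f φ = g)).card ≤
        (Fintype.piFinset (fun _ : Fin r => g.1)).card := by
      refine Finset.card_le_card_of_injOn (fun φ => (φ : Fin r → Fin n)) ?_ ?_
      · intro φ hφ
        simp only [Finset.coe_filter, Finset.mem_univ, true_and, Set.mem_ofPred_eq] at hφ
        rw [Finset.mem_coe, Fintype.mem_piFinset]
        intro i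
        rw [← hφ]; simp [f]
      · intro φ _ φ' _ h; exact DFunLike.coe_injective h
    rw [Fintype.card_piFinset] at this
    simpa [fe_card1 hg] using this
  have hcard := Finset.card_le_mul_card_image_of_maps_to hf _ hfib
  rw [Finset.card_univ, Fintype.card_embedding_eq, Fintype.card_fin, Fintype.card_fin] at hcard
  have hpow := Nat.pow_sub_le_descFactorial n r
  have h4 : ((n : ℝ) / 2) ^ r ≤ (r : ℝ) ^ r * (allFEdges F n).card := by
    have e1 : ((n : ℝ) / 2) ^ r ≤ ((n + 1 - r : ℕ) : ℝ) ^ r := by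
      apply pow_le_pow_left₀ (by positivity)
      rw [Nat.cast_sub (by omega)]
      have : (2 * r : ℝ) ≤ n := by exact_mod_cast hn
      push_cast; linarith
    refine e1.trans ?_
    exact_mod_cast hpow.trans hcard
  have h1 : (n : ℝ) * Dv F n v = r * (allFEdges F n).card := by exact_mod_cast n_mul_Dv F v
  have hn' : (0 : ℝ) < n := by exact_mod_cast hn0
  have hr' : (1 : ℝ) ≤ r := by exact_mod_cast (by omega : 1 ≤ r)
  have hrp : (0 : ℝ) < (2 * r) ^ r := by positivity
  rw [div_le_iff₀ hrp]
  have h5 : (n : ℝ) ^ r = n * (n : ℝ) ^ (r - 1) := by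
    obtain ⟨k, rfl⟩ : ∃ k, r = k + 1 := ⟨r - 1, by omega⟩
    simp [pow_succ, mul_comm]
  have h6 : (n : ℝ) ^ r ≤ (2 * r) ^ r * (allFEdges F n).card := by
    rw [div_pow, div_le_iff₀ (by positivity)] at h4
    calc _ ≤ _ := h4
      _ = _ := by rw [mul_pow]; ring
  have h7 : ((allFEdges F n).card : ℝ) ≤ n * Dv F n v := by
    rw [h1]; nlinarith [Nat.cast_nonneg (α := ℝ) (allFEdges F n).card]
  have h8 : (n : ℝ) * (n : ℝ) ^ (r - 1) ≤ n * (Dv F n v * (2 * r) ^ r) := by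
    rw [← h5]
    calc _ ≤ _ := h6
      _ ≤ (2 * r) ^ r * (n * Dv F n v) := mul_le_mul_of_nonneg_left h7 hrp.le
      _ = _ := by ring
  exact le_of_mul_le_mul_left h8 hn'

/-- Number of copies containing two given distinct vertices. -/
lemma D2_le (F : Finset (Finset (Fin r))) {x y : Fin n} (hxy : x ≠ y) :
    ((allFEdges F n).filter (fun g => x ∈ g.1 ∧ y ∈ g.1)).card ≤ r * r * n ^ (r - 2) := by
  have hn : 1 ≤ n := by have := x.2; omega
  obtain ⟨Φ, h1, h2⟩ := exists_Phi F n hn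
  have hsub : ((allFEdges F n).filter (fun g => x ∈ g.1 ∧ y ∈ g.1)).image Φ ⊆
      ((Finset.univ : Finset (Fin r × Fin r)).filter (fun z => z.1 ≠ z.2)).biUnion (fun z =>
        Fintype.piFinset (fun i => if i = z.1 then {x} else if i = z.2 then {y} else Finset.univ)) := by
    intro φ hφ
    obtain ⟨g, hg, rfl⟩ := Finset.mem_image.1 hφ
    obtain ⟨hga, hx, hy⟩ := Finset.mem_filter.1 hg
    obtain ⟨_, he, _⟩ := h1 g hga
    rw [he] at hx hy
    obtain ⟨i, _, hi⟩ := Finset.mem_image.1 hx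
    obtain ⟨j, _, hj⟩ := Finset.mem_image.1 hy
    refine Finset.mem_biUnion.2 ⟨(i, j), ?_, ?_⟩
    · simp only [Finset.mem_filter, Finset.mem_univ, true_and]
      rintro rfl; exact hxy (hi.symm.trans hj)
    · rw [Fintype.mem_piFinset]
      intro k
      split_ifs with a b
      · simp [a, hi]
      · simp [b, hj]
      · simp
  have hinj : Set.InjOn Φ ((allFEdges F n).filter (fun g => x ∈ g.1 ∧ y ∈ g.1) : Set (FE n)) :=
    h2.mono (by intro g hg; exact (Finset.mem_filter.1 hg).1)
  rw [← Finset.card_image_of_injOn hinj]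
  refine (Finset.card_le_card hsub).trans ?_
  refine (Finset.card_biUnion_le_card_mul _ _ (n ^ (r - 2)) ?_).trans ?_
  · intro z hz
    have hz := (Finset.mem_filter.1 hz).2
    rw [Fintype.card_piFinset]
    have : ∀ i : Fin r, (if i = z.1 then ({x} : Finset (Fin n)) else if i = z.2 then {y} else
        Finset.univ).card = if i ∈ ({z.1, z.2} : Finset (Fin r)) then 1 else n := by
      intro i
      by_cases a : i = z.1 <;> by_cases b : i = z.2 <;> simp [a, b, hz, hz.symm]
    rw [Finset.prod_congr rfl (fun i _ => this i), Finset.prod_ite, Finset.prod_const_one, one_mul,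
      Finset.prod_const]
    apply le_of_eq
    congr 1
    have e1 : (Finset.univ.filter (fun i => i ∉ ({z.1, z.2} : Finset (Fin r)))) =
      Finset.univ \ {z.1, z.2} := by ext; simp
    rw [e1, Finset.card_sdiff_of_subset (Finset.subset_univ _), Finset.card_pair hz]; simp
  · refine Nat.mul_le_mul_right _ ((Finset.card_filter_le _ _).trans ?_)
    simp

lemma W_bound (F : Finset (Finset (Fin r))) {h : FE n} (hh : h ∈ allFEdges F n) (hn : 1 ≤ n) :
    ∑ g ∈ allFEdges F n, (n : ℝ) ^ (g.1 ∩ h.1).card ≤ ((r + 1) * n) ^ r := by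
  obtain ⟨Φ, h1, h2⟩ := exists_Phi F n hn
  have hn1 : (1 : ℝ) ≤ n := by exact_mod_cast hn
  let w : Fin n → ℝ := fun x => if x ∈ h.1 then n else 1
  have hw : ∀ x, 0 ≤ w x := fun x => by simp only [w]; split_ifs <;> positivity
  have hterm : ∀ g ∈ allFEdges F n, (n : ℝ) ^ (g.1 ∩ h.1).card = ∏ i, w (Φ g i) := by
    intro g hg
    obtain ⟨hi, he, _⟩ := h1 g hg
    rw [← Finset.prod_image (s := Finset.univ) (g := Φ g) (f := w) (fun a _ b _ h => hi h), ← he]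
    simp only [w]
    rw [Finset.prod_ite, Finset.prod_const, Finset.prod_const_one, mul_one, Finset.filter_mem_eq_inter]
  rw [Finset.sum_congr rfl hterm, ← Finset.sum_image (f := fun φ : Fin r → Fin n => ∏ i, w (φ i)) h2]
  calc _ ≤ ∑ φ : Fin r → Fin n, ∏ i, w (φ i) :=
        Finset.sum_le_sum_of_subset_of_nonneg (Finset.subset_univ _)
          (fun φ _ _ => Finset.prod_nonneg (fun i _ => hw _))
    _ = (∑ x, w x) ^ r := (Fintype.sum_pow _ _).symm
    _ ≤ _ := by
        apply pow_le_pow_left₀ (Finset.sum_nonneg (fun x _ => hw x))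
        have : ∀ x, w x ≤ (if x ∈ h.1 then (n : ℝ) else 0) + 1 := by
          intro x; simp only [w]; split_ifs <;> linarith
        refine (Finset.sum_le_sum (fun x _ => this x)).trans ?_
        rw [Finset.sum_add_distrib, ← Finset.sum_filter, Finset.sum_const, Finset.sum_const]
        simp [fe_card1 hh]; linarith

lemma deg_tail (F : Finset (Finset (Fin r))) {π : ℝ} (h0 : 0 ≤ π) (h1 : π ≤ 1) (v : Fin n) (d : ℕ) :
    ex (qJ (allFEdges F n) π) (fun H => ind (¬ degFE H v ≤ d)) ≤
      Real.exp (π * Dv F n v) / 2 ^ (d + 1) := by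
  have hq := Pq_qJ (allFEdges F n) h0 h1
  have hpt : ∀ H : Finset (FE n), ind (¬ degFE H v ≤ d) ≤
      (1 / 2 ^ (d + 1)) * ∏ g, (if g ∈ H then (if v ∈ g.1 then (2 : ℝ) else 1) else 1) := by
    intro H
    have e1 : ∏ g, (if g ∈ H then (if v ∈ g.1 then (2 : ℝ) else 1) else 1) = 2 ^ degFE H v := by
      rw [Finset.prod_ite_mem, Finset.univ_inter, Finset.prod_ite, Finset.prod_const,
        Finset.prod_const_one, mul_one]; rfl
    rw [e1]
    by_cases h : degFE H v ≤ d
    · rw [ind_neg (not_not.2 h)]; positivity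
    · rw [ind_pos h, one_div, inv_mul_eq_div, le_div_iff₀ (by positivity), one_mul]
      exact pow_le_pow_right₀ (by norm_num) (by omega)
  refine (ex_mono hq hpt).trans ?_
  rw [ex_mul_left, ex_prod, one_div, inv_mul_eq_div]
  gcongr
  have : ∀ g : FE n, qJ (allFEdges F n) π g * (if v ∈ g.1 then (2 : ℝ) else 1) +
      (1 - qJ (allFEdges F n) π g) * 1 =
      if g ∈ (allFEdges F n).filter (fun g => v ∈ g.1) then 1 + π else 1 := by
    intro g
    by_cases a : g ∈ allFEdges F n <;> by_cases b : v ∈ g.1 <;> simp [qJ, a, b] <;> ring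
  rw [Finset.prod_congr rfl (fun g _ => this g), Finset.prod_ite_mem, Finset.univ_inter,
    Finset.prod_const, mul_comm, Real.exp_nat_mul]
  exact pow_le_pow_left₀ (by linarith) (by linarith [Real.add_one_le_exp π]) _

lemma extra_tail (hF : NF u F) {π Λ : ℝ} (h0 : 0 ≤ π) (h1 : π ≤ 1) (hn : 1 ≤ n) (hΛ : 1 ≤ Λ)
    (hπ : π * (n : ℝ) ^ (r - 1) ≤ Λ) :
    ex (qJ (allFEdges F n) π)
      (fun H => ind (∃ h ∈ allFEdges F n, h.2 ⊆ (H.erase h).biUnion Prod.snd)) ≤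
      (F.card + 2) * ((r + 1) ^ r * Λ) ^ (F.card + 1) / n := by
  have hq := Pq_qJ (allFEdges F n) h0 h1
  have hr := hF.hr
  have hn0 : (0 : ℝ) < n := by exact_mod_cast hn
  have hn1 : (1 : ℝ) ≤ n := by exact_mod_cast hn
  set w0 : ℝ := (r + 1) ^ r * Λ with hw0
  have hw01 : 1 ≤ w0 := by
    have : (1 : ℝ) ≤ (r + 1) ^ r := one_le_pow₀ (by linarith [Nat.cast_nonneg (α := ℝ) r])
    nlinarith
  have hone : ∀ h ∈ allFEdges F n, ex (qJ (allFEdges F n) π)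
      (fun H => ind (h.2 ⊆ (H.erase h).biUnion Prod.snd)) ≤
      (F.card + 2) * w0 ^ (F.card + 1) / n ^ (r + 1) := by
    intro h hh
    let w : FE n → ℝ := fun g => π * ((n : ℝ) ^ (g.1 ∩ h.1).card / n)
    have hw : ∀ g, 0 ≤ w g := fun g => by positivity
    have hpt : ∀ H ⊆ allFEdges F n, ind (h.2 ⊆ (H.erase h).biUnion Prod.snd) ≤
        ∑ k ∈ Finset.range (F.card + 2), ∑ C ∈ (allFEdges F n).powersetCard k,
          ((∏ g ∈ C, ((n : ℝ) ^ (g.1 ∩ h.1).card / n)) / n ^ (r + 1)) * ind (C ⊆ H) := by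
      intro H hH
      have hnn : ∀ C : Finset (FE n), 0 ≤
          ((∏ g ∈ C, ((n : ℝ) ^ (g.1 ∩ h.1).card / n)) / n ^ (r + 1)) * ind (C ⊆ H) :=
        fun C => mul_nonneg (by positivity) (ind_nonneg _)
      by_cases hs : h.2 ⊆ (H.erase h).biUnion Prod.snd
      · rw [ind_pos hs]
        obtain ⟨C, hCs, hCc, hC1, hC2⟩ := extra_struct hF hH hh hs
        have hCH : C ⊆ H := hCs.trans (Finset.erase_subset _ _)
        have hmem : C ∈ (allFEdges F n).powersetCard C.card :=
          Finset.mem_powersetCard.2 ⟨hCH.trans hH, rfl⟩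
        refine le_trans ?_ (Finset.single_le_sum (f := fun k => ∑ C ∈ (allFEdges F n).powersetCard k,
          ((∏ g ∈ C, ((n : ℝ) ^ (g.1 ∩ h.1).card / n)) / n ^ (r + 1)) * ind (C ⊆ H))
          (fun k _ => Finset.sum_nonneg (fun C _ => hnn C))
          (Finset.mem_range.2 (by omega : C.card < F.card + 2)))
        refine le_trans ?_ (Finset.single_le_sum (f := fun C =>
          ((∏ g ∈ C, ((n : ℝ) ^ (g.1 ∩ h.1).card / n)) / n ^ (r + 1)) * ind (C ⊆ H))
          (fun C _ => hnn C) hmem)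
        rw [ind_pos hCH, mul_one, Finset.prod_div_distrib, Finset.prod_pow_eq_pow_sum,
          Finset.prod_const, div_div, ← pow_add, le_div_iff₀ (by positivity), one_mul]
        exact pow_le_pow_right₀ hn1 (by omega)
      · rw [ind_neg hs]
        exact Finset.sum_nonneg (fun k _ => Finset.sum_nonneg (fun C _ => hnn C))
    refine (ex_mono_on h0 h1 hpt).trans ?_
    rw [ex_sum]
    have hW : ∑ g ∈ allFEdges F n, w g ≤ w0 := by
      simp only [w]
      rw [← Finset.mul_sum, ← Finset.sum_div]
      have hb := W_bound F hh hn
      calc _ ≤ π * (((r + 1) * n) ^ r / n) := by gcongr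
        _ = π * (n : ℝ) ^ (r - 1) * (r + 1) ^ r := by
            obtain ⟨k, rfl⟩ : ∃ k, r = k + 1 := ⟨r - 1, by omega⟩
            rw [mul_pow, Nat.add_sub_cancel, pow_succ (n : ℝ)]
            field_simp
        _ ≤ Λ * (r + 1) ^ r := by gcongr
        _ = w0 := by rw [hw0]; ring
    have hWn : 0 ≤ ∑ g ∈ allFEdges F n, w g := Finset.sum_nonneg (fun g _ => hw g)
    have hk : ∀ k ∈ Finset.range (F.card + 2), ex (qJ (allFEdges F n) π) (fun H =>
        ∑ C ∈ (allFEdges F n).powersetCard k,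
          ((∏ g ∈ C, ((n : ℝ) ^ (g.1 ∩ h.1).card / n)) / n ^ (r + 1)) * ind (C ⊆ H)) ≤
        w0 ^ (F.card + 1) / n ^ (r + 1) := by
      intro k hk
      rw [ex_sum]
      have : ∀ C ∈ (allFEdges F n).powersetCard k, ex (qJ (allFEdges F n) π) (fun H =>
          ((∏ g ∈ C, ((n : ℝ) ^ (g.1 ∩ h.1).card / n)) / n ^ (r + 1)) * ind (C ⊆ H)) =
          (∏ g ∈ C, w g) / n ^ (r + 1) := by
        intro C hC
        rw [ex_mul_left, ex_subset, prod_qJ (Finset.mem_powersetCard.1 hC).1]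
        simp only [w]
        rw [Finset.prod_mul_distrib, Finset.prod_const]; ring
      rw [Finset.sum_congr rfl this, ← Finset.sum_div]
      gcongr
      calc _ ≤ (∑ g ∈ allFEdges F n, w g) ^ k := esymm_le _ w hw k
        _ ≤ w0 ^ k := pow_le_pow_left₀ hWn hW k
        _ ≤ w0 ^ (F.card + 1) := pow_le_pow_right₀ hw01 (by
            have := Finset.mem_range.1 hk; omega)
    refine (Finset.sum_le_sum hk).trans (le_of_eq ?_)
    rw [Finset.sum_const, Finset.card_range, nsmul_eq_mul]; push_cast; ring
  refine (ex_mono hq (fun H => ind_exists_le (allFEdges F n) _)).trans ?_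
  rw [ex_sum]
  refine (Finset.sum_le_sum hone).trans ?_
  rw [Finset.sum_const, nsmul_eq_mul]
  have hc : ((allFEdges F n).card : ℝ) ≤ n ^ r := by exact_mod_cast card_all_le F hn
  calc _ ≤ (n : ℝ) ^ r * ((F.card + 2) * w0 ^ (F.card + 1) / n ^ (r + 1)) := by
        gcongr
    _ = _ := by field_simp; ring

lemma bad_le (hF : NF u F) {π Λ X : ℝ} (h0 : 0 ≤ π) (h1 : π ≤ 1) (hn : 1 ≤ n) (hΛ : 1 ≤ Λ)
    (hπ : π * (n : ℝ) ^ (r - 1) ≤ Λ) (d : ℕ) (hX : ∀ v, π * Dv F n v ≤ X) :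
    ex (qJ (allFEdges F n) π) (fun H => ind (¬ Good F d H)) ≤
      n * (Real.exp X / 2 ^ (d + 1)) +
        (F.card + 2) * ((r + 1) ^ r * Λ) ^ (F.card + 1) / n := by
  have hq := Pq_qJ (allFEdges F n) h0 h1
  have hpt : ∀ H : Finset (FE n), ind (¬ Good F d H) ≤
      ∑ v : Fin n, ind (¬ degFE H v ≤ d) +
      ind (∃ h ∈ allFEdges F n, h.2 ⊆ (H.erase h).biUnion Prod.snd) := by
    intro H
    refine le_trans ?_ (add_le_add (ind_exists_le Finset.univ (fun v => ¬ degFE H v ≤ d)) le_rfl)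
    refine le_trans (ind_mono ?_) (ind_or_le _ _)
    intro hb
    by_contra hcon
    push Not at hcon
    exact hb ⟨fun v => hcon.1 v (Finset.mem_univ _), fun h hh hs => hcon.2 h hh hs⟩
  refine (ex_mono hq hpt).trans ?_
  rw [ex_add, ex_sum]
  refine add_le_add ?_ (extra_tail hF h0 h1 hn hΛ hπ)
  refine (Finset.sum_le_sum (g := fun _ => Real.exp X / 2 ^ (d + 1)) (fun v _ => ?_)).trans ?_
  · refine (deg_tail F h0 h1 v d).trans ?_
    gcongr
    exact hX v
  · simp

end Count

/-! ## Part 7: isolated vertices and the coupling at a fixed density -/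

section Lev
variable {u r : ℕ} {F : Finset (Finset (Fin r))} {n : ℕ}

/-- Isolated vertices of an `F`-graph. -/
def IsoH (H : Finset (FE n)) : Finset (Fin n) := Finset.univ.filter (fun v => ∀ h ∈ H, v ∉ h.1)

/-- Vertices in no copy of `F` inside `G`. -/
def IsoG (F : Finset (Finset (Fin r))) (G : Finset (Finset (Fin n))) : Finset (Fin n) :=
  Finset.univ.filter (fun v => ∀ h ∈ allFEdges F n, v ∈ h.1 → ¬ h.2 ⊆ G)

lemma mem_IsoH {H : Finset (FE n)} {v : Fin n} : v ∈ IsoH H ↔ ∀ h ∈ H, v ∉ h.1 := by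
  simp [IsoH]

lemma mem_IsoG {G : Finset (Finset (Fin n))} {v : Fin n} :
    v ∈ IsoG F G ↔ ∀ h ∈ allFEdges F n, v ∈ h.1 → ¬ h.2 ⊆ G := by
  simp [IsoG]

/-- Standing assumptions at a fixed density. -/
structure Lev (u : ℕ) {r : ℕ} (F : Finset (Finset (Fin r))) (n d : ℕ) (Λ p : ℝ) : Prop where
  hp0 : 0 ≤ p
  hp1 : p ≤ 1
  hΛ : 1 ≤ Λ
  hpn : (n : ℝ) ^ (r - 1) * p ^ F.card ≤ Λ
  hη : etaB r F.card d Λ n ≤ 1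
  hd : 1 ≤ d
  hn : 1 ≤ n

/-- The density of the `F`-graph. -/
def piF (F : Finset (Finset (Fin r))) (n d : ℕ) (Λ p : ℝ) : ℝ :=
  (1 - etaB r F.card d Λ n) * p ^ F.card

variable {d : ℕ} {Λ p : ℝ}

lemma Lev.eta0 (hL : Lev u F n d Λ p) : 0 ≤ etaB r F.card d Λ n := by
  have := hL.hΛ
  unfold etaB; positivity

lemma Lev.pi0 (hL : Lev u F n d Λ p) : 0 ≤ piF F n d Λ p :=
  mul_nonneg (by linarith [hL.hη]) (pow_nonneg hL.hp0 _)

lemma Lev.pi_le (hL : Lev u F n d Λ p) : piF F n d Λ p ≤ p ^ F.card := by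
  have h1 := hL.eta0
  have h2 := pow_nonneg hL.hp0 F.card
  unfold piF; nlinarith

lemma Lev.pi1 (hL : Lev u F n d Λ p) : piF F n d Λ p ≤ 1 :=
  hL.pi_le.trans (pow_le_one₀ hL.hp0 hL.hp1)

lemma Lev.PU (hL : Lev u F n d Λ p) : Pq (qJ (allUEdges u n) p) := Pq_qJ _ hL.hp0 hL.hp1
lemma Lev.PH (hL : Lev u F n d Λ p) : Pq (qJ (allFEdges F n) (piF F n d Λ p)) :=
  Pq_qJ _ hL.pi0 hL.pi1

lemma good_single (hF : NF u F) (hd : 1 ≤ d) {h : FE n} (hh : h ∈ allFEdges F n) :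
    Good F d (insert h (∅ : Finset (FE n))) := by
  refine ⟨fun v => ?_, fun g hg hs => ?_⟩
  · refine le_trans ?_ hd
    refine (Finset.card_filter_le _ _).trans (by simp)
  · by_cases hgh : g = h
    · subst hgh
      have hp := hF.pos
      rw [← fe_card2 hg] at hp
      obtain ⟨e, he⟩ := Finset.card_pos.1 hp
      have := hs he
      simp at this
    · have h1 : (insert h (∅ : Finset (FE n))).erase g = {h} := by
        ext x; simp only [Finset.mem_erase, Finset.mem_insert, Finset.mem_singleton]
        constructor
        · rintro ⟨_, h | h⟩
          · exact h
          · simp at h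
        · rintro rfl; exact ⟨fun h => hgh h.symm, Or.inl rfl⟩
      rw [h1, Finset.singleton_biUnion] at hs
      exact hgh (fe_eq hF hg hh hs)

lemma lev_key (hF : NF u F) (hL : Lev u F n d Λ p) {h : FE n} (hh : h ∈ allFEdges F n)
    {R N : Finset (FE n)} (hR : R ⊆ allFEdges F n) (hN : N ⊆ allFEdges F n)
    (hhN : h ∉ N) (hRN : Disjoint R N) (hg : Good F d (insert h R)) :
    piF F n d Λ p * ∑ G, bw (qJ (allUEdges u n) p) G *
        ind ((∀ i ∈ R, i.2 ⊆ G) ∧ ∀ i ∈ N, ¬ i.2 ⊆ G) ≤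
      ∑ G, bw (qJ (allUEdges u n) p) G *
        ind (h.2 ⊆ G ∧ (∀ i ∈ R, i.2 ⊆ G) ∧ ∀ i ∈ N, ¬ i.2 ⊆ G) := by
  have hQ := Q_bound hF hR hN hh hhN hRN hg hL.hp0 hL.hΛ hL.hpn
  have hk := key_lower hL.PU (R.biUnion Prod.snd) h.2 N Prod.snd _ hL.hη hQ
  rw [prod_qJ (fe_sub_all hF hh), fe_card2 hh] at hk
  have e1 : ∀ G : Finset (Finset (Fin n)),
      (R.biUnion Prod.snd ⊆ G) ↔ ∀ i ∈ R, i.2 ⊆ G := fun G => Finset.biUnion_subset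
  simp only [e1] at hk
  exact hk

lemma lev_couple (hF : NF u F) (hL : Lev u F n d Λ p) :
    ∃ γ : Finset (Finset (Fin n)) → Finset (FE n) → ℝ, (∀ G K, 0 ≤ γ G K) ∧
      (∀ G, ∑ K, γ G K = bw (qJ (allUEdges u n) p) G) ∧
      (∀ K, ∑ G, γ G K = bw (qJ (allFEdges F n) (piF F n d Λ p)) K) ∧
      (∀ G K, γ G K ≠ 0 → Good F d K → ∀ h ∈ K, h.2 ⊆ G) := by
  obtain ⟨γ, h1, h2, h3, h4⟩ := couple (ι := FE n) (Ω := Finset (Finset (Fin n)))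
    (fun h G => h.2 ⊆ G) (piF F n d Λ p) hL.pi0 hL.pi1 (allFEdges F n)
    (bw (qJ (allUEdges u n) p)) (bw_nonneg hL.PU) (Good F d) (fun S T hST hT => good_down hST hT)
    (fun j hj R hR N hN _ hjN hRN hg => lev_key hF hL hj hR hN hjN hRN hg)
  refine ⟨γ, h1, h2, fun K => ?_, h4⟩
  rw [h3, sum_bw, one_mul]

lemma lev_avoid (hF : NF u F) (hL : Lev u F n d Λ p) {J : Finset (FE n)}
    (hJ : J ⊆ allFEdges F n) :
    ex (qJ (allUEdges u n) p) (fun G => ind (∀ i ∈ J, ¬ i.2 ⊆ G)) ≤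
      (1 - piF F n d Λ p) ^ J.card := by
  have := avoid_le (ι := FE n) (Ω := Finset (Finset (Fin n))) (fun h G => h.2 ⊆ G)
    (piF F n d Λ p) hL.pi1 (bw (qJ (allUEdges u n) p)) (allFEdges F n) ?_ J hJ
  · rw [sum_bw, mul_one] at this; exact this
  · intro j hj N hN hjN
    have := lev_key hF hL hj (Finset.empty_subset _) hN hjN (Finset.disjoint_empty_left _)
      (good_single hF hL.hd hj)
    simpa using this

lemma lev_avoid_lower (hF : NF u F) (hL : Lev u F n d Λ p) {J : Finset (FE n)}
    (hJ : J ⊆ allFEdges F n) :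
    (1 - p ^ F.card) ^ J.card ≤
      ex (qJ (allUEdges u n) p) (fun G => ind (∀ i ∈ J, ¬ i.2 ⊆ G)) := by
  have := harris_avoid hL.PU J (Prod.snd : FE n → _)
  rw [Finset.prod_congr rfl (fun j hj => by
    rw [prod_qJ (fe_sub_all hF (hJ hj)), fe_card2 (hJ hj)]), Finset.prod_const] at this
  exact this

/-- Copies through a vertex. -/
def Jv (F : Finset (Finset (Fin r))) (v : Fin n) : Finset (FE n) :=
  (allFEdges F n).filter (fun g => v ∈ g.1)

lemma Jv_sub (v : Fin n) : Jv F v ⊆ allFEdges F n := Finset.filter_subset _ _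
lemma Jv_card (v : Fin n) : (Jv F v).card = Dv F n v := rfl
lemma mem_Jv {v : Fin n} {g : FE n} : g ∈ Jv F v ↔ g ∈ allFEdges F n ∧ v ∈ g.1 := by simp [Jv]

lemma indG (v : Fin n) (G : Finset (Finset (Fin n))) :
    ind (v ∈ IsoG F G) = ind (∀ i ∈ Jv F v, ¬ i.2 ⊆ G) :=
  ind_congr (by rw [mem_IsoG]; simp only [mem_Jv, and_imp])

lemma indGG (v w : Fin n) (G : Finset (Finset (Fin n))) :
    ind (v ∈ IsoG F G ∧ w ∈ IsoG F G) = ind (∀ i ∈ Jv F v ∪ Jv F w, ¬ i.2 ⊆ G) :=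
  ind_congr (by
    rw [mem_IsoG, mem_IsoG]; simp only [Finset.mem_union, mem_Jv]
    constructor
    · rintro ⟨a, b⟩ i (hi | hi)
      · exact a i hi.1 hi.2
      · exact b i hi.1 hi.2
    · intro a
      exact ⟨fun h h1 h2 => a h (Or.inl ⟨h1, h2⟩), fun h h1 h2 => a h (Or.inr ⟨h1, h2⟩)⟩)

lemma H_avoid {J : Finset (FE n)} (hJ : J ⊆ allFEdges F n) (x : ℝ) :
    ex (qJ (allFEdges F n) x) (fun H => ind (Disjoint J H)) = (1 - x) ^ J.card := by
  rw [ex_disj, Finset.prod_congr rfl (fun e he => by rw [qJ, if_pos (hJ he)]), Finset.prod_const]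

lemma IsoH_iff {H : Finset (FE n)} (hH : H ⊆ allFEdges F n) (v : Fin n) :
    v ∈ IsoH H ↔ Disjoint (Jv F v) H := by
  rw [mem_IsoH, Finset.disjoint_left]
  simp only [mem_Jv]
  exact ⟨fun a g hg hH' => a g hH' hg.2, fun a g hg hv => a ⟨hH hg, hv⟩ hg⟩

lemma exH1 (v : Fin n) (x : ℝ) :
    ex (qJ (allFEdges F n) x) (fun H => ind (v ∈ IsoH H)) = (1 - x) ^ Dv F n v := by
  rw [ex_congr_on (g := fun H => ind (Disjoint (Jv F v) H))
    (fun H hH => ind_congr (IsoH_iff hH v)), H_avoid (Jv_sub v), Jv_card]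

lemma exH2 (v w : Fin n) (x : ℝ) :
    ex (qJ (allFEdges F n) x) (fun H => ind (v ∈ IsoH H ∧ w ∈ IsoH H)) =
      (1 - x) ^ (Jv F v ∪ Jv F w).card := by
  rw [ex_congr_on (g := fun H => ind (Disjoint (Jv F v ∪ Jv F w) H))
    (fun H hH => ind_congr (by
      rw [IsoH_iff hH v, IsoH_iff hH w, Finset.disjoint_union_left])),
      H_avoid (Finset.union_subset (Jv_sub v) (Jv_sub w))]

lemma Jv_union (v w : Fin n) : (Jv F v ∪ Jv F w).card +
    ((allFEdges F n).filter (fun g => v ∈ g.1 ∧ w ∈ g.1)).card = Dv F n v + Dv F n w := by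
  rw [← Jv_card, ← Jv_card, ← Finset.card_union_add_card_inter (Jv F v) (Jv F w)]
  congr 2
  ext g; simp only [Finset.mem_filter, Finset.mem_inter, mem_Jv]; tauto

/-- The second moment term bound. -/
lemma pair_bound {v w : Fin n} (hvw : v ≠ w) {x δ : ℝ} (h0 : 0 ≤ x) (h1 : x ≤ 1)
    (hδ : (r : ℝ) * r * n ^ (r - 2) * x ≤ δ) (hδ2 : δ ≤ 1 / 2) :
    (1 - x) ^ (Jv F v ∪ Jv F w).card ≤ (1 - x) ^ (Dv F n v) * (1 - x) ^ (Dv F n v) * (1 + 2 * δ) := by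
  have hu := Jv_union (F := F) v w
  have hD := D2_le F hvw
  set D2 := ((allFEdges F n).filter (fun g => v ∈ g.1 ∧ w ∈ g.1)).card
  rw [Dv_eq F w v] at hu
  have hD' : (D2 : ℝ) ≤ r * r * n ^ (r - 2) := by exact_mod_cast hD
  have h2 : 1 - δ ≤ (1 - x) ^ D2 := by
    have := one_add_mul_le_pow (a := -x) (by linarith) D2
    have h3 : (D2 : ℝ) * x ≤ δ := (mul_le_mul_of_nonneg_right hD' h0).trans hδ
    have e : (1 + -x) = 1 - x := by ring
    rw [e] at this
    linarith
  have hδ0 : 0 ≤ δ := le_trans (by positivity) hδ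
  have h4 : (1 - x) ^ (Jv F v ∪ Jv F w).card * (1 - δ) ≤
      (1 - x) ^ (Dv F n v) * (1 - x) ^ (Dv F n v) := by
    rw [← pow_add, ← hu, pow_add]
    exact mul_le_mul_of_nonneg_left h2 (pow_nonneg (by linarith) _)
  have h5 : 1 ≤ (1 - δ) * (1 + 2 * δ) := by nlinarith
  have h6 : 0 ≤ (1 - x) ^ (Jv F v ∪ Jv F w).card := pow_nonneg (by linarith) _
  calc _ ≤ (1 - x) ^ (Jv F v ∪ Jv F w).card * ((1 - δ) * (1 + 2 * δ)) := by nlinarith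
    _ = ((1 - x) ^ (Jv F v ∪ Jv F w).card * (1 - δ)) * (1 + 2 * δ) := by ring
    _ ≤ _ := mul_le_mul_of_nonneg_right h4 (by linarith)

end Lev

section SM
variable {E V : Type*} [Fintype E] [DecidableEq E] [Fintype V] [DecidableEq V]

lemma card_ind (I : Finset V) : (I.card : ℝ) = ∑ v, ind (v ∈ I) := by
  rw [sum_ind]; simp

/-- Second moment from pair bounds. -/
lemma second_moment (q : E → ℝ) (I : Finset E → Finset V) (b c : ℝ) (hc : 0 ≤ c)
    (h1 : ∀ v, ex q (fun A => ind (v ∈ I A)) ≤ b)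
    (h2 : ∀ v w, v ≠ w → ex q (fun A => ind (v ∈ I A ∧ w ∈ I A)) ≤ c) :
    ex q (fun A => ((I A).card : ℝ) ^ 2) ≤ Fintype.card V * b + Fintype.card V ^ 2 * c := by
  have e : ∀ A, ((I A).card : ℝ) ^ 2 = ∑ v, ∑ w, ind (v ∈ I A ∧ w ∈ I A) := by
    intro A
    rw [card_ind, sq, Finset.sum_mul_sum]
    simp only [ind_and]
  rw [ex_congr q e, ex_sum]
  have : ∀ v, ex q (fun A => ∑ w, ind (v ∈ I A ∧ w ∈ I A)) ≤ b + Fintype.card V * c := by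
    intro v
    rw [ex_sum, ← Finset.add_sum_erase _ _ (Finset.mem_univ v)]
    refine add_le_add ?_ ?_
    · simpa using h1 v
    · refine (Finset.sum_le_card_nsmul _ _ c (fun w hw => h2 v w (Finset.ne_of_mem_erase hw).symm)).trans ?_
      rw [nsmul_eq_mul]
      refine mul_le_mul_of_nonneg_right ?_ hc
      exact_mod_cast (Finset.card_le_univ _)
  refine (Finset.sum_le_sum (fun v _ => this v)).trans ?_
  rw [Finset.sum_const, nsmul_eq_mul, Finset.card_univ]
  apply le_of_eq; ring

end SM

/-! ## Part 8: the mass of good transitions at a fixed density -/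

section Marg
variable {A B : Type*} [Fintype A] [Fintype B]

lemma marg_left (γ : A → B → ℝ) (a : A → ℝ) (h : ∀ x, ∑ y, γ x y = a x) (f : A → ℝ) :
    ∑ x, ∑ y, γ x y * f x = ∑ x, a x * f x :=
  Finset.sum_congr rfl (fun x _ => by rw [← Finset.sum_mul, h])

lemma marg_right (γ : A → B → ℝ) (b : B → ℝ) (h : ∀ y, ∑ x, γ x y = b y) (f : B → ℝ) :
    ∑ x, ∑ y, γ x y * f y = ∑ y, b y * f y := by
  rw [Finset.sum_comm]
  exact Finset.sum_congr rfl (fun x _ => by rw [← Finset.sum_mul, h])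

end Marg

section Mass
variable {u r : ℕ} {F : Finset (Finset (Fin r))} {n : ℕ} {d : ℕ} {Λ p : ℝ}

/-- `h` may be added to `G` as the only new copy at `v`. -/
def Cp (F : Finset (Finset (Fin r))) (G : Finset (Finset (Fin n))) (h : FE n) (v : Fin n) : Prop :=
  Disjoint h.2 G ∧ ∀ g ∈ Jv F v, g.2 ⊆ G ∪ h.2 → g = h

/-- The transition relation. -/
def Tr (F : Finset (Finset (Fin r))) (G : Finset (Finset (Fin n))) (K : Finset (FE n))
    (h : FE n) (v : Fin n) : Prop :=
  IsoG F G = {v} ∧ IsoH K = {v} ∧ h ∈ Jv F v ∧ Cp F G h v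

lemma IsoG_anti {G G' : Finset (Finset (Fin n))} (h : G ⊆ G') : IsoG F G' ⊆ IsoG F G := by
  intro v hv
  rw [mem_IsoG] at hv ⊢
  exact fun g hg hvg hs => hv g hg hvg (hs.trans h)

lemma lev_C (hF : NF u F) (hL : Lev u F n d Λ p) {v : Fin n} {h : FE n} (hh : h ∈ Jv F v) :
    ex (qJ (allUEdges u n) p) (fun G => ind (v ∈ IsoG F G ∧ ¬ Cp F G h v)) ≤
      (1 - piF F n d Λ p) ^ Dv F n v * (F.card * p + etaB r F.card d Λ n) := by
  have hq := hL.PU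
  have hha := Jv_sub v hh
  set N := (Jv F v).erase h with hN
  set N1 := N.filter (fun g => ¬ (g.2 ∩ h.2 ⊆ (∅ : Finset (FE n)).biUnion Prod.snd)) with hN1
  have hpt : ∀ G, ind (v ∈ IsoG F G ∧ ¬ Cp F G h v) ≤
      ∑ e ∈ h.2, ind (({e} : Finset _) ⊆ G ∧ v ∈ IsoG F G) +
      ∑ g ∈ N1, ind (g.2 \ ((∅ : Finset (FE n)).biUnion Prod.snd ∪ h.2) ⊆ G ∧ v ∈ IsoG F G) := by
    intro G
    refine le_trans ?_ (add_le_add (ind_exists_le h.2 _) (ind_exists_le N1 _))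
    refine le_trans (ind_mono ?_) (ind_or_le _ _)
    rintro ⟨hv, hC⟩
    by_cases hd : Disjoint h.2 G
    · right
      have : ¬ ∀ g ∈ Jv F v, g.2 ⊆ G ∪ h.2 → g = h := fun h' => hC ⟨hd, h'⟩
      push Not at this
      obtain ⟨g, hg, hs, hne⟩ := this
      refine ⟨g, ?_, ?_, hv⟩
      · rw [hN1, Finset.mem_filter]
        refine ⟨Finset.mem_erase.2 ⟨hne, hg⟩, fun h0 => ?_⟩
        rw [mem_IsoG] at hv
        have hg' := mem_Jv.1 hg
        apply hv g hg'.1 hg'.2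
        intro e he
        rcases Finset.mem_union.1 (hs he) with h1 | h1
        · exact h1
        · have := h0 (Finset.mem_inter.2 ⟨he, h1⟩); simp at this
      · intro e he
        simp only [Finset.biUnion_empty, Finset.empty_union, Finset.mem_sdiff] at he
        rcases Finset.mem_union.1 (hs he.1) with h1 | h1
        · exact h1
        · exact absurd h1 he.2
    · left
      rw [Finset.not_disjoint_iff] at hd
      obtain ⟨e, he, heG⟩ := hd
      exact ⟨e, he, by simpa using heG, hv⟩
  have hiso : ex (qJ (allUEdges u n) p) (fun G => ind (v ∈ IsoG F G)) ≤
      (1 - piF F n d Λ p) ^ Dv F n v := by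
    rw [ex_congr _ (indG v)]; exact lev_avoid hF hL (Jv_sub v)
  have hb0 : 0 ≤ ex (qJ (allUEdges u n) p) (fun G => ind (v ∈ IsoG F G)) :=
    ex_nonneg hq (fun _ => ind_nonneg _)
  have hone : ∀ T : Finset (Finset (Fin n)),
      ex (qJ (allUEdges u n) p) (fun G => ind (T ⊆ G ∧ v ∈ IsoG F G)) ≤
      (∏ e ∈ T, qJ (allUEdges u n) p e) * ex (qJ (allUEdges u n) p) (fun G => ind (v ∈ IsoG F G)) := by
    intro T
    rw [← ex_subset]
    exact harris_ud hq (P := fun G => T ⊆ G) (Q := fun G => v ∈ IsoG F G)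
      (fun A B h h1 => h1.trans h) (fun A B h h1 => IsoG_anti h h1)
  have hQ := Q_bound hF (R := ∅) (N := N) (Finset.empty_subset _)
    ((Finset.erase_subset _ _).trans (Jv_sub v)) hha (by simp [hN]) (Finset.disjoint_empty_left _)
    (good_single hF hL.hd hha) hL.hp0 hL.hΛ hL.hpn
  have hs : ∑ e ∈ h.2, ∏ e' ∈ ({e} : Finset (Finset (Fin n))), qJ (allUEdges u n) p e' =
      F.card * p := by
    rw [Finset.sum_congr rfl (fun e he => by
      rw [Finset.prod_singleton, qJ, if_pos (fe_sub_all hF hha he)])]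
    rw [Finset.sum_const, fe_card2 hha, nsmul_eq_mul]
  refine (ex_mono hq hpt).trans ?_
  rw [ex_add, ex_sum, ex_sum]
  refine (add_le_add (Finset.sum_le_sum (fun e _ => hone {e}))
    (Finset.sum_le_sum (fun g _ => hone _))).trans ?_
  rw [← Finset.sum_mul, ← Finset.sum_mul, hs, ← add_mul, mul_comm]
  have hη := hL.eta0
  have hp := hL.hp0
  exact mul_le_mul hiso (add_le_add le_rfl hQ)
    (add_nonneg (by positivity) (Finset.sum_nonneg (fun g _ =>
      Finset.prod_nonneg (fun e _ => (hq e).1)))) (pow_nonneg (by linarith [hL.pi1]) _)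

/-- The error term at a fixed density. -/
def errL (F : Finset (Finset (Fin r))) (n d D : ℕ) (Λ p PB δ t : ℝ) : ℝ :=
  PB + (n * (1 - piF F n d Λ p) ^ D - n * (1 - p ^ F.card) ^ D) +
    t * (n * (1 - piF F n d Λ p) ^ D +
      n ^ 2 * ((1 - piF F n d Λ p) ^ D * (1 - piF F n d Λ p) ^ D * (1 + 2 * δ))) + PB / t +
    n * (1 - piF F n d Λ p) ^ D * (F.card * p + etaB r F.card d Λ n)

set_option maxHeartbeats 2000000 in
lemma lev_mass (hF : NF u F) (hL : Lev u F n d Λ p) {D : ℕ} (hD : ∀ v, Dv F n v = D)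
    {PB δ t : ℝ} (ht : 0 < t)
    (hPB : ex (qJ (allFEdges F n) (piF F n d Λ p)) (fun H => ind (¬ Good F d H)) ≤ PB)
    (hδ : (r : ℝ) * r * n ^ (r - 2) * (piF F n d Λ p) ≤ δ) (hδ2 : δ ≤ 1 / 2) :
    ∃ γ : Finset (Finset (Fin n)) → Finset (FE n) → ℝ, (∀ G K, 0 ≤ γ G K) ∧
      (∀ G, ∑ K, γ G K ≤ bw (qJ (allUEdges u n) p) G) ∧
      (∀ K, ∑ G, γ G K ≤ bw (qJ (allFEdges F n) (piF F n d Λ p)) K) ∧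
      (∀ G K, γ G K ≠ 0 → ∀ h ∈ K, h.2 ⊆ G) ∧
      D * (ex (qJ (allFEdges F n) (piF F n d Λ p)) (fun H => ind ((IsoH H).card = 1)) -
        errL F n d D Λ p PB δ t) ≤
        ∑ G, ∑ K, γ G K * ∑ v, ∑ h, ind (Tr F G K h v) := by
  obtain ⟨γ, h1, h2, h3, h4⟩ := lev_couple hF hL
  have hqU := hL.PU
  have hqH := hL.PH
  set π := piF F n d Λ p with hπ
  set b := (1 - π) ^ D with hb
  have hb0 : 0 ≤ b := pow_nonneg (by linarith [hL.pi1]) _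
  have hδ0 : 0 ≤ δ := le_trans (by have := hL.pi0; rw [← hπ] at this; positivity) hδ
  have g1 : ∀ G K, γ G K * ind (Good F d K) ≤ γ G K := fun G K =>
    mul_le_of_le_one_right (h1 G K) (ind_le_one _)
  refine ⟨fun G K => γ G K * ind (Good F d K), fun G K => mul_nonneg (h1 G K) (ind_nonneg _),
    fun G => ?_, fun K => ?_, ?_, ?_⟩
  · rw [← h2]; exact Finset.sum_le_sum (fun K _ => g1 G K)
  · rw [← h3]; exact Finset.sum_le_sum (fun G _ => g1 G K)
  · intro G K hne
    refine h4 G K (left_ne_zero_of_mul hne) ?_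
    by_contra hng
    exact hne (show γ G K * ind (Good F d K) = 0 by rw [ind_neg hng, mul_zero])
  -- pointwise bound
  have hpt1 : ∀ G K, γ G K ≠ 0 → ind (¬ (Good F d K ∧ IsoG F G = IsoH K)) ≤
      ind (¬ Good F d K) + ((IsoH K).card - (IsoG F G).card) +
        (t * ((IsoG F G).card : ℝ) ^ 2 + ind (¬ Good F d K) / t) := by
    intro G K hne
    have hY : (0 : ℝ) ≤ (IsoG F G).card := Nat.cast_nonneg _
    have hX : (0 : ℝ) ≤ (IsoH K).card := Nat.cast_nonneg _
    by_cases hg : Good F d K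
    · have hsub : IsoG F G ⊆ IsoH K := by
        intro v hv
        rw [mem_IsoG] at hv
        rw [mem_IsoH]
        intro g hgK hvg
        by_cases hga : g ∈ allFEdges F n
        · exact hv g hga hvg (h4 G K hne hg g hgK)
        · have hz : bw (qJ (allFEdges F n) π) K = 0 := bw_qJ_zero (fun hs => hga (hs hgK)) _
          rw [← h3] at hz
          have := (Finset.sum_eq_zero_iff_of_nonneg (fun G _ => h1 G K)).1 hz G (Finset.mem_univ _)
          exact hne this
      rw [ind_neg (not_not.2 hg)]
      have hc := Finset.card_le_card hsub
      have hc' : ((IsoG F G).card : ℝ) ≤ (IsoH K).card := by exact_mod_cast hc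
      have ht2 : 0 ≤ t * ((IsoG F G).card : ℝ) ^ 2 := by positivity
      by_cases heq : IsoG F G = IsoH K
      · rw [ind_neg (not_not.2 ⟨hg, heq⟩)]; simp only [zero_div, add_zero, zero_add]; linarith
      · have hlt : (IsoG F G).card < (IsoH K).card :=
          Finset.card_lt_card (lt_of_le_of_ne hsub heq)
        have hlt' : ((IsoG F G).card : ℝ) + 1 ≤ (IsoH K).card := by exact_mod_cast hlt
        have := ind_le_one (¬ (Good F d K ∧ IsoG F G = IsoH K))
        simp only [zero_div, add_zero, zero_add]; linarith
    · rw [ind_pos hg, ind_pos (fun h => hg h.1)]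
      have : ((IsoG F G).card : ℝ) ≤ t * ((IsoG F G).card : ℝ) ^ 2 + 1 / t := by
        set Y := ((IsoG F G).card : ℝ)
        have h5 : 0 ≤ (t * Y - 1) ^ 2 / t := by positivity
        have h6 : (t * Y - 1) ^ 2 / t = t * Y ^ 2 - 2 * Y + 1 / t := by field_simp; ring
        linarith
      linarith
  have hpt2 : ∀ (G : Finset (Finset (Fin n))) (K : Finset (FE n)), D * ind ((IsoH K).card = 1) -
      D * ind (¬ (Good F d K ∧ IsoG F G = IsoH K)) -
        ∑ v, ∑ h ∈ Jv F v, ind (v ∈ IsoG F G ∧ ¬ Cp F G h v) ≤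
      ind (Good F d K) * ∑ v, ∑ h, ind (Tr F G K h v) := by
    intro G K
    have hS0 : 0 ≤ ∑ v, ∑ h ∈ Jv F v, ind (v ∈ IsoG F G ∧ ¬ Cp F G h v) :=
      Finset.sum_nonneg (fun v _ => Finset.sum_nonneg (fun h _ => ind_nonneg _))
    have hR0 : 0 ≤ ind (Good F d K) * ∑ v, ∑ h, ind (Tr F G K h v) :=
      mul_nonneg (ind_nonneg _) (Finset.sum_nonneg (fun v _ => Finset.sum_nonneg (fun h _ => ind_nonneg _)))
    by_cases hc : (IsoH K).card = 1
    · by_cases hge : Good F d K ∧ IsoG F G = IsoH K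
      · obtain ⟨v, hv⟩ := Finset.card_eq_one.1 hc
        have hvG : v ∈ IsoG F G := by rw [hge.2, hv]; simp
        rw [ind_pos hc, ind_neg (not_not.2 hge), ind_pos hge.1, one_mul, mul_one, mul_zero, sub_zero]
        have l1 : ∑ h ∈ Jv F v, ind (v ∈ IsoG F G ∧ ¬ Cp F G h v) ≤
            ∑ v, ∑ h ∈ Jv F v, ind (v ∈ IsoG F G ∧ ¬ Cp F G h v) :=
          Finset.single_le_sum (f := fun v => ∑ h ∈ Jv F v, ind (v ∈ IsoG F G ∧ ¬ Cp F G h v))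
            (fun v _ => Finset.sum_nonneg (fun h _ => ind_nonneg _)) (Finset.mem_univ v)
        have l2 : ∑ h, ind (Tr F G K h v) ≤ ∑ v, ∑ h, ind (Tr F G K h v) :=
          Finset.single_le_sum (f := fun v => ∑ h, ind (Tr F G K h v))
            (fun v _ => Finset.sum_nonneg (fun h _ => ind_nonneg _)) (Finset.mem_univ v)
        have l3 : ∑ h ∈ Jv F v, ind (Tr F G K h v) ≤ ∑ h, ind (Tr F G K h v) :=
          Finset.sum_le_sum_of_subset_of_nonneg (Finset.subset_univ _) (fun h _ _ => ind_nonneg _)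
        have l4 : (D : ℝ) = ∑ h ∈ Jv F v, (ind (Tr F G K h v) +
            ind (v ∈ IsoG F G ∧ ¬ Cp F G h v)) := by
          rw [Finset.sum_congr rfl (g := fun _ => (1 : ℝ)), Finset.sum_const, Jv_card, hD]
          · simp
          · intro h hh
            by_cases hC : Cp F G h v
            · rw [ind_pos (show Tr F G K h v from ⟨hge.2.trans hv, hv, hh, hC⟩),
                ind_neg (fun h' => h'.2 hC), add_zero]
            · rw [ind_neg (fun h' : Tr F G K h v => hC h'.2.2.2), ind_pos ⟨hvG, hC⟩, zero_add]
        rw [Finset.sum_add_distrib] at l4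
        linarith
      · rw [ind_pos hc, ind_pos hge]; linarith
    · rw [ind_neg hc]
      have := mul_nonneg (Nat.cast_nonneg (α := ℝ) D)
        (ind_nonneg (¬ (Good F d K ∧ IsoG F G = IsoH K)))
      linarith
  -- expectations
  have eX : ex (qJ (allFEdges F n) π) (fun K => ((IsoH K).card : ℝ)) = n * b := by
    rw [ex_congr _ (fun K => card_ind (IsoH K)), ex_sum,
      Finset.sum_congr rfl (fun v _ => by rw [exH1 v π, hD])]
    simp [hb]
  have eY : n * (1 - p ^ F.card) ^ D ≤
      ex (qJ (allUEdges u n) p) (fun G => ((IsoG F G).card : ℝ)) := by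
    rw [ex_congr _ (fun G => card_ind (IsoG F G)), ex_sum]
    refine le_trans (by simp) (Finset.card_nsmul_le_sum _ _ ((1 - p ^ F.card) ^ D) (fun v _ => ?_))
    rw [ex_congr _ (indG v), ← hD v]; exact lev_avoid_lower hF hL (Jv_sub v)
  have eY2 : ex (qJ (allUEdges u n) p) (fun G => ((IsoG F G).card : ℝ) ^ 2) ≤
      n * b + n ^ 2 * (b * b * (1 + 2 * δ)) := by
    have := second_moment (qJ (allUEdges u n) p) (IsoG F) b (b * b * (1 + 2 * δ)) (by positivity)
      (fun v => by
        rw [ex_congr _ (indG v), hb, ← hD v]; exact lev_avoid hF hL (Jv_sub v))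
      (fun v w hvw => by
        rw [ex_congr _ (indGG v w), hb, ← hD v]
        exact (lev_avoid hF hL (Finset.union_subset (Jv_sub v) (Jv_sub w))).trans
          (pair_bound hvw hL.pi0 hL.pi1 hδ hδ2))
    simpa using this
  have hT1 : ∑ G, ∑ K, γ G K * ind (¬ (Good F d K ∧ IsoG F G = IsoH K)) ≤
      PB + (n * b - n * (1 - p ^ F.card) ^ D) +
        t * (n * b + n ^ 2 * (b * b * (1 + 2 * δ))) + PB / t := by
    have l1 : ∑ G, ∑ K, γ G K * ind (¬ (Good F d K ∧ IsoG F G = IsoH K)) ≤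
        ∑ G, ∑ K, γ G K * (((IsoH K).card : ℝ) + (1 + 1 / t) * ind (¬ Good F d K)) +
        ∑ G, ∑ K, γ G K * (t * ((IsoG F G).card : ℝ) ^ 2 - (IsoG F G).card) := by
      rw [← Finset.sum_add_distrib]
      refine Finset.sum_le_sum (fun G _ => ?_)
      rw [← Finset.sum_add_distrib]
      refine Finset.sum_le_sum (fun K _ => ?_)
      by_cases hne : γ G K = 0
      · simp [hne]
      · rw [← mul_add]
        refine mul_le_mul_of_nonneg_left ((hpt1 G K hne).trans (le_of_eq ?_)) (h1 G K)
        ring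
    rw [marg_right γ _ h3 (fun K => ((IsoH K).card : ℝ) + (1 + 1 / t) * ind (¬ Good F d K)),
      marg_left γ _ h2 (fun G => t * ((IsoG F G).card : ℝ) ^ 2 - (IsoG F G).card)] at l1
    have l2 : ex (qJ (allFEdges F n) π)
        (fun K => ((IsoH K).card : ℝ) + (1 + 1 / t) * ind (¬ Good F d K)) =
        n * b + (1 + 1 / t) * ex (qJ (allFEdges F n) π) (fun K => ind (¬ Good F d K)) := by
      rw [ex_add, eX, ex_mul_left]
    have l3 : ex (qJ (allUEdges u n) p)
        (fun G => t * ((IsoG F G).card : ℝ) ^ 2 - (IsoG F G).card) =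
        t * ex (qJ (allUEdges u n) p) (fun G => ((IsoG F G).card : ℝ) ^ 2) -
          ex (qJ (allUEdges u n) p) (fun G => ((IsoG F G).card : ℝ)) := by
      rw [ex_sub, ex_mul_left]
    have l4 := l1.trans (le_of_eq (congrArg₂ (· + ·) l2 l3))
    have l5 : (1 + 1 / t) * ex (qJ (allFEdges F n) π) (fun K => ind (¬ Good F d K)) ≤
        (1 + 1 / t) * PB := mul_le_mul_of_nonneg_left hPB (by positivity)
    have l6 := mul_le_mul_of_nonneg_left eY2 ht.le
    have l7 : (1 + 1 / t) * PB = PB + PB / t := by ring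
    linarith
  have hT2 : ∑ G, bw (qJ (allUEdges u n) p) G *
      ∑ v, ∑ h ∈ Jv F v, ind (v ∈ IsoG F G ∧ ¬ Cp F G h v) ≤
      D * (n * b * (F.card * p + etaB r F.card d Λ n)) := by
    have l1 : ex (qJ (allUEdges u n) p)
        (fun G => ∑ v, ∑ h ∈ Jv F v, ind (v ∈ IsoG F G ∧ ¬ Cp F G h v)) =
        ∑ v, ∑ h ∈ Jv F v, ex (qJ (allUEdges u n) p)
          (fun G => ind (v ∈ IsoG F G ∧ ¬ Cp F G h v)) := by
      rw [ex_sum]; exact Finset.sum_congr rfl (fun v _ => ex_sum _ _ _)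
    refine (le_of_eq l1).trans ?_
    have l2 : ∀ v : Fin n, ∑ h ∈ Jv F v, ex (qJ (allUEdges u n) p)
          (fun G => ind (v ∈ IsoG F G ∧ ¬ Cp F G h v)) ≤
          D * (b * (F.card * p + etaB r F.card d Λ n)) := by
      intro v
      refine (Finset.sum_le_card_nsmul _ _ _ (fun h hh => lev_C hF hL hh)).trans ?_
      rw [nsmul_eq_mul, Jv_card, hD]
    refine (Finset.sum_le_sum (fun v _ => l2 v)).trans (le_of_eq ?_)
    simp; ring
  have hfin : ∑ G, ∑ K, γ G K * (D * ind ((IsoH K).card = 1) -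
      D * ind (¬ (Good F d K ∧ IsoG F G = IsoH K)) -
        ∑ v, ∑ h ∈ Jv F v, ind (v ∈ IsoG F G ∧ ¬ Cp F G h v)) ≤
      ∑ G, ∑ K, γ G K * ind (Good F d K) * ∑ v, ∑ h, ind (Tr F G K h v) := by
    refine Finset.sum_le_sum (fun G _ => Finset.sum_le_sum (fun K _ => ?_))
    rw [mul_assoc]
    exact mul_le_mul_of_nonneg_left (hpt2 G K) (h1 G K)
  refine le_trans ?_ hfin
  simp only [mul_sub, Finset.sum_sub_distrib]
  have m1 := marg_right γ _ h3 (fun K => D * ind ((IsoH K).card = 1))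
  have m2 := marg_left γ _ h2 (fun G => ∑ v, ∑ h ∈ Jv F v, ind (v ∈ IsoG F G ∧ ¬ Cp F G h v))
  rw [m1, m2]
  have m3 : ∑ K, bw (qJ (allFEdges F n) π) K * (D * ind ((IsoH K).card = 1)) =
      D * ex (qJ (allFEdges F n) π) (fun H => ind ((IsoH H).card = 1)) :=
    ex_mul_left _ _ _
  have m4 : ∑ G, ∑ K, γ G K * (D * ind (¬ (Good F d K ∧ IsoG F G = IsoH K))) =
      D * ∑ G, ∑ K, γ G K * ind (¬ (Good F d K ∧ IsoG F G = IsoH K)) := by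
    simp only [Finset.mul_sum]
    exact Finset.sum_congr rfl (fun G _ => Finset.sum_congr rfl (fun K _ => by ring))
  rw [m3, m4]
  have m5 := mul_le_mul_of_nonneg_left hT1 (Nat.cast_nonneg (α := ℝ) D)
  have m6 : errL F n d D Λ p PB δ t = PB + (n * b - n * (1 - p ^ F.card) ^ D) +
        t * (n * b + n ^ 2 * (b * b * (1 + 2 * δ))) + PB / t +
        n * b * (F.card * p + etaB r F.card d Λ n) := rfl
  rw [m6]
  have m7 : D * (PB + (n * b - n * (1 - p ^ F.card) ^ D) +
        t * (n * b + n ^ 2 * (b * b * (1 + 2 * δ))) + PB / t +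
        n * b * (F.card * p + etaB r F.card d Λ n)) = D * (PB + (n * b - n * (1 - p ^ F.card) ^ D) +
        t * (n * b + n ^ 2 * (b * b * (1 + 2 * δ))) + PB / t) + D * (n * b * (F.card * p + etaB r F.card d Λ n)) := mul_add _ _ _
  linarith

end Mass

/-! ## Part 9: the probability that the random `F`-graph has no isolated vertex -/

section Tel
variable {u r : ℕ} {F : Finset (Finset (Fin r))} {n : ℕ}

/-- Probability of no isolated vertices. -/
def fH (F : Finset (Finset (Fin r))) (n : ℕ) (x : ℝ) : ℝ :=
  ex (qJ (allFEdges F n) x) (fun H => ind (IsoH H = ∅))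

/-- Probability of exactly one isolated vertex. -/
def gH (F : Finset (Finset (Fin r))) (n : ℕ) (x : ℝ) : ℝ :=
  ex (qJ (allFEdges F n) x) (fun H => ind ((IsoH H).card = 1))

lemma gH_nonneg {x : ℝ} (h0 : 0 ≤ x) (h1 : x ≤ 1) : 0 ≤ gH F n x :=
  ex_nonneg (Pq_qJ _ h0 h1) (fun _ => ind_nonneg _)

lemma gH_le {x : ℝ} (h0 : 0 ≤ x) (h1 : x ≤ 1) : gH F n x ≤ 1 := by
  have := ex_mono (Pq_qJ (allFEdges F n) h0 h1)
    (f := fun H => ind ((IsoH H).card = 1)) (g := fun _ => 1) (fun _ => ind_le_one _)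
  rwa [ex_const] at this

lemma IsoH_anti {A B : Finset (FE n)} (h : A ⊆ B) : IsoH B ⊆ IsoH A := by
  intro v hv
  rw [mem_IsoH] at hv ⊢
  exact fun g hg => hv g (h hg)

lemma hit_one {A : Finset (FE n)} {τ : ℝ} (h0 : 0 ≤ τ) (h1 : τ ≤ 1)
    {v : Fin n} (hv : v ∈ IsoH A) :
    ex (qJ (allFEdges F n) τ) (fun B => ind (IsoH (A ∪ B) = ∅)) ≤ Dv F n v * τ := by
  have hq := Pq_qJ (allFEdges F n) h0 h1
  have : ex (qJ (allFEdges F n) τ) (fun B => ind (IsoH (A ∪ B) = ∅)) ≤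
      ex (qJ (allFEdges F n) τ) (fun B => ∑ h ∈ Jv F v, ind (h ∈ B)) := by
    refine ex_mono_on h0 h1 (fun B hB => le_trans (ind_mono ?_) (ind_exists_le _ _))
    intro hE
    by_contra hcon
    push Not at hcon
    have : v ∈ IsoH (A ∪ B) := by
      rw [mem_IsoH] at hv ⊢
      intro h hh hvh
      rcases Finset.mem_union.1 hh with h' | h'
      · exact hv h h' hvh
      · exact hcon h (mem_Jv.2 ⟨hB h', hvh⟩) h'
    rw [hE] at this; simp at this
  refine this.trans ?_
  rw [ex_sum, Finset.sum_congr rfl (fun h hh => by rw [ex_mem, qJ, if_pos (Jv_sub v hh)])]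
  simp [Jv_card]

lemma hit_two {A : Finset (FE n)} {τ : ℝ} (h0 : 0 ≤ τ) (h1 : τ ≤ 1)
    {v w : Fin n} (hvw : v ≠ w) (hv : v ∈ IsoH A) (hw : w ∈ IsoH A) :
    ex (qJ (allFEdges F n) τ) (fun B => ind (IsoH (A ∪ B) = ∅)) ≤
      (r : ℝ) * r * n ^ (r - 2) * τ + (Dv F n v * τ) * (Dv F n w * τ) := by
  have hq := Pq_qJ (allFEdges F n) h0 h1
  set J2 := (allFEdges F n).filter (fun g => v ∈ g.1 ∧ w ∈ g.1) with hJ2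
  have : ex (qJ (allFEdges F n) τ) (fun B => ind (IsoH (A ∪ B) = ∅)) ≤
      ex (qJ (allFEdges F n) τ) (fun B => ∑ h ∈ J2, ind (h ∈ B) +
        ∑ z ∈ (Jv F v ×ˢ Jv F w).filter (fun z => z.1 ≠ z.2), ind ({z.1, z.2} ⊆ B)) := by
    refine ex_mono_on h0 h1 (fun B hB => le_trans (ind_mono ?_) ((ind_or_le _ _).trans
      (add_le_add (ind_exists_le _ _) (ind_exists_le _ _))))
    intro hE
    have key : ∀ x : Fin n, x ∈ IsoH A → ∃ h ∈ Jv F x, h ∈ B := by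
      intro x hx
      by_contra hcon
      push Not at hcon
      have : x ∈ IsoH (A ∪ B) := by
        rw [mem_IsoH] at hx ⊢
        intro h hh hvh
        rcases Finset.mem_union.1 hh with h' | h'
        · exact hx h h' hvh
        · exact hcon h (mem_Jv.2 ⟨hB h', hvh⟩) h'
      rw [hE] at this; simp at this
    obtain ⟨h, hh, hhB⟩ := key v hv
    obtain ⟨g, hg, hgB⟩ := key w hw
    by_cases heq : h = g
    · subst heq
      exact Or.inl ⟨h, Finset.mem_filter.2 ⟨(mem_Jv.1 hh).1, (mem_Jv.1 hh).2, (mem_Jv.1 hg).2⟩, hhB⟩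
    · refine Or.inr ⟨(h, g), Finset.mem_filter.2 ⟨Finset.mk_mem_product hh hg, heq⟩, ?_⟩
      intro e he
      simp only [Finset.mem_insert, Finset.mem_singleton] at he
      rcases he with rfl | rfl <;> assumption
  refine this.trans ?_
  rw [ex_add, ex_sum, ex_sum]
  refine add_le_add ?_ ?_
  · rw [Finset.sum_congr rfl (fun h hh => by
      rw [ex_mem, qJ, if_pos (Finset.mem_filter.1 hh).1]), Finset.sum_const, nsmul_eq_mul]
    refine mul_le_mul_of_nonneg_right ?_ h0
    exact_mod_cast D2_le F hvw
  · rw [Finset.sum_congr rfl (fun z hz => by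
      have hz' := Finset.mem_filter.1 hz
      have hz2 := Finset.mem_product.1 hz'.1
      rw [ex_subset, Finset.prod_pair hz'.2, qJ, qJ, if_pos (Jv_sub v hz2.1),
        if_pos (Jv_sub w hz2.2)]), Finset.sum_const, nsmul_eq_mul]
    have : (((Jv F v ×ˢ Jv F w).filter (fun z => z.1 ≠ z.2)).card : ℝ) ≤ Dv F n v * Dv F n w := by
      rw [← Jv_card, ← Jv_card]
      exact_mod_cast (Finset.card_filter_le _ _).trans (le_of_eq (Finset.card_product _ _))
    calc _ ≤ (Dv F n v * Dv F n w : ℝ) * (τ * τ) := mul_le_mul_of_nonneg_right this (by positivity)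
      _ = _ := by ring

lemma f_step {D : ℕ} (hD : ∀ v, Dv F n v = D) {x τ : ℝ} (hx0 : 0 ≤ x) (hx1 : x ≤ 1)
    (h0 : 0 ≤ τ) (h1 : τ ≤ 1) :
    fH F n (1 - (1 - x) * (1 - τ)) ≤ fH F n x + D * τ * gH F n x +
      ((r : ℝ) * r * n ^ (r - 2) * τ + (D * τ) * (D * τ)) := by
  have hq : qJ (allFEdges F n) (1 - (1 - x) * (1 - τ)) =
      fun e => 1 - (1 - qJ (allFEdges F n) x e) * (1 - qJ (allFEdges F n) τ e) := by
    funext e; unfold qJ; split_ifs <;> ring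
  unfold fH gH
  rw [hq, ex_union]
  set W := (r : ℝ) * r * n ^ (r - 2) * τ + (D * τ) * (D * τ) with hW
  have hW0 : 0 ≤ W := by positivity
  have hpt : ∀ A : Finset (FE n), ex (qJ (allFEdges F n) τ) (fun B => ind (IsoH (A ∪ B) = ∅)) ≤
      ind (IsoH A = ∅) + D * τ * ind ((IsoH A).card = 1) + W := by
    intro A
    have hDτ : 0 ≤ (D : ℝ) * τ := by positivity
    have i1 := mul_nonneg hDτ (ind_nonneg ((IsoH A).card = 1))
    by_cases hE : IsoH A = ∅
    · rw [ind_pos hE]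
      have := ex_mono (Pq_qJ (allFEdges F n) h0 h1)
        (f := fun B => ind (IsoH (A ∪ B) = ∅)) (g := fun _ => 1) (fun _ => ind_le_one _)
      rw [ex_const] at this
      linarith
    · by_cases hc : (IsoH A).card = 1
      · obtain ⟨v, hv⟩ := Finset.card_eq_one.1 hc
        have := hit_one (F := F) (A := A) h0 h1 (v := v) (by rw [hv]; simp)
        rw [hD] at this
        rw [ind_neg hE, ind_pos hc]; linarith
      · have : 1 < (IsoH A).card := by
          have := Finset.card_pos.2 (Finset.nonempty_iff_ne_empty.2 hE); omega
        obtain ⟨v, hv, w, hw, hvw⟩ := Finset.one_lt_card.1 this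
        have := hit_two (F := F) h0 h1 hvw hv hw
        rw [hD, hD] at this
        have := ind_nonneg (IsoH A = ∅)
        linarith
  refine (ex_mono (Pq_qJ (allFEdges F n) hx0 hx1) hpt).trans ?_
  rw [ex_add, ex_add, ex_mul_left, ex_const]

lemma eX_card {D : ℕ} (hD : ∀ v, Dv F n v = D) (x : ℝ) :
    ex (qJ (allFEdges F n) x) (fun K => ((IsoH K).card : ℝ)) = n * (1 - x) ^ D := by
  rw [ex_congr _ (fun K => card_ind (IsoH K)), ex_sum,
    Finset.sum_congr rfl (fun v _ => by rw [exH1 v x, hD])]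
  simp

lemma f_end {D : ℕ} (hD : ∀ v, Dv F n v = D) {x : ℝ} (hx0 : 0 ≤ x) (hx1 : x ≤ 1) :
    1 - n * (1 - x) ^ D ≤ fH F n x := by
  have : ex (qJ (allFEdges F n) x) (fun H => 1 - ((IsoH H).card : ℝ)) ≤ fH F n x := by
    refine ex_mono (Pq_qJ _ hx0 hx1) (fun H => ?_)
    by_cases hE : IsoH H = ∅
    · rw [ind_pos hE, hE]; simp
    · have := Finset.card_pos.2 (Finset.nonempty_iff_ne_empty.2 hE)
      have : (1 : ℝ) ≤ (IsoH H).card := by exact_mod_cast this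
      linarith [ind_nonneg (IsoH H = ∅)]
  rwa [ex_sub, ex_const, eX_card hD] at this

lemma f_start {D : ℕ} (hD : ∀ v, Dv F n v = D) {x δ : ℝ} (hx0 : 0 ≤ x) (hx1 : x < 1) (hn : 1 ≤ n)
    (hδ : (r : ℝ) * r * n ^ (r - 2) * x ≤ δ) (hδ2 : δ ≤ 1 / 2) :
    fH F n x ≤ 1 / (n * (1 - x) ^ D) + 2 * δ := by
  set b := (1 - x) ^ D with hb
  have hb0 : 0 < b := pow_pos (by linarith) _
  have hn0 : (0 : ℝ) < n := by exact_mod_cast hn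
  have hδ0 : 0 ≤ δ := le_trans (by positivity) hδ
  have hq := Pq_qJ (allFEdges F n) hx0 hx1.le
  have e2 : ex (qJ (allFEdges F n) x) (fun H => ((IsoH H).card : ℝ) ^ 2) ≤
      n * b + n ^ 2 * (b * b * (1 + 2 * δ)) := by
    have := second_moment (qJ (allFEdges F n) x) IsoH b (b * b * (1 + 2 * δ)) (by positivity)
      (fun v => by rw [exH1 v x, hD])
      (fun v w hvw => by
        rw [exH2 v w x, hb, ← hD v]
        exact pair_bound hvw hx0 hx1.le hδ hδ2)
    simpa using this
  have e3 : (n * b) ^ 2 * fH F n x ≤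
      ex (qJ (allFEdges F n) x) (fun H => ((IsoH H).card : ℝ) ^ 2 +
        ((-2 * (n * b)) * ((IsoH H).card : ℝ) + (n * b) ^ 2)) := by
    unfold fH
    rw [← ex_mul_left]
    refine ex_mono hq (fun H => ?_)
    by_cases hE : IsoH H = ∅
    · rw [ind_pos hE, hE]; simp
    · rw [ind_neg hE]
      nlinarith [sq_nonneg (((IsoH H).card : ℝ) - n * b)]
  rw [ex_add, ex_add, ex_mul_left, ex_const, eX_card hD] at e3
  have hm : 0 < n * b := by positivity
  have e4 : (n * b) ^ 2 * fH F n x ≤ (n * b) ^ 2 * (1 / (n * b) + 2 * δ) := by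
    have : (n * b) ^ 2 * (1 / (n * b) + 2 * δ) = n * b + 2 * δ * (n * b) ^ 2 := by
      field_simp
    rw [this]
    calc _ ≤ _ := e3
      _ ≤ (n * b + n ^ 2 * (b * b * (1 + 2 * δ))) + (-2 * (n * b) * (n * b) + (n * b) ^ 2) := by
          rw [← hb]; linarith
      _ = _ := by ring
  exact le_of_mul_le_mul_left e4 (by positivity)

end Tel

/-! ## Part 10: beta inequality, orderings and lifting of couplings -/

section Beta

lemma beta_int (a b : ℕ) : ∫ x in (0:ℝ)..1, x ^ a * (1 - x) ^ b =
    (a.factorial : ℝ) * b.factorial / (a + b + 1).factorial := by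
  induction b generalizing a with
  | zero =>
    simp only [pow_zero, mul_one, integral_pow, Nat.factorial_zero, Nat.cast_one, add_zero]
    rw [Nat.factorial_succ]
    have : (a.factorial : ℝ) ≠ 0 := by exact_mod_cast Nat.factorial_ne_zero a
    push_cast
    field_simp
    simp
  | succ b ih =>
    have hd : ∀ x ∈ Set.uIcc (0:ℝ) 1, HasDerivAt (fun x : ℝ => x ^ (a + 1) * (1 - x) ^ (b + 1))
        ((a + 1) * (x ^ a * (1 - x) ^ (b + 1)) - (b + 1) * (x ^ (a + 1) * (1 - x) ^ b)) x := by
      intro x _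
      have h1 : HasDerivAt (fun x : ℝ => x ^ (a + 1)) ((a + 1) * x ^ a) x := by
        simpa using hasDerivAt_pow (a + 1) x
      have h2 : HasDerivAt (fun x : ℝ => (1 - x) ^ (b + 1)) (-((b + 1) * (1 - x) ^ b)) x := by
        have h3 : HasDerivAt (fun x : ℝ => 1 - x) (-1) x := by
          simpa using (hasDerivAt_id x).const_sub 1
        have h4 := h3.pow (b + 1)
        simp only [Nat.add_sub_cancel] at h4
        exact h4.congr_deriv (by push_cast; ring)
      exact (h1.mul h2).congr_deriv (by ring)
    have hintg := intervalIntegral.integral_eq_sub_of_hasDerivAt hd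
      (Continuous.intervalIntegrable (by fun_prop) _ _)
    rw [intervalIntegral.integral_sub (Continuous.intervalIntegrable (by fun_prop) _ _)
      (Continuous.intervalIntegrable (by fun_prop) _ _),
      intervalIntegral.integral_const_mul, intervalIntegral.integral_const_mul, ih (a + 1)] at hintg
    simp only [sub_self, ne_eq, Nat.succ_ne_zero, not_false_eq_true, zero_pow, mul_zero,
      zero_mul] at hintg
    have e1 : a + 1 + b + 1 = a + (b + 1) + 1 := by ring
    rw [e1] at hintg
    have ha : (a + 1 : ℝ) ≠ 0 := by positivity
    have : ∫ x in (0:ℝ)..1, x ^ a * (1 - x) ^ (b + 1) =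
      (b + 1) * (((a + 1).factorial : ℝ) * b.factorial / (a + (b + 1) + 1).factorial) / (a + 1) := by
      rw [eq_div_iff ha]; linarith
    rw [this, Nat.factorial_succ a, Nat.factorial_succ b]
    push_cast
    field_simp

lemma beta_grid (x : ℕ → ℝ) (L a b : ℕ) (hx : Monotone x) (h0 : 0 ≤ x 0) (h1 : x L ≤ 1) :
    ∑ k ∈ Finset.range L, (x (k + 1) - x k) * (x k ^ a * (1 - x (k + 1)) ^ b) ≤
      (a.factorial : ℝ) * b.factorial / (a + b + 1).factorial := by
  have hc : Continuous (fun y : ℝ => y ^ a * (1 - y) ^ b) := by fun_prop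
  have hk : ∀ k ∈ Finset.range L, (x (k + 1) - x k) * (x k ^ a * (1 - x (k + 1)) ^ b) ≤
      ∫ y in (x k)..(x (k + 1)), y ^ a * (1 - y) ^ b := by
    intro k hk
    have hkL : k + 1 ≤ L := Finset.mem_range.1 hk
    have hle : x k ≤ x (k + 1) := hx (Nat.le_succ k)
    have hxk : 0 ≤ x k := h0.trans (hx (Nat.zero_le k))
    have hxk1 : x (k + 1) ≤ 1 := (hx hkL).trans h1
    have : ∫ y in (x k)..(x (k + 1)), (x k ^ a * (1 - x (k + 1)) ^ b) ≤
        ∫ y in (x k)..(x (k + 1)), y ^ a * (1 - y) ^ b := by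
      refine intervalIntegral.integral_mono_on hle (Continuous.intervalIntegrable (by fun_prop) _ _)
        (hc.intervalIntegrable _ _) (fun y hy => ?_)
      have hy1 := hy.1
      have hy2 := hy.2
      exact mul_le_mul (pow_le_pow_left₀ hxk hy1 a) (pow_le_pow_left₀ (by linarith) (by linarith) b)
        (pow_nonneg (by linarith) _) (pow_nonneg (by linarith) _)
    rwa [intervalIntegral.integral_const, smul_eq_mul] at this
  refine (Finset.sum_le_sum hk).trans ?_
  rw [intervalIntegral.sum_integral_adjacent_intervals (fun k _ => hc.intervalIntegrable _ _),
    ← beta_int]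
  have hxL : x 0 ≤ x L := hx (Nat.zero_le L)
  refine intervalIntegral.integral_mono_interval h0 hxL h1 ?_ (hc.intervalIntegrable _ _)
  refine (ae_restrict_iff' measurableSet_Ioc).2 (Eventually.of_forall (fun y hy => ?_))
  exact mul_nonneg (pow_nonneg hy.1.le _) (pow_nonneg (by linarith [hy.2]) _)

end Beta

section Ord
variable {α : Type*} [Fintype α] [DecidableEq α] {N : ℕ}

/-- Valid orderings of `J`. -/
def VO (J : Finset α) (f : Fin N → α) : Prop := Function.Injective f ∧ ∀ x ∈ J, ∃ i, f i = x

/-- The ordering passes through the transition `(S, e)`. -/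
def EV (J S : Finset α) (e : α) (f : Fin N → α) : Prop :=
  VO J f ∧ proc f S.card = S ∧ ∀ i : Fin N, (i : ℕ) = S.card → f i = e

lemma VO_image {J : Finset α} (hN : J.card = N) {f : Fin N → α} (hf : VO J f) :
    Finset.univ.image f = J := by
  symm
  apply Finset.eq_of_subset_of_card_le
  · intro x hx
    obtain ⟨i, hi⟩ := hf.2 x hx
    exact Finset.mem_image.2 ⟨i, Finset.mem_univ _, hi⟩
  · rw [Finset.card_image_of_injective _ hf.1, hN]; simp

lemma VO_card_le {J : Finset α} (hN : J.card = N) :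
    ((Finset.univ : Finset (Fin N → α)).filter (fun f => VO J f)).card ≤ N.factorial := by
  have h1 : Fintype.card (Fin N ↪ J) = N.factorial := by
    rw [Fintype.card_embedding_eq]; simp [hN, Nat.descFactorial_self]
  rw [← h1, ← Fintype.card_coe]
  refine Fintype.card_le_of_injective (fun f => (⟨fun i => ⟨f.1 i, ?_⟩, ?_⟩ : Fin N ↪ J)) ?_
  · have hf := (Finset.mem_filter.1 f.2).2
    have hm : f.1 i ∈ Finset.univ.image f.1 := Finset.mem_image_of_mem _ (Finset.mem_univ _)
    exact (Finset.ext_iff.1 (VO_image hN hf) _).1 hm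
  · intro i j hij
    have hf := (Finset.mem_filter.1 f.2).2
    exact hf.1 (by simpa using hij)
  · intro f g hfg
    apply Subtype.ext
    funext i
    exact congrArg (fun (φ : Fin N ↪ J) => ((φ i : J) : α)) hfg

lemma EV_exists {J S : Finset α} {e : α} (hN : J.card = N) (hS : S ⊆ J) (he : e ∈ J)
    (heS : e ∉ S) : ∃ f : Fin N → α, EV J S e f := by
  set R := J \ insert e S with hR
  set l := S.toList ++ e :: R.toList with hl
  have hins : insert e S ⊆ J := Finset.insert_subset he hS
  have hlen : l.length = N := by
    rw [hl, List.length_append, List.length_cons, Finset.length_toList, Finset.length_toList, hR,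
      Finset.card_sdiff_of_subset hins, ← hN]
    have := Finset.card_le_card hins
    rw [Finset.card_insert_of_notMem heS] at this ⊢
    omega
  have hnd : l.Nodup := by
    rw [hl, List.nodup_append, List.nodup_cons]
    refine ⟨Finset.nodup_toList _, ⟨?_, Finset.nodup_toList _⟩, ?_⟩
    · simp [hR]
    · intro a ha b hb
      rw [Finset.mem_toList] at ha
      rcases List.mem_cons.1 hb with rfl | hb
      · rintro rfl; exact heS ha
      · rw [Finset.mem_toList, hR] at hb
        rintro rfl
        exact (Finset.mem_sdiff.1 hb).2 (Finset.mem_insert_of_mem ha)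
  have hmem : ∀ x ∈ J, x ∈ l := by
    intro x hx
    rw [hl, List.mem_append, List.mem_cons, Finset.mem_toList, Finset.mem_toList, hR,
      Finset.mem_sdiff, Finset.mem_insert]
    tauto
  refine ⟨fun i => l.get (Fin.cast hlen.symm i), ⟨?_, ?_⟩, ?_, ?_⟩
  · intro i j hij
    have := hnd.injective_get hij
    simpa using this
  · intro x hx
    obtain ⟨i, hi⟩ := List.get_of_mem (hmem x hx)
    exact ⟨Fin.cast hlen i, by simpa using hi⟩
  · unfold proc
    ext x
    simp only [Finset.mem_image, Finset.mem_filter, Finset.mem_univ, true_and]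
    constructor
    · rintro ⟨i, hi, rfl⟩
      have : l.get (Fin.cast hlen.symm i) = S.toList.get ⟨(i : ℕ), by simpa using hi⟩ := by
        simp only [List.get_eq_getElem, Fin.val_cast, hl]
        exact List.getElem_append_left _
      rw [this, ← Finset.mem_toList]
      exact List.getElem_mem _
    · intro hx
      rw [← Finset.mem_toList] at hx
      obtain ⟨i, hi, hix⟩ := List.mem_iff_getElem.1 hx
      have hiN : i < N := by
        rw [Finset.length_toList] at hi
        exact lt_of_lt_of_le hi ((Finset.card_le_card hS).trans hN.le)
      refine ⟨⟨i, hiN⟩, by simpa using hi, ?_⟩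
      simp only [List.get_eq_getElem, Fin.val_cast, hl]
      rw [List.getElem_append_left hi, hix]
  · intro i hi
    simp only [List.get_eq_getElem, Fin.val_cast, hl]
    rw [List.getElem_append_right (by simp [hi])]
    simp [hi]

lemma EV_card {J S : Finset α} {e : α} (hN : J.card = N) (hS : S ⊆ J) (he : e ∈ J)
    (heS : e ∉ S) : S.card.factorial * (N - S.card - 1).factorial ≤
      ((Finset.univ : Finset (Fin N → α)).filter (fun f => EV J S e f)).card := by
  obtain ⟨f, hf⟩ := EV_exists hN hS he heS
  set a := S.card with ha
  have haN : a < N := by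
    rw [← hN]
    have := Finset.card_le_card (Finset.insert_subset he hS)
    rw [Finset.card_insert_of_notMem heS] at this
    omega
  let P : Fin N → Prop := fun i => (i : ℕ) < a
  let Q : Fin N → Prop := fun i => a < (i : ℕ)
  have hP : Fintype.card {i // P i} = a := by
    rw [Fintype.card_subtype]
    have : (Finset.univ.filter (fun i : Fin N => (i : ℕ) < a)) = Finset.Iio ⟨a, haN⟩ := by
      ext i; simp [Fin.lt_def]
    simp only [P, this, Fin.card_Iio]
  have hQ : Fintype.card {i // Q i} = N - a - 1 := by
    rw [Fintype.card_subtype]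
    have : (Finset.univ.filter (fun i : Fin N => a < (i : ℕ))) = Finset.Ioi ⟨a, haN⟩ := by
      ext i; simp [Fin.lt_def]
    simp only [Q, this, Fin.card_Ioi]; omega
  let Φ : Equiv.Perm {i // P i} × Equiv.Perm {i // Q i} → (Fin N → α) := fun σ i =>
    f (Equiv.Perm.ofSubtype σ.1 (Equiv.Perm.ofSubtype σ.2 i))
  have v1 : ∀ σ : Equiv.Perm {i // P i} × Equiv.Perm {i // Q i}, ∀ i (hi : P i),
      Equiv.Perm.ofSubtype σ.1 (Equiv.Perm.ofSubtype σ.2 i) = σ.1 ⟨i, hi⟩ := by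
    intro σ i hi
    rw [Equiv.Perm.ofSubtype_apply_of_not_mem σ.2 (a := i) (by simp only [P, Q] at hi ⊢; omega),
      Equiv.Perm.ofSubtype_apply_of_mem σ.1 hi]
  have v2 : ∀ σ : Equiv.Perm {i // P i} × Equiv.Perm {i // Q i}, ∀ i (hi : Q i),
      Equiv.Perm.ofSubtype σ.1 (Equiv.Perm.ofSubtype σ.2 i) = σ.2 ⟨i, hi⟩ := by
    intro σ i hi
    rw [Equiv.Perm.ofSubtype_apply_of_mem σ.2 hi, Equiv.Perm.ofSubtype_apply_of_not_mem]
    have := (σ.2 ⟨i, hi⟩).2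
    simp only [P, Q] at this ⊢; omega
  have v3 : ∀ σ : Equiv.Perm {i // P i} × Equiv.Perm {i // Q i}, ∀ i : Fin N, (i : ℕ) = a →
      Equiv.Perm.ofSubtype σ.1 (Equiv.Perm.ofSubtype σ.2 i) = i := by
    intro σ i hi
    rw [Equiv.Perm.ofSubtype_apply_of_not_mem σ.2 (a := i) (by simp only [Q]; omega),
      Equiv.Perm.ofSubtype_apply_of_not_mem σ.1 (a := i) (by simp only [P]; omega)]
  have hinj : Function.Injective Φ := by
    intro σ τ hστ
    have key : ∀ i, Equiv.Perm.ofSubtype σ.1 (Equiv.Perm.ofSubtype σ.2 i) =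
        Equiv.Perm.ofSubtype τ.1 (Equiv.Perm.ofSubtype τ.2 i) := fun i => hf.1.1 (congrFun hστ i)
    refine Prod.ext ?_ ?_
    · ext ⟨i, hi⟩
      have := key i
      rw [v1 σ i hi, v1 τ i hi] at this
      rw [this]
    · ext ⟨i, hi⟩
      have := key i
      rw [v2 σ i hi, v2 τ i hi] at this
      rw [this]
  have hmem : ∀ σ, Φ σ ∈ (Finset.univ : Finset (Fin N → α)).filter (fun f => EV J S e f) := by
    intro σ
    rw [Finset.mem_filter]
    refine ⟨Finset.mem_univ _, ⟨?_, ?_⟩, ?_, ?_⟩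
    · intro i j hij
      exact (Equiv.injective _) ((Equiv.injective _) (hf.1.1 hij))
    · intro x hx
      obtain ⟨i, hi⟩ := hf.1.2 x hx
      refine ⟨(Equiv.Perm.ofSubtype σ.2).symm ((Equiv.Perm.ofSubtype σ.1).symm i), ?_⟩
      simp [Φ, hi]
    · apply Finset.eq_of_subset_of_card_le
      · intro x hx
        obtain ⟨i, hi, rfl⟩ := Finset.mem_image.1 hx
        have hi' : P i := (Finset.mem_filter.1 hi).2
        simp only [Φ]
        rw [v1 σ i hi', ← hf.2.1]
        exact Finset.mem_image_of_mem _ (Finset.mem_filter.2 ⟨Finset.mem_univ _, (σ.1 ⟨i, hi'⟩).2⟩)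
      · unfold proc
        rw [Finset.card_image_of_injective]
        · rw [← Fintype.card_subtype, hP]
        · intro i j hij
          exact (Equiv.injective _) ((Equiv.injective _) (hf.1.1 hij))
    · intro i hi
      simp only [Φ]
      rw [v3 σ i hi]; exact hf.2.2 i hi
  have := Finset.card_le_card_of_injOn (s := Finset.univ) Φ (fun σ _ => hmem σ) hinj.injOn
  rwa [Finset.card_univ, Fintype.card_prod, Fintype.card_perm, Fintype.card_perm, hP, hQ] at this

lemma proc_mono {f : Fin N → α} {s t : ℕ} (h : s ≤ t) : proc f s ⊆ proc f t := by
  unfold proc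
  refine Finset.image_subset_image (fun i hi => ?_)
  simp only [Finset.mem_filter, Finset.mem_univ, true_and] at hi ⊢
  omega

lemma EV_succ {J S : Finset α} {e : α} {f : Fin N → α} (hSN : S.card < N) (hf : EV J S e f) :
    proc f (S.card + 1) = insert e S := by
  have h1 := hf.2.1
  unfold proc at h1 ⊢
  have : (Finset.univ.filter (fun i : Fin N => (i : ℕ) < S.card + 1)) =
      insert ⟨S.card, hSN⟩ (Finset.univ.filter (fun i : Fin N => (i : ℕ) < S.card)) := by
    ext i
    simp only [Finset.mem_filter, Finset.mem_univ, true_and, Finset.mem_insert, Fin.ext_iff]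
    omega
  rw [this, Finset.image_insert, h1, hf.2.2 ⟨S.card, hSN⟩ rfl]

/-- The hitting time at a transition. -/
lemma EV_time {J S : Finset α} {e : α} {f : Fin N → α} (hSN : S.card < N) (hf : EV J S e f)
    (Q : Finset α → Prop) (hQ : ∀ A B, A ⊆ B → Q A → Q B) (h1 : ¬ Q S) (h2 : Q (insert e S)) :
    sInf {t : ℕ | Q (proc f t)} = S.card + 1 := by
  apply le_antisymm
  · apply Nat.sInf_le
    show Q _
    rwa [EV_succ hSN hf]
  · have hne : {t : ℕ | Q (proc f t)}.Nonempty := ⟨S.card + 1, by show Q _; rwa [EV_succ hSN hf]⟩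
    have hmem := Nat.sInf_mem hne
    by_contra hlt
    have hle : sInf {t : ℕ | Q (proc f t)} ≤ S.card := by omega
    apply h1
    have := hQ _ _ (proc_mono (f := f) hle) hmem
    rwa [hf.2.1] at this

end Ord

/-! ## Part 11: lifting partial couplings -/

section Lift

lemma pmf_of_real {Ω : Type*} [Fintype Ω] (m : Ω → ℝ) (h0 : ∀ ω, 0 ≤ m ω) (h1 : ∑ ω, m ω = 1) :
    ∃ μ : PMF Ω, ∀ S : Set Ω, μ.toOuterMeasure S = ENNReal.ofReal (∑ ω, ind (ω ∈ S) * m ω) := by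
  have hs : ∑ ω, ENNReal.ofReal (m ω) = 1 := by
    rw [← ENNReal.ofReal_sum_of_nonneg (fun ω _ => h0 ω), h1, ENNReal.ofReal_one]
  refine ⟨PMF.ofFintype (fun ω => ENNReal.ofReal (m ω)) hs, fun S => ?_⟩
  rw [PMF.toOuterMeasure_apply_fintype, ENNReal.ofReal_sum_of_nonneg
    (fun ω _ => mul_nonneg (ind_nonneg _) (h0 ω))]
  refine Finset.sum_congr rfl (fun ω _ => ?_)
  by_cases h : ω ∈ S
  · rw [Set.indicator_of_mem h, ind_pos h, one_mul, PMF.ofFintype_apply]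
  · rw [Set.indicator_of_notMem h, ind_neg h, zero_mul, ENNReal.ofReal_zero]

lemma ext_coupling {Ω₁ Ω₂ : Type*} [Fintype Ω₁] [Fintype Ω₂] (m : Ω₁ → Ω₂ → ℝ)
    (α : Ω₁ → ℝ) (β : Ω₂ → ℝ) (hm : ∀ f g, 0 ≤ m f g) (hα : ∑ f, α f = 1) (hβ : ∑ g, β g = 1)
    (h1 : ∀ f, ∑ g, m f g ≤ α f) (h2 : ∀ g, ∑ f, m f g ≤ β g) :
    ∃ m' : Ω₁ → Ω₂ → ℝ, (∀ f g, m f g ≤ m' f g) ∧ (∀ f, ∑ g, m' f g = α f) ∧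
      (∀ g, ∑ f, m' f g = β g) := by
  set M := ∑ f, ∑ g, m f g with hM
  have s1 : ∑ f, (α f - ∑ g, m f g) = 1 - M := by rw [Finset.sum_sub_distrib, hα]
  have s2 : ∑ g, (β g - ∑ f, m f g) = 1 - M := by
    rw [Finset.sum_sub_distrib, hβ, hM, Finset.sum_comm]
  have n1 : ∀ f, 0 ≤ α f - ∑ g, m f g := fun f => by linarith [h1 f]
  have n2 : ∀ g, 0 ≤ β g - ∑ f, m f g := fun g => by linarith [h2 g]
  have hM1 : 0 ≤ 1 - M := by rw [← s1]; exact Finset.sum_nonneg (fun f _ => n1 f)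
  refine ⟨fun f g => m f g + (α f - ∑ g, m f g) * (β g - ∑ f, m f g) / (1 - M), ?_, ?_, ?_⟩
  · intro f g
    have := div_nonneg (mul_nonneg (n1 f) (n2 g)) hM1
    simp only; linarith
  · intro f
    rw [Finset.sum_add_distrib, ← Finset.sum_div, ← Finset.mul_sum, s2]
    by_cases hz : 1 - M = 0
    · rw [hz] at s1 ⊢
      have := (Finset.sum_eq_zero_iff_of_nonneg (fun f _ => n1 f)).1 s1 f (Finset.mem_univ _)
      simp; linarith
    · rw [mul_div_assoc, div_self hz]; ring
  · intro g
    rw [Finset.sum_add_distrib, ← Finset.sum_div, ← Finset.sum_mul, s1]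
    by_cases hz : 1 - M = 0
    · rw [hz] at s2 ⊢
      have := (Finset.sum_eq_zero_iff_of_nonneg (fun f _ => n2 f)).1 s2 g (Finset.mem_univ _)
      simp; linarith
    · rw [mul_comm, mul_div_assoc, mul_comm, mul_comm (_ / _), div_self hz]; ring

lemma uniform_marg {Ω Ω₁ : Type*} [Fintype Ω] [Fintype Ω₁] (m : Ω → ℝ) (X : Ω → Ω₁) (V : Finset Ω₁)
    (hV : V.Nonempty) (μ : PMF Ω)
    (hμ : ∀ S : Set Ω, μ.toOuterMeasure S = ENNReal.ofReal (∑ ω, ind (ω ∈ S) * m ω))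
    (h : ∀ f, ∑ ω, ind (X ω = f) * m ω = ind (f ∈ V) / V.card) :
    UniformOn μ X (fun f => f ∈ V) := by
  constructor
  · rw [hμ]
    have : ∑ ω, ind (ω ∈ {ω | X ω ∈ V}) * m ω = ∑ f ∈ V, ∑ ω, ind (X ω = f) * m ω := by
      rw [Finset.sum_comm]
      refine Finset.sum_congr rfl (fun ω _ => ?_)
      rw [← Finset.sum_mul]
      congr 1
      change ind (X ω ∈ V) = _
      by_cases hx : X ω ∈ V
      · rw [ind_pos hx, Finset.sum_eq_single_of_mem _ hx, ind_pos rfl]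
        intro b _ hb; exact ind_neg (fun h => hb h.symm)
      · rw [ind_neg hx, Finset.sum_eq_zero]
        intro b hb; exact ind_neg (fun h => hx (h ▸ hb))
    rw [this]
    have : ∑ f ∈ V, ∑ ω, ind (X ω = f) * m ω = 1 := by
      rw [Finset.sum_congr rfl (fun f hf => by rw [h f, ind_pos hf]), Finset.sum_const, nsmul_eq_mul]
      have : (V.card : ℝ) ≠ 0 := by exact_mod_cast (Finset.card_pos.2 hV).ne'
      field_simp
    rw [this, ENNReal.ofReal_one]
  · intro a b ha hb
    rw [hμ, hμ]
    simp only [Set.mem_ofPred_eq]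
    rw [h a, h b, ind_pos ha, ind_pos hb]

lemma lift_marg {Ω₁ Θ A : Type*} [Fintype Ω₁] [Fintype Θ] (V : Finset Ω₁)
    (m : Θ → ℝ) (hm : ∀ θ, 0 ≤ m θ) (a : Θ → A) (E : A → Finset Ω₁) (hE : ∀ x, E x ⊆ V)
    (h : ∀ x, ∑ θ, ind (a θ = x) * m θ ≤ (E x).card / V.card)
    (hd : ∀ θ θ' f, m θ ≠ 0 → m θ' ≠ 0 → f ∈ E (a θ) → f ∈ E (a θ') → a θ = a θ') (f : Ω₁) :
    ∑ θ, m θ * (ind (f ∈ E (a θ)) / (E (a θ)).card) ≤ ind (f ∈ V) / V.card := by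
  by_cases hz : ∃ θ, m θ ≠ 0 ∧ f ∈ E (a θ)
  · obtain ⟨θ₀, h0, h1⟩ := hz
    rw [ind_pos (hE _ h1)]
    have hc : (0:ℝ) < (E (a θ₀)).card := by exact_mod_cast Finset.card_pos.2 ⟨f, h1⟩
    calc ∑ θ, m θ * (ind (f ∈ E (a θ)) / (E (a θ)).card)
        ≤ ∑ θ, (ind (a θ = a θ₀) * m θ) * (1 / (E (a θ₀)).card) := by
          refine Finset.sum_le_sum (fun θ _ => ?_)
          by_cases hm0 : m θ = 0
          · simp [hm0]
          by_cases hf : f ∈ E (a θ)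
          · have := hd θ θ₀ f hm0 h0 hf h1
            rw [ind_pos hf, ind_pos this, this, one_mul]
          · rw [ind_neg hf]; simp
            exact mul_nonneg (mul_nonneg (ind_nonneg _) (hm θ)) (by positivity)
      _ = (∑ θ, ind (a θ = a θ₀) * m θ) * (1 / (E (a θ₀)).card) := by rw [Finset.sum_mul]
      _ ≤ ((E (a θ₀)).card / V.card) * (1 / (E (a θ₀)).card) := by
          exact mul_le_mul_of_nonneg_right (h _) (by positivity)
      _ = 1 / V.card := by field_simp
  · rw [Finset.sum_eq_zero]
    · exact div_nonneg (ind_nonneg _) (by positivity)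
    · intro θ _
      by_cases hm0 : m θ = 0
      · rw [hm0, zero_mul]
      · rw [ind_neg (fun hf => hz ⟨θ, hm0, hf⟩)]; simp

lemma lift_ne {Ω₁ Θ A : Type*} [Fintype Ω₁] [Fintype Θ] (V : Finset Ω₁)
    (m : Θ → ℝ) (hm : ∀ θ, 0 ≤ m θ) (a : Θ → A) (E : A → Finset Ω₁)
    (h : ∀ x, ∑ θ, ind (a θ = x) * m θ ≤ (E x).card / V.card) (θ : Θ) (h0 : m θ ≠ 0) :
    ∑ f, ind (f ∈ E (a θ)) / ((E (a θ)).card : ℝ) = 1 := by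
  have hc : ((E (a θ)).card : ℝ) ≠ 0 := by
    intro hc
    have h1 := h (a θ)
    rw [hc, zero_div] at h1
    have h2 := Finset.single_le_sum (f := fun θ' => ind (a θ' = a θ) * m θ')
      (fun θ' _ => mul_nonneg (ind_nonneg _) (hm θ')) (Finset.mem_univ θ)
    simp only [ind_pos trivial, one_mul] at h2
    exact h0 (le_antisymm (h2.trans h1) (hm θ))
  rw [← Finset.sum_div, sum_ind]
  simp only [Finset.filter_mem_eq_inter, Finset.univ_inter]
  exact div_self hc

theorem lifting {Ω₁ Ω₂ Θ A B : Type*} [Fintype Ω₁] [Fintype Ω₂] [Fintype Θ]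
    (V₁ : Finset Ω₁) (V₂ : Finset Ω₂) (hV₁ : V₁.Nonempty) (hV₂ : V₂.Nonempty)
    (m : Θ → ℝ) (hm : ∀ θ, 0 ≤ m θ) (a : Θ → A) (b : Θ → B)
    (E₁ : A → Finset Ω₁) (E₂ : B → Finset Ω₂) (hE₁ : ∀ x, E₁ x ⊆ V₁) (hE₂ : ∀ x, E₂ x ⊆ V₂)
    (h₁ : ∀ x, ∑ θ, ind (a θ = x) * m θ ≤ (E₁ x).card / V₁.card)
    (h₂ : ∀ x, ∑ θ, ind (b θ = x) * m θ ≤ (E₂ x).card / V₂.card)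
    (hd₁ : ∀ θ θ' f, m θ ≠ 0 → m θ' ≠ 0 → f ∈ E₁ (a θ) → f ∈ E₁ (a θ') → a θ = a θ')
    (hd₂ : ∀ θ θ' f, m θ ≠ 0 → m θ' ≠ 0 → f ∈ E₂ (b θ) → f ∈ E₂ (b θ') → b θ = b θ') :
    ∃ μ : PMF (Ω₁ × Ω₂), UniformOn μ Prod.fst (fun f => f ∈ V₁) ∧
      UniformOn μ Prod.snd (fun f => f ∈ V₂) ∧
      ∀ S : Set (Ω₁ × Ω₂), (∀ θ f g, m θ ≠ 0 → f ∈ E₁ (a θ) → g ∈ E₂ (b θ) → (f, g) ∈ S) →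
        ENNReal.ofReal (∑ θ, m θ) ≤ μ.toOuterMeasure S := by
  let q₁ : Θ → Ω₁ → ℝ := fun θ f => ind (f ∈ E₁ (a θ)) / (E₁ (a θ)).card
  let q₂ : Θ → Ω₂ → ℝ := fun θ f => ind (f ∈ E₂ (b θ)) / (E₂ (b θ)).card
  have q1n : ∀ θ f, 0 ≤ q₁ θ f := fun θ f => div_nonneg (ind_nonneg _) (by positivity)
  have q2n : ∀ θ f, 0 ≤ q₂ θ f := fun θ f => div_nonneg (ind_nonneg _) (by positivity)
  have q1s : ∀ θ, m θ ≠ 0 → ∑ f, q₁ θ f = 1 := fun θ h => lift_ne V₁ m hm a E₁ h₁ θ h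
  have q2s : ∀ θ, m θ ≠ 0 → ∑ f, q₂ θ f = 1 := fun θ h => lift_ne V₂ m hm b E₂ h₂ θ h
  let m0 : Ω₁ → Ω₂ → ℝ := fun f g => ∑ θ, m θ * (q₁ θ f * q₂ θ g)
  have hm0 : ∀ f g, 0 ≤ m0 f g := fun f g =>
    Finset.sum_nonneg (fun θ _ => mul_nonneg (hm θ) (mul_nonneg (q1n θ f) (q2n θ g)))
  have e1 : ∀ f, ∑ g, m0 f g = ∑ θ, m θ * q₁ θ f := by
    intro f
    simp only [m0]
    rw [Finset.sum_comm]
    refine Finset.sum_congr rfl (fun θ _ => ?_)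
    by_cases h : m θ = 0
    · simp [h]
    · rw [← Finset.mul_sum, ← Finset.mul_sum, q2s θ h, mul_one]
  have e2 : ∀ g, ∑ f, m0 f g = ∑ θ, m θ * q₂ θ g := by
    intro f
    simp only [m0]
    rw [Finset.sum_comm]
    refine Finset.sum_congr rfl (fun θ _ => ?_)
    by_cases h : m θ = 0
    · simp [h]
    · rw [← Finset.mul_sum, ← Finset.sum_mul, q1s θ h, one_mul]
  have hs : ∀ {Ω : Type _} [Fintype Ω] (V : Finset Ω), V.Nonempty →
      ∑ f, ind (f ∈ V) / (V.card : ℝ) = 1 := by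
    intro Ω _ V hV
    rw [← Finset.sum_div, sum_ind]
    simp only [Finset.filter_mem_eq_inter, Finset.univ_inter]
    exact div_self (by exact_mod_cast (Finset.card_pos.2 hV).ne')
  have hs' : ∑ f, ind (f ∈ V₂) / (V₂.card : ℝ) = 1 := by
    rw [← Finset.sum_div, sum_ind]
    simp only [Finset.filter_mem_eq_inter, Finset.univ_inter]
    exact div_self (by exact_mod_cast (Finset.card_pos.2 hV₂).ne')
  obtain ⟨m', hle, hm1, hm2⟩ := ext_coupling m0 (fun f => ind (f ∈ V₁) / V₁.card)
    (fun f => ind (f ∈ V₂) / V₂.card) hm0 (hs V₁ hV₁) hs'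
    (fun f => by rw [e1]; exact lift_marg V₁ m hm a E₁ hE₁ h₁ hd₁ f)
    (fun f => by rw [e2]; exact lift_marg V₂ m hm b E₂ hE₂ h₂ hd₂ f)
  have hm'0 : ∀ f g, 0 ≤ m' f g := fun f g => (hm0 f g).trans (hle f g)
  obtain ⟨μ, hμ⟩ := pmf_of_real (fun ω : Ω₁ × Ω₂ => m' ω.1 ω.2) (fun ω => hm'0 _ _)
    (by rw [Fintype.sum_prod_type]; simp only [hm1]; exact hs V₁ hV₁)
  refine ⟨μ, uniform_marg (fun ω : Ω₁ × Ω₂ => m' ω.1 ω.2) Prod.fst V₁ hV₁ μ hμ ?_,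
    uniform_marg (fun ω : Ω₁ × Ω₂ => m' ω.1 ω.2) Prod.snd V₂ hV₂ μ hμ ?_, ?_⟩
  · intro f
    rw [Fintype.sum_prod_type, Finset.sum_eq_single f]
    · simp only [ind_pos trivial, one_mul]; exact hm1 f
    · intro b _ hb
      simp [ind_neg hb]
    · simp
  · intro f
    rw [Fintype.sum_prod_type_right, Finset.sum_eq_single f]
    · simp only [ind_pos trivial, one_mul]; exact hm2 f
    · intro b _ hb
      simp [ind_neg hb]
    · simp
  · intro S hS
    rw [hμ]
    apply ENNReal.ofReal_le_ofReal
    calc ∑ θ, m θ = ∑ f, ∑ g, m0 f g := by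
          simp only [e1]
          rw [Finset.sum_comm]
          refine Finset.sum_congr rfl (fun θ _ => ?_)
          by_cases h : m θ = 0
          · simp [h]
          · rw [← Finset.mul_sum, q1s θ h, mul_one]
      _ ≤ ∑ f, ∑ g, ind ((f, g) ∈ S) * m' f g := by
          refine Finset.sum_le_sum (fun f _ => Finset.sum_le_sum (fun g _ => ?_))
          by_cases h : (f, g) ∈ S
          · rw [ind_pos h, one_mul]; exact hle f g
          · rw [ind_neg h, zero_mul]
            refine le_of_eq (Finset.sum_eq_zero (fun θ _ => ?_))
            by_cases h0 : m θ = 0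
            · rw [h0, zero_mul]
            by_cases hf : f ∈ E₁ (a θ)
            · have hg : g ∉ E₂ (b θ) := fun hg => h (hS θ f g h0 hf hg)
              simp only [q₂, ind_neg hg]; simp
            · simp only [q₁, ind_neg hf]; simp
      _ = _ := by rw [Fintype.sum_prod_type]

end Lift

/-! ## Part 12: transitions and their marginals -/

section Trans
variable {u r : ℕ} {F : Finset (Finset (Fin r))} {n : ℕ}

lemma bw_qJ_eq {ι : Type*} [Fintype ι] [DecidableEq ι] {J A : Finset ι} (h : A ⊆ J) (x : ℝ) :
    bw (qJ J x) A = x ^ A.card * (1 - x) ^ (J.card - A.card) := by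
  have h1 : bw (qJ J x) A = ∏ e ∈ J, (if e ∈ A then x else 1 - x) := by
    unfold bw
    rw [← Finset.prod_subset (Finset.subset_univ J)]
    · refine Finset.prod_congr rfl (fun e he => ?_)
      simp [qJ, he]
    · intro e _ he
      have : e ∉ A := fun hA => he (h hA)
      simp [qJ, he, this]
  rw [h1, Finset.prod_ite, Finset.prod_const, Finset.prod_const]
  have h2 : J.filter (fun e => e ∈ A) = A := by
    ext e; simp only [Finset.mem_filter]; exact ⟨fun h => h.2, fun hA => ⟨h hA, hA⟩⟩
  have h3 : J.filter (fun e => e ∉ A) = J \ A := by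
    ext e; simp
  rw [h2, h3, Finset.card_sdiff_of_subset h]

/-- The state before the last edge is added. -/
def St (G : Finset (Finset (Fin n))) (h : FE n) (e : Finset (Fin n)) : Finset (Finset (Fin n)) :=
  G ∪ h.2.erase e

/-- Every vertex is in a copy. -/
def QG (F : Finset (Finset (Fin r))) (S : Finset (Finset (Fin n))) : Prop :=
  ∀ v : Fin n, ∃ h : FE n, IsFEdge F n h ∧ v ∈ h.1 ∧ h.2 ⊆ S

/-- No isolated vertices. -/
def QH (K : Finset (FE n)) : Prop := ∀ v : Fin n, ∃ h ∈ K, v ∈ h.1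

lemma St_insert {G : Finset (Finset (Fin n))} {h : FE n} {e : Finset (Fin n)} (he : e ∈ h.2) :
    insert e (St G h e) = G ∪ h.2 := by
  unfold St
  rw [← Finset.union_insert, Finset.insert_erase he]

lemma Tr_notMem {G : Finset (Finset (Fin n))} {K : Finset (FE n)} {h : FE n} {v : Fin n}
    {e : Finset (Fin n)} (hT : Tr F G K h v) (he : e ∈ h.2) : e ∉ St G h e := by
  unfold St
  rw [Finset.mem_union, not_or]
  exact ⟨Finset.disjoint_left.1 hT.2.2.2.1 he, Finset.notMem_erase _ _⟩

lemma Tr_card {G : Finset (Finset (Fin n))} {K : Finset (FE n)} {h : FE n} {v : Fin n}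
    {e : Finset (Fin n)} (hT : Tr F G K h v) (he : e ∈ h.2) :
    (St G h e).card + 1 = G.card + F.card := by
  rw [← Finset.card_insert_of_notMem (Tr_notMem hT he), St_insert he,
    Finset.card_union_of_disjoint hT.2.2.2.1.symm, fe_card2 (mem_Jv.1 hT.2.2.1).1]

lemma Tr_iso {G : Finset (Finset (Fin n))} {K : Finset (FE n)} {h : FE n} {v : Fin n}
    {e : Finset (Fin n)} (hT : Tr F G K h v) (he : e ∈ h.2) : IsoG F (St G h e) = {v} := by
  apply Finset.Subset.antisymm
  · rw [← hT.1]
    exact IsoG_anti Finset.subset_union_left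
  · rw [Finset.singleton_subset_iff, mem_IsoG]
    intro g hg hv hs
    have hsub : g.2 ⊆ G ∪ h.2 := by
      refine hs.trans (Finset.union_subset_union_right (Finset.erase_subset _ _))
    have := hT.2.2.2.2 g (mem_Jv.2 ⟨hg, hv⟩) hsub
    subst this
    exact Tr_notMem hT he (hs he)

lemma Tr_unique {G G' : Finset (Finset (Fin n))} {K K' : Finset (FE n)} {h h' : FE n} {v v' : Fin n}
    {e : Finset (Fin n)} (hT : Tr F G K h v) (hT' : Tr F G' K' h' v') (he : e ∈ h.2)
    (he' : e ∈ h'.2) (hS : St G h e = St G' h' e) : v = v' ∧ h = h' ∧ G = G' := by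
  have hv : v = v' := by
    have := Tr_iso hT he
    rw [hS, Tr_iso hT' he'] at this
    exact (Finset.singleton_injective this).symm
  subst hv
  have hh : h' = h := by
    refine hT.2.2.2.2 h' hT'.2.2.1 ?_
    rw [← St_insert he, hS, St_insert he']
    exact Finset.subset_union_right
  subst hh
  refine ⟨rfl, rfl, ?_⟩
  have h1 : G ∪ h'.2 = G' ∪ h'.2 := by rw [← St_insert he, hS, St_insert he']
  have e1 : ∀ A : Finset (Finset (Fin n)), Disjoint h'.2 A → A = (A ∪ h'.2) \ h'.2 := by
    intro A hA
    rw [Finset.union_sdiff_right, Finset.sdiff_eq_self_of_disjoint hA.symm]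
  rw [e1 G hT.2.2.2.1, e1 G' hT'.2.2.2.1, h1]

lemma QG_iff {S : Finset (Finset (Fin n))} : QG F S ↔ IsoG F S = ∅ := by
  unfold QG
  rw [Finset.eq_empty_iff_forall_notMem]
  refine forall_congr' (fun v => ?_)
  rw [mem_IsoG]
  push Not
  simp only [mem_all]

lemma QH_iff {K : Finset (FE n)} : QH K ↔ IsoH K = ∅ := by
  unfold QH
  rw [Finset.eq_empty_iff_forall_notMem]
  refine forall_congr' (fun v => ?_)
  rw [mem_IsoH]
  push Not
  rfl

lemma Tr_QG1 {G : Finset (Finset (Fin n))} {K : Finset (FE n)} {h : FE n} {v : Fin n}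
    {e : Finset (Fin n)} (hT : Tr F G K h v) (he : e ∈ h.2) : ¬ QG F (St G h e) := by
  rw [QG_iff, Tr_iso hT he]; simp

lemma Tr_QG2 {G : Finset (Finset (Fin n))} {K : Finset (FE n)} {h : FE n} {v : Fin n}
    {e : Finset (Fin n)} (hT : Tr F G K h v) (he : e ∈ h.2) : QG F (insert e (St G h e)) := by
  rw [St_insert he, QG_iff, Finset.eq_empty_iff_forall_notMem]
  intro w hw
  have h1 : w ∈ IsoG F G := IsoG_anti Finset.subset_union_left hw
  rw [hT.1, Finset.mem_singleton] at h1
  subst h1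
  rw [mem_IsoG] at hw
  have h2 := mem_Jv.1 hT.2.2.1
  exact hw h h2.1 h2.2 Finset.subset_union_right

lemma Tr_QH1 {G : Finset (Finset (Fin n))} {K : Finset (FE n)} {h : FE n} {v : Fin n}
    (hT : Tr F G K h v) : ¬ QH K := by
  rw [QH_iff, hT.2.1]; simp

lemma Tr_QH2 {G : Finset (Finset (Fin n))} {K : Finset (FE n)} {h : FE n} {v : Fin n}
    (hT : Tr F G K h v) : QH (insert h K) := by
  rw [QH_iff, Finset.eq_empty_iff_forall_notMem]
  intro w hw
  have h1 : w ∈ IsoH K := IsoH_anti (Finset.subset_insert _ _) hw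
  rw [hT.2.1, Finset.mem_singleton] at h1
  subst h1
  rw [mem_IsoH] at hw
  exact hw h (Finset.mem_insert_self _ _) (mem_Jv.1 hT.2.2.1).2

lemma Tr_hK {G : Finset (Finset (Fin n))} {K : Finset (FE n)} {h : FE n} {v : Fin n}
    (hT : Tr F G K h v) : h ∉ K := by
  intro hK
  have : v ∈ IsoH K := by rw [hT.2.1]; simp
  exact mem_IsoH.1 this h hK (mem_Jv.1 hT.2.2.1).2

lemma gside {p : ℝ} (hp0 : 0 ≤ p) (hp1 : p ≤ 1) (hs : 1 ≤ F.card)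
    {γ : Finset (Finset (Fin n)) → Finset (FE n) → ℝ} (h0 : ∀ G K, 0 ≤ γ G K)
    (h1 : ∀ G, ∑ K, γ G K ≤ bw (qJ (allUEdges u n) p) G)
    (S : Finset (Finset (Fin n))) (e : Finset (Fin n)) :
    p ^ (F.card - 1) * ∑ G, ∑ K, ∑ h, ∑ v, γ G K * ind (Tr F G K h v ∧ e ∈ h.2 ∧ St G h e = S) ≤
      p ^ S.card * (1 - p) ^ ((allUEdges u n).card - S.card - 1) := by
  have hrhs : 0 ≤ p ^ S.card * (1 - p) ^ ((allUEdges u n).card - S.card - 1) :=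
    mul_nonneg (pow_nonneg hp0 _) (pow_nonneg (by linarith) _)
  by_cases hex : ∃ G K h v, γ G K ≠ 0 ∧ Tr F G K h v ∧ e ∈ h.2 ∧ St G h e = S
  · obtain ⟨G₀, K₀, h₀, v₀, hγ0, hT0, he0, hS0⟩ := hex
    have hb : ∑ G, ∑ K, ∑ h, ∑ v, γ G K * ind (Tr F G K h v ∧ e ∈ h.2 ∧ St G h e = S) ≤
        ∑ K, γ G₀ K := by
      have step : ∀ G K h v, γ G K * ind (Tr F G K h v ∧ e ∈ h.2 ∧ St G h e = S) ≤
          (if G = G₀ then (if h = h₀ then (if v = v₀ then γ G K else 0) else 0) else 0) := by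
        intro G K h v
        by_cases hc : Tr F G K h v ∧ e ∈ h.2 ∧ St G h e = S
        · obtain ⟨a, b, c⟩ := Tr_unique hc.1 hT0 hc.2.1 he0 (hc.2.2.trans hS0.symm)
          rw [ind_pos hc, if_pos c, if_pos b, if_pos a, mul_one]
        · rw [ind_neg hc, mul_zero]; split_ifs <;> first | exact h0 _ _ | exact le_rfl
      refine (Finset.sum_le_sum fun G _ => Finset.sum_le_sum fun K _ => Finset.sum_le_sum fun h _ =>
        Finset.sum_le_sum fun v _ => step G K h v).trans (le_of_eq ?_)
      rw [Finset.sum_eq_single G₀]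
      · refine Finset.sum_congr rfl (fun K _ => ?_)
        rw [Finset.sum_eq_single h₀]
        · rw [Finset.sum_eq_single v₀]
          · simp
          · intro b _ hb; simp [hb]
          · simp
        · intro b _ hb; simp [hb]
        · simp
      · intro b _ hb; simp [hb]
      · simp
    have hbw : 0 < bw (qJ (allUEdges u n) p) G₀ := by
      refine lt_of_lt_of_le (lt_of_lt_of_le (lt_of_le_of_ne (h0 G₀ K₀) hγ0.symm) ?_) (h1 G₀)
      exact Finset.single_le_sum (fun K _ => h0 G₀ K) (Finset.mem_univ K₀)
    have hsub : G₀ ⊆ allUEdges u n := by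
      by_contra hsub
      rw [bw_qJ_zero hsub] at hbw
      exact lt_irrefl _ hbw
    have hc := Tr_card hT0 he0
    rw [hS0] at hc
    calc _ ≤ p ^ (F.card - 1) * bw (qJ (allUEdges u n) p) G₀ :=
          mul_le_mul_of_nonneg_left (hb.trans (h1 G₀)) (pow_nonneg hp0 _)
      _ = p ^ S.card * (1 - p) ^ ((allUEdges u n).card - G₀.card) := by
          rw [bw_qJ_eq hsub, ← mul_assoc, ← pow_add]
          congr 2; omega
      _ ≤ _ := by
          refine mul_le_mul_of_nonneg_left ?_ (pow_nonneg hp0 _)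
          exact pow_le_pow_of_le_one (by linarith) (by linarith) (by omega)
  · rw [Finset.sum_eq_zero, mul_zero]
    · exact hrhs
    · intro G _
      refine Finset.sum_eq_zero fun K _ => Finset.sum_eq_zero fun h _ => Finset.sum_eq_zero fun v _ => ?_
      by_cases hg : γ G K = 0
      · rw [hg, zero_mul]
      · rw [ind_neg (fun hc => hex ⟨G, K, h, v, hg, hc⟩), mul_zero]

lemma hside {x : ℝ} (hx0 : 0 ≤ x) (hx1 : x ≤ 1)
    {γ : Finset (Finset (Fin n)) → Finset (FE n) → ℝ} (h0 : ∀ G K, 0 ≤ γ G K)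
    (h1 : ∀ K, ∑ G, γ G K ≤ bw (qJ (allFEdges F n) x) K)
    (K : Finset (FE n)) (h : FE n) :
    ∑ G, ∑ v, ∑ e, γ G K * ind (Tr F G K h v ∧ e ∈ h.2) ≤
      F.card * (x ^ K.card * (1 - x) ^ ((allFEdges F n).card - K.card - 1)) := by
  have hrhs : 0 ≤ x ^ K.card * (1 - x) ^ ((allFEdges F n).card - K.card - 1) :=
    mul_nonneg (pow_nonneg hx0 _) (pow_nonneg (by linarith) _)
  have hbw : bw (qJ (allFEdges F n) x) K ≤
      x ^ K.card * (1 - x) ^ ((allFEdges F n).card - K.card - 1) := by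
    by_cases hK : K ⊆ allFEdges F n
    · rw [bw_qJ_eq hK]
      refine mul_le_mul_of_nonneg_left ?_ (pow_nonneg hx0 _)
      exact pow_le_pow_of_le_one (by linarith) (by linarith) (by omega)
    · rw [bw_qJ_zero hK]; exact hrhs
  calc ∑ G, ∑ v, ∑ e, γ G K * ind (Tr F G K h v ∧ e ∈ h.2) ≤ ∑ G, γ G K * F.card := by
        refine Finset.sum_le_sum fun G _ => ?_
        by_cases hex : ∃ v, Tr F G K h v
        · obtain ⟨v₀, hv₀⟩ := hex
          rw [Finset.sum_eq_single v₀]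
          · rw [← Finset.mul_sum]
            refine mul_le_mul_of_nonneg_left ?_ (h0 _ _)
            rw [← fe_card2 (mem_Jv.1 hv₀.2.2.1).1]
            calc ∑ e, ind (Tr F G K h v₀ ∧ e ∈ h.2) ≤ ∑ e, ind (e ∈ h.2) :=
                  Finset.sum_le_sum (fun e _ => ind_mono (fun h => h.2))
              _ ≤ _ := by rw [sum_ind]; simp
          · intro b _ hb
            refine Finset.sum_eq_zero fun e _ => ?_
            rw [ind_neg, mul_zero]
            rintro ⟨hT, _⟩
            exact hb (Finset.singleton_injective (hT.1.symm.trans hv₀.1))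
          · simp
        · rw [Finset.sum_eq_zero]
          · exact mul_nonneg (h0 _ _) (by positivity)
          · intro v _
            refine Finset.sum_eq_zero fun e _ => ?_
            rw [ind_neg (fun hc => hex ⟨v, hc.1⟩), mul_zero]
    _ = F.card * ∑ G, γ G K := by rw [← Finset.sum_mul, mul_comm]
    _ ≤ _ := mul_le_mul_of_nonneg_left ((h1 K).trans hbw) (by positivity)

lemma pow_shift {y z ζ : ℝ} (b : ℕ) (h0 : 0 ≤ y) (h1 : y ≤ z) (h2 : z ≤ 1 / 2)
    (hζ : 2 * b * (z - y) ≤ ζ) : (1 - ζ) * (1 - y) ^ b ≤ (1 - z) ^ b := by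
  have hy : 0 < 1 - y := by linarith
  set w := (z - y) / (1 - y) with hw
  have e : 1 - z = (1 - w) * (1 - y) := by rw [hw]; field_simp; ring
  have hw2 : w ≤ 2 * (z - y) := by rw [hw, div_le_iff₀ hy]; nlinarith
  have hw0 : 0 ≤ w := div_nonneg (by linarith) hy.le
  have hw1 : w ≤ 1 := by rw [hw, div_le_one hy]; linarith
  rw [e, mul_pow]
  refine mul_le_mul_of_nonneg_right ?_ (pow_nonneg hy.le _)
  have := one_add_mul_le_pow (a := -w) (by linarith) b
  have h3 : (b : ℝ) * w ≤ b * (2 * (z - y)) := mul_le_mul_of_nonneg_left hw2 (by positivity)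
  have e2 : 1 + -w = 1 - w := by ring
  rw [e2] at this
  linarith

lemma grid_bound (x c : ℕ → ℝ) (L a b : ℕ) {ζ : ℝ} (hx : Monotone x) (h0 : 0 ≤ x 0)
    (h1 : x L ≤ 1 / 2) (hζ : ∀ k < L, 2 * b * (x (k + 1) - x k) ≤ ζ)
    (hc : ∀ k < L, c k ≤ (1 - ζ) * (x (k + 1) - x k)) :
    ∑ k ∈ Finset.range L, c k * (x k ^ a * (1 - x k) ^ b) ≤
      (a.factorial : ℝ) * b.factorial / (a + b + 1).factorial := by
  refine le_trans (Finset.sum_le_sum fun k hk => ?_) (beta_grid x L a b hx h0 (by linarith))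
  have hk := Finset.mem_range.1 hk
  have hxk : 0 ≤ x k := h0.trans (hx (Nat.zero_le k))
  have hxk1 : x (k + 1) ≤ 1 / 2 := (hx hk).trans h1
  have hle := hx (Nat.le_succ k)
  have hp := pow_shift b hxk hle hxk1 (hζ k hk)
  have h3 : 0 ≤ x k ^ a * (1 - x k) ^ b := mul_nonneg (pow_nonneg hxk _) (pow_nonneg (by
    have := hle; simp only [Nat.succ_eq_add_one] at this; linarith) _)
  have h4 : 0 ≤ (x (k + 1) - x k) * x k ^ a := mul_nonneg (by
    have := hle; simp only [Nat.succ_eq_add_one] at this; linarith) (pow_nonneg hxk _)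
  calc c k * (x k ^ a * (1 - x k) ^ b) ≤ ((1 - ζ) * (x (k + 1) - x k)) * (x k ^ a * (1 - x k) ^ b) :=
        mul_le_mul_of_nonneg_right (hc k hk) h3
    _ = ((x (k + 1) - x k) * x k ^ a) * ((1 - ζ) * (1 - x k) ^ b) := by ring
    _ ≤ ((x (k + 1) - x k) * x k ^ a) * (1 - x (k + 1)) ^ b := mul_le_mul_of_nonneg_left hp h4
    _ = _ := by ring

lemma VO_nonempty {α : Type*} [Fintype α] [DecidableEq α] {N : ℕ} {J : Finset α} (hN : J.card = N) :
    ((Finset.univ : Finset (Fin N → α)).filter (fun f => VO J f)).Nonempty := by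
  let φ := (J.equivFinOfCardEq hN)
  refine ⟨fun i => (φ.symm i : α), ?_⟩
  rw [Finset.mem_filter]
  refine ⟨Finset.mem_univ _, fun i j hij => φ.symm.injective (Subtype.ext hij), fun x hx => ?_⟩
  exact ⟨φ ⟨x, hx⟩, by simp⟩

/-- The event ratio bound. -/
lemma EV_ratio {α : Type*} [Fintype α] [DecidableEq α] {N : ℕ} {J S : Finset α} {e : α}
    (hN : J.card = N) (hS : S ⊆ J) (he : e ∈ J) (heS : e ∉ S) :
    (S.card.factorial : ℝ) * (N - S.card - 1).factorial / (S.card + (N - S.card - 1) + 1).factorial ≤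
      ((Finset.univ : Finset (Fin N → α)).filter (fun f => EV J S e f)).card /
      ((Finset.univ : Finset (Fin N → α)).filter (fun f => VO J f)).card := by
  have haN : S.card < N := by
    rw [← hN]
    have := Finset.card_le_card (Finset.insert_subset he hS)
    rw [Finset.card_insert_of_notMem heS] at this
    omega
  have e1 : S.card + (N - S.card - 1) + 1 = N := by omega
  rw [e1]
  have h1 := EV_card hN hS he heS
  have h2 := VO_card_le hN
  have h3 := Finset.card_pos.2 (VO_nonempty hN)
  refine div_le_div₀ (by positivity) (by exact_mod_cast h1) (by exact_mod_cast h3) (by exact_mod_cast h2)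

end Trans

/-! ## Part 13: the coupling for fixed `n`, from level couplings on a grid -/

section MasterA
variable {u r : ℕ} {F : Finset (Finset (Fin r))} {n : ℕ}

/-- The properties of a level coupling. -/
structure LC (u : ℕ) {r : ℕ} (F : Finset (Finset (Fin r))) (n : ℕ) (p x : ℝ)
    (γ : Finset (Finset (Fin n)) → Finset (FE n) → ℝ) : Prop where
  h0 : ∀ G K, 0 ≤ γ G K
  h1 : ∀ G, ∑ K, γ G K ≤ bw (qJ (allUEdges u n) p) G
  h2 : ∀ K, ∑ G, γ G K ≤ bw (qJ (allFEdges F n) x) K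
  h3 : ∀ G K, γ G K ≠ 0 → ∀ h ∈ K, h.2 ⊆ G

lemma LC.subU {p x : ℝ} {γ : Finset (Finset (Fin n)) → Finset (FE n) → ℝ} (h : LC u F n p x γ)
    {G : Finset (Finset (Fin n))} {K : Finset (FE n)} (hg : γ G K ≠ 0) : G ⊆ allUEdges u n := by
  by_contra hsub
  have h1 := h.h1 G
  rw [bw_qJ_zero hsub] at h1
  have h2 := Finset.single_le_sum (fun K _ => h.h0 G K) (Finset.mem_univ K)
  exact hg (le_antisymm (h2.trans h1) (h.h0 _ _))

lemma LC.subF {p x : ℝ} {γ : Finset (Finset (Fin n)) → Finset (FE n) → ℝ} (h : LC u F n p x γ)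
    {G : Finset (Finset (Fin n))} {K : Finset (FE n)} (hg : γ G K ≠ 0) : K ⊆ allFEdges F n := by
  by_contra hsub
  have h1 := h.h2 K
  rw [bw_qJ_zero hsub] at h1
  have h2 := Finset.single_le_sum (fun G _ => h.h0 G K) (Finset.mem_univ G)
  exact hg (le_antisymm (h2.trans h1) (h.h0 _ _))

lemma card_allU (u n : ℕ) : (allUEdges u n).card = n.choose u := by
  have : allUEdges u n = Finset.powersetCard u Finset.univ := by
    ext e; simp [allUEdges, Finset.mem_powersetCard]
  rw [this, Finset.card_powersetCard]; simp

lemma ValidU_iff (f : Fin (n.choose u) → Finset (Fin n)) :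
    ValidOrdU u n f ↔ VO (allUEdges u n) f := by
  unfold ValidOrdU VO allUEdges; simp

lemma ValidH_iff (f : Fin (Mnum F n) → FE n) :
    ValidOrdH F n f ↔ VO (allFEdges F n) f := by
  unfold ValidOrdH VO; simp only [mem_all]

lemma EV_inj {α : Type*} [Fintype α] [DecidableEq α] {N : ℕ} {J S S' : Finset α} {e e' : α}
    {f : Fin N → α} (hf : EV J S e f) (hf' : EV J S' e' f) (hS : S.card < N)
    (hc : S.card = S'.card) : S = S' ∧ e = e' := by
  constructor
  · rw [← hf.2.1, ← hf'.2.1, hc]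
  · rw [← hf.2.2 ⟨S.card, hS⟩ rfl, ← hf'.2.2 ⟨S.card, hS⟩ hc]

lemma QG_up (A B : Finset (Finset (Fin n))) (h : A ⊆ B) (hA : QG F A) : QG F B := by
  intro v
  obtain ⟨g, h1, h2, h3⟩ := hA v
  exact ⟨g, h1, h2, h3.trans h⟩

lemma QH_up (A B : Finset (FE n)) (h : A ⊆ B) (hA : QH A) : QH B := by
  intro v
  obtain ⟨g, h1, h2⟩ := hA v
  exact ⟨g, h h1, h2⟩

lemma card_lt_of {α : Type*} [DecidableEq α] {N : ℕ} {J S : Finset α} {e : α}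
    (hN : J.card = N) (hS : S ⊆ J) (he : e ∈ J) (heS : e ∉ S) : S.card < N := by
  rw [← hN]
  have := Finset.card_le_card (Finset.insert_subset he hS)
  rw [Finset.card_insert_of_notMem heS] at this
  omega

lemma pow_sub_ge {a b : ℝ} (ha : 0 ≤ a) (hab : a ≤ b) {s : ℕ} (hs : 1 ≤ s) :
    s * a ^ (s - 1) * (b - a) ≤ b ^ s - a ^ s := by
  obtain ⟨s, rfl⟩ := Nat.exists_eq_add_of_le' hs
  simp only [Nat.add_sub_cancel]
  induction s with
  | zero => simp
  | succ s ih =>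
    have e1 : b ^ (s + 1 + 1) - a ^ (s + 1 + 1) =
      a * (b ^ (s + 1) - a ^ (s + 1)) + b ^ (s + 1) * (b - a) := by ring
    have h4 := pow_le_pow_left₀ ha hab (s + 1)
    have h5 := mul_le_mul_of_nonneg_left (ih (by omega)) ha
    have h6 := mul_le_mul_of_nonneg_right h4 (sub_nonneg.2 hab)
    rw [e1]; push_cast at h5 ⊢
    have e3 : ((s : ℝ) + 1 + 1) * a ^ (s + 1) * (b - a) =
      a * ((s + 1) * a ^ s * (b - a)) + a ^ (s + 1) * (b - a) := by ring
    rw [e3]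
    linarith

lemma pow_sub_le {a b : ℝ} (ha : 0 ≤ a) (hab : a ≤ b) {s : ℕ} (hs : 1 ≤ s) :
    b ^ s - a ^ s ≤ s * b ^ (s - 1) * (b - a) := by
  obtain ⟨s, rfl⟩ := Nat.exists_eq_add_of_le' hs
  simp only [Nat.add_sub_cancel]
  induction s with
  | zero => simp
  | succ s ih =>
    have e1 : b ^ (s + 1 + 1) - a ^ (s + 1 + 1) =
      b * (b ^ (s + 1) - a ^ (s + 1)) + a ^ (s + 1) * (b - a) := by ring
    have h4 := pow_le_pow_left₀ ha hab (s + 1)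
    have h5 := mul_le_mul_of_nonneg_left (ih (by omega)) (ha.trans hab)
    have h6 := mul_le_mul_of_nonneg_right h4 (sub_nonneg.2 hab)
    rw [e1]; push_cast at h5 ⊢
    have e3 : ((s : ℝ) + 1 + 1) * b ^ (s + 1) * (b - a) =
      b * ((s + 1) * b ^ s * (b - a)) + b ^ (s + 1) * (b - a) := by ring
    rw [e3]
    linarith

lemma sum6 {A B C D E G : Type*} [Fintype A] [Fintype B] [Fintype C] [Fintype D] [Fintype E]
    [Fintype G] (f : A × B × C × D × E × G → ℝ) :
    ∑ θ, f θ = ∑ a, ∑ b, ∑ c, ∑ d, ∑ e, ∑ g, f (a, b, c, d, e, g) := by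
  rw [Fintype.sum_prod_type]
  refine Finset.sum_congr rfl (fun a _ => ?_)
  rw [Fintype.sum_prod_type]
  refine Finset.sum_congr rfl (fun b _ => ?_)
  rw [Fintype.sum_prod_type]
  refine Finset.sum_congr rfl (fun c _ => ?_)
  rw [Fintype.sum_prod_type]
  refine Finset.sum_congr rfl (fun d _ => ?_)
  rw [Fintype.sum_prod_type]

set_option maxHeartbeats 1000000 in
theorem masterA (hF : NF u F) (p : ℕ → ℝ) (L : ℕ) (hp : Monotone p) (hp0 : 0 ≤ p 0)
    (hpL : p L ≤ 1 / 2) {A ζ : ℝ} (hA0 : 0 ≤ A) (hA1 : A ≤ 1) (hζ1 : ζ ≤ 1)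
    (hζ : ∀ k < L, 2 * ((n.choose u : ℝ) + Mnum F n * F.card) * (p (k + 1) - p k) ≤ ζ)
    (γ : ℕ → Finset (Finset (Fin n)) → Finset (FE n) → ℝ)
    (hγ : ∀ k < L, LC u F n (p k) (A * p k ^ F.card) (γ k)) :
    ∃ μ : PMF ((Fin (Nat.choose n u) → Finset (Fin n)) × (Fin (Mnum F n) → FE n)),
      UniformOn μ Prod.fst (ValidOrdU u n) ∧ UniformOn μ Prod.snd (ValidOrdH F n) ∧
      ENNReal.ofReal (∑ k ∈ Finset.range L, ((1 - ζ) * A) * (p (k + 1) - p k) *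
          p k ^ (F.card - 1) * (F.card * ∑ G, ∑ K, γ k G K * ∑ v, ∑ h, ind (Tr F G K h v))) ≤
        μ.toOuterMeasure
          {ω | ∀ h ∈ proc ω.2 (THit F n ω.2), h.2 ⊆ proc ω.1 (TGHit u F n ω.1)} := by
  have hs := hF.pos
  have hpk : ∀ k, 0 ≤ p k := fun k => hp0.trans (hp (Nat.zero_le k))
  have hΔ : ∀ k, 0 ≤ p (k + 1) - p k := fun k => by linarith [hp (Nat.le_succ k)]
  set w : ℕ → ℝ := fun k => ((1 - ζ) * A) * (p (k + 1) - p k) * p k ^ (F.card - 1) with hw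
  have hw0 : ∀ k, 0 ≤ w k := fun k =>
    mul_nonneg (mul_nonneg (mul_nonneg (by linarith) hA0) (hΔ k)) (pow_nonneg (hpk k) _)
  let Θ := Fin L × Finset (Finset (Fin n)) × Finset (FE n) × FE n × Fin n × Finset (Fin n)
  let m : Θ → ℝ := fun ⟨k, G, K, h, v, e⟩ => w k * (γ k G K * ind (Tr F G K h v ∧ e ∈ h.2))
  let a : Θ → Finset (Finset (Fin n)) × Finset (Fin n) := fun ⟨_, G, _, h, _, e⟩ => (St G h e, e)
  let b : Θ → Finset (FE n) × FE n := fun ⟨_, _, K, h, _, _⟩ => (K, h)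
  have hsum : ∀ f : Θ → ℝ, ∑ θ, f θ = ∑ k, ∑ G, ∑ K, ∑ h, ∑ v, ∑ e, f (k, G, K, h, v, e) :=
    fun f => sum6 f
  have hm : ∀ θ, 0 ≤ m θ := by
    rintro ⟨k, G, K, h, v, e⟩
    exact mul_nonneg (hw0 _) (mul_nonneg ((hγ k k.2).h0 _ _) (ind_nonneg _))
  have hT : ∀ k G K h v e, m (k, G, K, h, v, e) ≠ 0 → γ k G K ≠ 0 ∧ Tr F G K h v ∧ e ∈ h.2 := by
    intro k G K h v e hne
    have h1 := right_ne_zero_of_mul hne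
    refine ⟨left_ne_zero_of_mul h1, ?_⟩
    by_contra hc
    exact right_ne_zero_of_mul h1 (ind_neg hc)
  have hcU := card_allU u n
  have hcF : (allFEdges F n).card = Mnum F n := rfl
  have vU : ∀ k G K h v e, m (k, G, K, h, v, e) ≠ 0 →
      St G h e ⊆ allUEdges u n ∧ e ∈ allUEdges u n ∧ e ∉ St G h e := by
    intro k G K h v e hne
    obtain ⟨h1, h2, h3⟩ := hT k G K h v e hne
    have hh := fe_sub_all hF (mem_Jv.1 h2.2.2.1).1
    exact ⟨Finset.union_subset ((hγ k k.2).subU h1) ((Finset.erase_subset _ _).trans hh),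
      hh h3, Tr_notMem h2 h3⟩
  have vF : ∀ k G K h v e, m (k, G, K, h, v, e) ≠ 0 →
      K ⊆ allFEdges F n ∧ h ∈ allFEdges F n ∧ h ∉ K := by
    intro k G K h v e hne
    obtain ⟨h1, h2, h3⟩ := hT k G K h v e hne
    exact ⟨(hγ k k.2).subF h1, (mem_Jv.1 h2.2.2.1).1, Tr_hK h2⟩
  have tU : ∀ k G K h v e, m (k, G, K, h, v, e) ≠ 0 →
      ∀ f : Fin (n.choose u) → Finset (Fin n), EV (allUEdges u n) (St G h e) e f →
        TGHit u F n f = (St G h e).card + 1 := by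
    intro k G K h v e hne f hf
    obtain ⟨h1, h2, h3⟩ := hT k G K h v e hne
    obtain ⟨v1, v2, v3⟩ := vU k G K h v e hne
    exact EV_time (card_lt_of hcU v1 v2 v3) hf (QG F) QG_up (Tr_QG1 h2 h3) (Tr_QG2 h2 h3)
  have tF : ∀ k G K h v e, m (k, G, K, h, v, e) ≠ 0 →
      ∀ f : Fin (Mnum F n) → FE n, EV (allFEdges F n) K h f →
        THit F n f = K.card + 1 := by
    intro k G K h v e hne f hf
    obtain ⟨h1, h2, h3⟩ := hT k G K h v e hne
    obtain ⟨v1, v2, v3⟩ := vF k G K h v e hne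
    exact EV_time (card_lt_of hcF v1 v2 v3) hf QH QH_up (Tr_QH1 h2) (Tr_QH2 h2)
  refine Exists.elim (lifting
    ((Finset.univ : Finset (Fin (n.choose u) → Finset (Fin n))).filter
      (fun f => VO (allUEdges u n) f))
    ((Finset.univ : Finset (Fin (Mnum F n) → FE n)).filter (fun f => VO (allFEdges F n) f))
    (VO_nonempty hcU) (VO_nonempty hcF) m hm a b
    (fun x => Finset.univ.filter (fun f => EV (allUEdges u n) x.1 x.2 f))
    (fun x => Finset.univ.filter (fun f => EV (allFEdges F n) x.1 x.2 f))
    (fun x f hf => by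
      rw [Finset.mem_filter] at hf ⊢; exact ⟨hf.1, hf.2.1⟩)
    (fun x f hf => by
      rw [Finset.mem_filter] at hf ⊢; exact ⟨hf.1, hf.2.1⟩)
    ?_ ?_ ?_ ?_) ?_
  rotate_right 1
  · rintro μ ⟨hμ1, hμ2, hμ3⟩
    refine ⟨μ, ?_, ?_, ?_⟩
    · have e1 : ValidOrdU u n = fun f => f ∈ ((Finset.univ :
          Finset (Fin (n.choose u) → Finset (Fin n))).filter (fun f => VO (allUEdges u n) f)) := by
        funext f; rw [Finset.mem_filter, ValidU_iff]; simp
      rw [e1]; exact hμ1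
    · have e1 : ValidOrdH F n = fun f => f ∈ ((Finset.univ :
          Finset (Fin (Mnum F n) → FE n)).filter (fun f => VO (allFEdges F n) f)) := by
        funext f; rw [Finset.mem_filter, ValidH_iff]; simp
      rw [e1]; exact hμ2
    · refine le_trans (le_of_eq ?_) (hμ3 _ ?_)
      · congr 1
        rw [hsum]
        refine Eq.trans ?_ (Fin.sum_univ_eq_sum_range (fun k => ∑ G, ∑ K, ∑ h : FE n, ∑ v, ∑ e,
          w k * (γ k G K * ind (Tr F G K h v ∧ e ∈ h.2))) L).symm
        refine Finset.sum_congr rfl (fun k _ => ?_)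
        change w k * _ = _
        rw [Finset.mul_sum, Finset.mul_sum]
        refine Finset.sum_congr rfl (fun G _ => ?_)
        rw [Finset.mul_sum, Finset.mul_sum]
        refine Finset.sum_congr rfl (fun K _ => ?_)
        rw [Finset.sum_comm, Finset.mul_sum, Finset.mul_sum, Finset.mul_sum]
        refine Finset.sum_congr rfl (fun h _ => ?_)
        rw [Finset.mul_sum, Finset.mul_sum, Finset.mul_sum]
        refine Finset.sum_congr rfl (fun v _ => ?_)
        rw [← Finset.mul_sum, ← Finset.mul_sum]
        by_cases hTr : Tr F G K h v
        · have : ∑ e, ind (Tr F G K h v ∧ e ∈ h.2) = F.card := by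
            rw [Finset.sum_congr rfl (fun e _ => ind_congr (Q := e ∈ h.2) ⟨fun h => h.2, fun h => ⟨hTr, h⟩⟩),
              sum_ind, ← fe_card2 (mem_Jv.1 hTr.2.2.1).1]
            simp
          rw [this, ind_pos hTr]; ring
        · rw [Finset.sum_eq_zero (fun e _ => ind_neg (fun hc => hTr hc.1)), ind_neg hTr]; ring
      · rintro ⟨k, G, K, h, v, e⟩ f g hne hf hg
        replace hf := (Finset.mem_filter.1 hf).2
        replace hg := (Finset.mem_filter.1 hg).2
        obtain ⟨h1, h2, h3⟩ := hT k G K h v e hne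
        obtain ⟨v1, v2, v3⟩ := vU k G K h v e hne
        obtain ⟨v1', v2', v3'⟩ := vF k G K h v e hne
        change ∀ g' ∈ proc g (THit F n g), g'.2 ⊆ proc f (TGHit u F n f)
        rw [tU k G K h v e hne f hf, tF k G K h v e hne g hg,
          EV_succ (card_lt_of hcU v1 v2 v3) hf, EV_succ (card_lt_of hcF v1' v2' v3') hg]
        simp only [a, b]
        rw [St_insert h3]
        intro g' hg'
        rcases Finset.mem_insert.1 hg' with rfl | hg'
        · exact Finset.subset_union_right
        · exact ((hγ k k.2).h3 G K h1 g' hg').trans Finset.subset_union_left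
  · rintro ⟨S, e₀⟩
    by_cases hex : ∃ θ, a θ = (S, e₀) ∧ m θ ≠ 0
    · obtain ⟨⟨k, G, K, h, v, e⟩, ha, hne⟩ := hex
      have := vU k G K h v e hne
      have h1 : St G h e = S := congrArg Prod.fst ha
      have h2 : e = e₀ := congrArg Prod.snd ha
      rw [h1, h2] at this
      refine le_trans ?_ (EV_ratio hcU this.1 this.2.1 this.2.2)
      refine le_trans ?_ (grid_bound p (fun k => ((1 - ζ) * A) * (p (k + 1) - p k)) L S.card
        (n.choose u - S.card - 1) hp hp0 hpL (ζ := ζ) ?_ ?_)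
      · rw [hsum]
        refine le_trans (le_of_eq (Fin.sum_univ_eq_sum_range (fun k => ∑ G, ∑ K, ∑ h : FE n,
          ∑ v, ∑ e, ind ((St G h e, e) = (S, e₀)) *
          (w k * (γ k G K * ind (Tr F G K h v ∧ e ∈ h.2)))) L)) ?_
        refine Finset.sum_le_sum (fun k hk => ?_)
        have hk := Finset.mem_range.1 hk
        have hg := gside (hpk k) (by linarith [hp hk.le]) hs (hγ k hk).h0 (hγ k hk).h1 S e₀
        rw [hcU] at hg
        have hfac : 0 ≤ ((1 - ζ) * A) * (p (k + 1) - p k) :=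
          mul_nonneg (mul_nonneg (by linarith) hA0) (hΔ k)
        refine le_trans (le_of_eq ?_) (mul_le_mul_of_nonneg_left hg hfac)
        rw [← mul_assoc]
        change _ = w k * _
        rw [Finset.mul_sum]
        refine Finset.sum_congr rfl (fun G _ => ?_)
        rw [Finset.mul_sum]
        refine Finset.sum_congr rfl (fun K _ => ?_)
        rw [Finset.mul_sum]
        refine Finset.sum_congr rfl (fun h _ => ?_)
        rw [Finset.mul_sum]
        refine Finset.sum_congr rfl (fun v _ => ?_)
        rw [Finset.sum_eq_single e₀]
        · rw [← and_assoc, ind_and _ (St G h e₀ = S), ind_congr (Q := St G h e₀ = S) (by simp)]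
          ring
        · intro e _ he
          rw [ind_neg (fun h => he (congrArg Prod.snd h)), zero_mul]
        · simp
      · intro k hk
        refine le_trans (mul_le_mul_of_nonneg_right ?_ (hΔ k)) (hζ k hk)
        have : ((n.choose u - S.card - 1 : ℕ) : ℝ) ≤ n.choose u := by exact_mod_cast (by omega)
        have : (0:ℝ) ≤ Mnum F n * F.card := by positivity
        linarith
      · intro k hk
        refine mul_le_mul_of_nonneg_right ?_ (hΔ k)
        nlinarith
    · rw [Finset.sum_eq_zero]
      · positivity
      · intro θ _
        by_cases h : a θ = (S, e₀)
        · have : m θ = 0 := by by_contra hc; exact hex ⟨θ, h, hc⟩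
          rw [this, mul_zero]
        · rw [ind_neg h, zero_mul]
  · rintro ⟨K₀, h₀⟩
    by_cases hex : ∃ θ, b θ = (K₀, h₀) ∧ m θ ≠ 0
    · obtain ⟨⟨k, G, K, h, v, e⟩, ha, hne⟩ := hex
      have := vF k G K h v e hne
      have h1 : K = K₀ := congrArg Prod.fst ha
      have h2 : h = h₀ := congrArg Prod.snd ha
      rw [h1, h2] at this
      refine le_trans ?_ (EV_ratio hcF this.1 this.2.1 this.2.2)
      have hxm : Monotone (fun k => A * p k ^ F.card) := fun i j hij =>
        mul_le_mul_of_nonneg_left (pow_le_pow_left₀ (hpk i) (hp hij) _) hA0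
      refine le_trans ?_ (grid_bound (fun k => A * p k ^ F.card) (fun k => w k * F.card) L K₀.card
        (Mnum F n - K₀.card - 1) hxm (mul_nonneg hA0 (pow_nonneg hp0 _)) ?_ (ζ := ζ) ?_ ?_)
      · rw [hsum]
        refine le_trans (le_of_eq (Fin.sum_univ_eq_sum_range (fun k => ∑ G, ∑ K, ∑ h : FE n,
          ∑ v, ∑ e : Finset (Fin n), ind ((K, h) = (K₀, h₀)) *
          (w k * (γ k G K * ind (Tr F G K h v ∧ e ∈ h.2)))) L)) ?_
        refine Finset.sum_le_sum (fun k hk => ?_)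
        have hk := Finset.mem_range.1 hk
        have hx1 : A * p k ^ F.card ≤ 1 := by
          have : p k ≤ 1 := by linarith [hp hk.le]
          have := pow_le_one₀ (hpk k) this (n := F.card)
          have h0 := pow_nonneg (hpk k) F.card
          nlinarith
        have hg := hside (mul_nonneg hA0 (pow_nonneg (hpk k) _)) hx1 (hγ k hk).h0 (hγ k hk).h2 K₀ h₀
        rw [mul_assoc]
        refine le_trans (le_of_eq ?_) (mul_le_mul_of_nonneg_left hg (hw0 k))
        rw [Finset.mul_sum]
        refine Finset.sum_congr rfl (fun G _ => ?_)
        rw [Finset.sum_eq_single K₀]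
        · rw [Finset.sum_eq_single h₀, Finset.mul_sum]
          · refine Finset.sum_congr rfl (fun v _ => ?_)
            rw [Finset.mul_sum]
            refine Finset.sum_congr rfl (fun e _ => ?_)
            rw [ind_pos rfl, one_mul]
          · intro h _ hh
            refine Finset.sum_eq_zero fun v _ => Finset.sum_eq_zero fun e _ => ?_
            rw [ind_neg (fun hc => hh (congrArg Prod.snd hc)), zero_mul]
          · simp
        · intro K _ hK
          refine Finset.sum_eq_zero fun h _ =>
            Finset.sum_eq_zero fun v _ => Finset.sum_eq_zero fun e _ => ?_
          rw [ind_neg (fun hc => hK (congrArg Prod.fst hc)), zero_mul]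
        · simp
      · have h0 := pow_nonneg (hpk L) F.card
        have h1 : p L ^ F.card ≤ p L := pow_le_of_le_one (hpk L) (by linarith) (by omega)
        have : A * p L ^ F.card ≤ 1 * p L ^ F.card := mul_le_mul_of_nonneg_right hA1 h0
        linarith
      · intro k hk
        have hd : A * p (k + 1) ^ F.card - A * p k ^ F.card ≤ F.card * (p (k + 1) - p k) := by
          have h1 : p (k + 1) ≤ 1 := by linarith [hp (show k + 1 ≤ L from hk)]
          have h2 : p (k + 1) ^ F.card - p k ^ F.card ≤ F.card * (p (k + 1) - p k) := by
            have key : ∀ s : ℕ, p (k + 1) ^ s - p k ^ s ≤ s * (p (k + 1) - p k) := by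
              intro s
              induction s with
              | zero => simp
              | succ s ih =>
                have e1 : p (k + 1) ^ (s + 1) - p k ^ (s + 1) =
                  p (k + 1) * (p (k + 1) ^ s - p k ^ s) + p k ^ s * (p (k + 1) - p k) := by ring
                have h3 : p k ^ s ≤ 1 := pow_le_one₀ (hpk k) (by linarith [hΔ k])
                have h4 : 0 ≤ p (k + 1) ^ s - p k ^ s := by
                  linarith [pow_le_pow_left₀ (hpk k) (hp (Nat.le_succ k)) s]
                rw [e1]; push_cast
                nlinarith [hΔ k, hpk (k + 1)]
            exact key _
          have h3 : 0 ≤ p (k + 1) ^ F.card - p k ^ F.card := by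
            linarith [pow_le_pow_left₀ (hpk k) (hp (Nat.le_succ k)) F.card]
          nlinarith
        have hM : ((Mnum F n - K₀.card - 1 : ℕ) : ℝ) ≤ Mnum F n := by exact_mod_cast (by omega)
        have hC : (0:ℝ) ≤ n.choose u := by positivity
        have hr1 := hxm (Nat.le_succ k)
        simp only [Nat.succ_eq_add_one] at hr1
        calc _ ≤ 2 * (Mnum F n : ℝ) * (F.card * (p (k + 1) - p k)) := by
              refine mul_le_mul (by linarith) hd (by linarith) (by positivity)
          _ ≤ 2 * ((n.choose u : ℝ) + Mnum F n * F.card) * (p (k + 1) - p k) := by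
              have := mul_nonneg hC (hΔ k)
              nlinarith
          _ ≤ ζ := hζ k hk
      · intro k hk
        have hbern : F.card * p k ^ (F.card - 1) * (p (k + 1) - p k) ≤
            p (k + 1) ^ F.card - p k ^ F.card := by
          exact pow_sub_ge (hpk k) (hp (Nat.le_succ k)) hs
        have := mul_le_mul_of_nonneg_left hbern (mul_nonneg (sub_nonneg.2 hζ1) hA0)
        simp only [hw]
        calc _ = ((1 - ζ) * A) * (F.card * p k ^ (F.card - 1) * (p (k + 1) - p k)) := by ring
          _ ≤ _ := this
          _ = _ := by ring
    · rw [Finset.sum_eq_zero]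
      · positivity
      · intro θ _
        by_cases h : b θ = (K₀, h₀)
        · have : m θ = 0 := by by_contra hc; exact hex ⟨θ, h, hc⟩
          rw [this, mul_zero]
        · rw [ind_neg h, zero_mul]
  · rintro ⟨k, G, K, h, v, e⟩ ⟨k', G', K', h', v', e'⟩ f hne hne' hf hf'
    replace hf := (Finset.mem_filter.1 hf).2
    replace hf' := (Finset.mem_filter.1 hf').2
    obtain ⟨v1, v2, v3⟩ := vU k G K h v e hne
    have t1 := tU k G K h v e hne f hf
    have t2 := tU k' G' K' h' v' e' hne' f hf'
    have := EV_inj hf hf' (card_lt_of hcU v1 v2 v3) (by simp only [a]; omega)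
    exact Prod.ext this.1 this.2
  · rintro ⟨k, G, K, h, v, e⟩ ⟨k', G', K', h', v', e'⟩ f hne hne' hf hf'
    replace hf := (Finset.mem_filter.1 hf).2
    replace hf' := (Finset.mem_filter.1 hf').2
    obtain ⟨v1, v2, v3⟩ := vF k G K h v e hne
    have t1 := tF k G K h v e hne f hf
    have t2 := tF k' G' K' h' v' e' hne' f hf'
    have := EV_inj hf hf' (card_lt_of hcF v1 v2 v3) (by simp only [b]; omega)
    exact Prod.ext this.1 this.2

end MasterA

/-! ## Part 14: telescoping for fixed `n` -/

section MasterB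
variable {u r : ℕ} {F : Finset (Finset (Fin r))} {n : ℕ}

set_option maxHeartbeats 1000000 in
/-- Real-variable telescoping lemma. -/
lemma tele_real {f g : ℝ → ℝ} {A a Δ B δ : ℝ} {s L D : ℕ} (hs : 1 ≤ s) (hA0 : 0 ≤ A) (hA1 : A ≤ 1)
    (ha : 0 ≤ a) (hΔ : 0 ≤ Δ) (hb : a + L * Δ ≤ 1) (hx : A * (a + L * Δ) ^ s ≤ 1 / 2)
    (hB : 0 ≤ B) (hδ : B * (A * (a + L * Δ) ^ s) ≤ δ)
    (hg : ∀ x, 0 ≤ x → x ≤ 1 → 0 ≤ g x ∧ g x ≤ 1)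
    (hf : ∀ x τ, 0 ≤ x → x ≤ 1 → 0 ≤ τ → τ ≤ 1 →
      f (1 - (1 - x) * (1 - τ)) ≤ f x + D * τ * g x + (B * τ + (D * τ) * (D * τ))) :
    f (A * (a + L * Δ) ^ s) - f (A * a ^ s) -
        2 * (A * (a + L * Δ) ^ s) * (D * ((a + L * Δ) ^ s - a ^ s)) - 2 * δ
        - (2 * s ^ 2 * D + 4 * D ^ 2 * s ^ 2) * Δ ≤
      ∑ k ∈ Finset.range L, (A * Δ * (s * (a + k * Δ) ^ (s - 1)) * D) * g (A * (a + k * Δ) ^ s) := by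
  set p : ℕ → ℝ := fun k => a + k * Δ with hp
  set x : ℕ → ℝ := fun k => A * p k ^ s with hxdef
  have hp0 : ∀ k, 0 ≤ p k := fun k => by simp only [hp]; positivity
  have hpm : ∀ j k, j ≤ k → p j ≤ p k := fun j k h => by
    simp only [hp]
    have : (j : ℝ) ≤ k := by exact_mod_cast h
    nlinarith
  have hxm : ∀ j k, j ≤ k → x j ≤ x k := fun j k h =>
    mul_le_mul_of_nonneg_left (pow_le_pow_left₀ (hp0 j) (hpm j k h) s) hA0
  have hx0 : ∀ k, 0 ≤ x k := fun k => mul_nonneg hA0 (pow_nonneg (hp0 k) s)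
  have hps : ∀ k, p (k + 1) - p k = Δ := fun k => by simp only [hp]; push_cast; ring
  have hxL : x L ≤ 1 / 2 := hx
  have hpL : p L ≤ 1 := hb
  have hs1 : (1 : ℝ) ≤ s := by exact_mod_cast hs
  have key : ∀ k < L, f (x (k + 1)) - f (x k) ≤ (A * Δ * (s * p k ^ (s - 1)) * D) * g (x k)
      + 2 * x L * (D * (p (k + 1) ^ s - p k ^ s)) + 2 * B * (x (k + 1) - x k)
      + (2 * s ^ 2 * D + 4 * D ^ 2 * s ^ 2) * Δ * Δ := by
    intro k hk
    have hxk : x k ≤ 1 / 2 := (hxm k L hk.le).trans hxL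
    have hxk1 : x (k + 1) ≤ 1 / 2 := (hxm (k + 1) L hk).trans hxL
    have h1x : 0 < 1 - x k := by linarith
    set y := x (k + 1) - x k with hy
    have hy0 : 0 ≤ y := by have := hxm k (k + 1) (Nat.le_succ k); simp only [hy]; linarith
    set τ := y / (1 - x k) with hτ
    have hτ0 : 0 ≤ τ := div_nonneg hy0 h1x.le
    have hτy : τ * (1 - x k) = y := div_mul_cancel₀ _ h1x.ne'
    have hτ1 : τ ≤ 1 := by rw [hτ, div_le_one h1x]; simp only [hy]; linarith
    have hτ2 : τ ≤ y + 2 * x L * y := by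
      have h3 : x k ≤ x L := hxm k L hk.le
      have hx0k := hx0 k
      have : y ≤ (y + 2 * x L * y) * (1 - x k) := by
        nlinarith [mul_nonneg hy0 (hx0 L), mul_nonneg hy0 (hx0 k),
          mul_nonneg (mul_nonneg hy0 (hx0 L)) (by linarith : 0 ≤ 1 / 2 - x k), mul_le_mul_of_nonneg_left h3 hy0]
      rw [hτ, div_le_iff₀ h1x]; exact this
    have hτ3 : τ ≤ 2 * y := by nlinarith
    have hstep := hf (x k) τ (hx0 k) (by linarith) hτ0 hτ1
    have e1 : 1 - (1 - x k) * (1 - τ) = x (k + 1) := by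
      have : (1 - x k) * τ = y := by rw [mul_comm]; exact hτy
      have h2 : y = x (k + 1) - x k := rfl
      linarith [this, h2, (by ring : 1 - (1 - x k) * (1 - τ) = x k + (1 - x k) * τ)]
    rw [e1] at hstep
    obtain ⟨hg0, hg1⟩ := hg (x k) (hx0 k) (by linarith)
    set gk := g (x k) with hgk
    -- bounds on y
    have hpk1 : p (k + 1) ≤ 1 := (hpm (k + 1) L hk).trans hpL
    have hb1 : p (k + 1) ^ (s - 1) ≤ p k ^ (s - 1) + s * Δ := by
      rcases Nat.lt_or_ge (s - 1) 1 with h | h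
      · have : s - 1 = 0 := by omega
        rw [this]; simp; positivity
      · have h4 := pow_sub_le (hp0 k) (hpm k (k + 1) (Nat.le_succ k)) h
        rw [hps] at h4
        have h5 : p (k + 1) ^ (s - 1 - 1) ≤ 1 := pow_le_one₀ (hp0 _) hpk1
        have h6 : ((s - 1 : ℕ) : ℝ) ≤ s := by exact_mod_cast Nat.sub_le s 1
        have h7 : ((s - 1 : ℕ) : ℝ) * p (k + 1) ^ (s - 1 - 1) * Δ ≤ s * 1 * Δ := by
          gcongr
        linarith
    have hpw := pow_sub_le (hp0 k) (hpm k (k + 1) (Nat.le_succ k)) hs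
    rw [hps] at hpw
    have hye : y = A * (p (k + 1) ^ s - p k ^ s) := by simp only [hy, hxdef]; ring
    have hz0 : 0 ≤ p (k + 1) ^ s - p k ^ s :=
      sub_nonneg.2 (pow_le_pow_left₀ (hp0 k) (hpm k (k + 1) (Nat.le_succ k)) s)
    have hyz : y ≤ p (k + 1) ^ s - p k ^ s := by rw [hye]; exact mul_le_of_le_one_left hz0 hA1
    have hy1 : y ≤ A * Δ * (s * p k ^ (s - 1)) + s ^ 2 * Δ * Δ := by
      have h8 : p (k + 1) ^ s - p k ^ s ≤ s * (p k ^ (s - 1) + s * Δ) * Δ := by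
        refine hpw.trans ?_
        gcongr
      have h9 : A * (p (k + 1) ^ s - p k ^ s) ≤ A * (s * (p k ^ (s - 1) + s * Δ) * Δ) :=
        mul_le_mul_of_nonneg_left h8 hA0
      have h10 : A * (s * (s * Δ) * Δ) ≤ s * (s * Δ) * Δ := mul_le_of_le_one_left (by positivity) hA1
      rw [hye]; nlinarith
    have hy2 : y ≤ s * Δ := by
      have h5 : p (k + 1) ^ (s - 1) ≤ 1 := pow_le_one₀ (hp0 _) hpk1
      have : s * p (k + 1) ^ (s - 1) * Δ ≤ s * 1 * Δ := by gcongr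
      linarith
    have hτ4 : τ ≤ 2 * (s * Δ) := by linarith
    have t1 : D * τ * gk ≤ D * (A * Δ * (s * p k ^ (s - 1)) + s ^ 2 * Δ * Δ) * gk +
        2 * x L * (D * (p (k + 1) ^ s - p k ^ s)) := by
      have q1 : D * τ * gk ≤ D * (y + 2 * x L * y) * gk := by gcongr
      have q2 : D * y * gk ≤ D * (A * Δ * (s * p k ^ (s - 1)) + s ^ 2 * Δ * Δ) * gk := by gcongr
      have q3 : D * (2 * x L * y) * gk ≤ D * (2 * x L * y) :=
        mul_le_of_le_one_right (by have := hx0 L; positivity) hg1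
      have q4 : D * (2 * x L * y) ≤ D * (2 * x L * (p (k + 1) ^ s - p k ^ s)) := by
        have := hx0 L; gcongr
      linarith
    have t2 : D * (s ^ 2 * Δ * Δ) * gk ≤ D * (s ^ 2 * Δ * Δ) :=
      mul_le_of_le_one_right (by positivity) hg1
    have t3 : (D * τ) * (D * τ) ≤ (D * (2 * (s * Δ))) * (D * (2 * (s * Δ))) := by gcongr
    have t4 : B * τ ≤ B * (2 * y) := by gcongr
    have t5 : 0 ≤ D * (s ^ 2 * Δ * Δ) := by positivity
    linarith
  have hsum := Finset.sum_le_sum (fun k hk => key k (Finset.mem_range.1 hk))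
  rw [Finset.sum_range_sub (fun k => f (x k))] at hsum
  simp only [Finset.sum_add_distrib, ← Finset.mul_sum] at hsum
  rw [Finset.sum_range_sub (fun k => p k ^ s), Finset.sum_range_sub x] at hsum
  simp only [Finset.sum_const, Finset.card_range, nsmul_eq_mul] at hsum
  have hLΔ : L * Δ ≤ 1 := by linarith
  have r1 : L * ((2 * s ^ 2 * D + 4 * D ^ 2 * s ^ 2) * Δ * Δ) ≤
      (2 * s ^ 2 * D + 4 * D ^ 2 * s ^ 2) * Δ := by
    have : (2 * s ^ 2 * D + 4 * D ^ 2 * s ^ 2) * Δ * (L * Δ) ≤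
      (2 * s ^ 2 * D + 4 * D ^ 2 * s ^ 2) * Δ * 1 := by gcongr
    linarith
  have hδ' : B * x L ≤ δ := hδ
  have r2 : 2 * B * (x L - x 0) ≤ 2 * δ := by
    nlinarith [mul_nonneg hB (hx0 0)]
  have z0 : p 0 = a := by simp [hp]
  have z1 : x 0 = A * a ^ s := by simp only [hxdef, z0]
  have zL : a + L * Δ = p L := rfl
  rw [z0] at hsum
  rw [zL, ← z1]
  have zx : A * p L ^ s = x L := rfl
  rw [zx]
  change _ ≤ ∑ k ∈ Finset.range L, (A * Δ * (s * p k ^ (s - 1)) * D) * g (x k)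
  linarith

lemma Lev.mono {d : ℕ} {Λ p q : ℝ} (h : Lev u F n d Λ q) (hp0 : 0 ≤ p) (hpq : p ≤ q) :
    Lev u F n d Λ p :=
  ⟨hp0, hpq.trans h.hp1, h.hΛ, le_trans (by gcongr) h.hpn, h.hη, h.hd, h.hn⟩

set_option maxHeartbeats 1000000 in
/-- Fixed-`n` bound. -/
theorem masterB (hF : NF u F) {d D : ℕ} {Λ a b PB δ t err ε : ℝ} (ha : 0 ≤ a) (hab : a ≤ b)
    (hb : b ≤ 1 / 2) (hL : Lev u F n d Λ b) (hD : ∀ v, Dv F n v = D) (ht : 0 < t)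
    (hPB : ∀ p, a ≤ p → p ≤ b →
      ex (qJ (allFEdges F n) (piF F n d Λ p)) (fun H => ind (¬ Good F d H)) ≤ PB)
    (hδ : (r : ℝ) * r * n ^ (r - 2) * (piF F n d Λ b) ≤ δ) (hδ2 : δ ≤ 1 / 2)
    (herr : ∀ p, a ≤ p → p ≤ b → errL F n d D Λ p PB δ t ≤ err) (herr0 : 0 ≤ err) (hε : 0 < ε) :
    ∃ μ : PMF ((Fin (Nat.choose n u) → Finset (Fin n)) × (Fin (Mnum F n) → FE n)),
      UniformOn μ Prod.fst (ValidOrdU u n) ∧ UniformOn μ Prod.snd (ValidOrdH F n) ∧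
      ENNReal.ofReal (fH F n (piF F n d Λ b) - fH F n (piF F n d Λ a)
        - 2 * piF F n d Λ b * (D * (b ^ F.card - a ^ F.card)) - 2 * δ
        - D * (b ^ F.card - a ^ F.card) * err - ε) ≤
        μ.toOuterMeasure
          {ω | ∀ h ∈ proc ω.2 (THit F n ω.2), h.2 ⊆ proc ω.1 (TGHit u F n ω.1)} := by
  have hs := hF.pos
  set s := F.card with hsdef
  set A := 1 - etaB r F.card d Λ n with hA
  have hA0 : 0 ≤ A := by have := hL.hη; simp only [hA]; linarith
  have hA1 : A ≤ 1 := by have := hL.eta0; simp only [hA]; linarith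
  have hpi : ∀ p, piF F n d Λ p = A * p ^ s := fun p => rfl
  set Q : ℝ := 2 * ((n.choose u : ℝ) + Mnum F n * F.card) with hQ
  have hQ0 : 0 ≤ Q := by positivity
  set W : ℝ := D * (b ^ s - a ^ s) with hW
  have hbs : a ^ s ≤ b ^ s := pow_le_pow_left₀ ha hab s
  have hW0 : 0 ≤ W := mul_nonneg (by positivity) (by linarith)
  set R : ℝ := Q * W + (2 * s ^ 2 * D + 4 * D ^ 2 * s ^ 2) with hR
  have hR0 : 0 ≤ R := by positivity
  obtain ⟨L, hLL⟩ := exists_nat_gt (1 + Q + R / ε)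
  have hL0 : (0 : ℝ) < L := lt_trans (by positivity) hLL
  set Δ := (b - a) / L with hΔ
  have hΔ0 : 0 ≤ Δ := div_nonneg (by linarith) hL0.le
  have hΔ1 : Δ ≤ 1 / L := by rw [hΔ]; gcongr; linarith
  have hLΔ : a + L * Δ = b := by rw [hΔ]; field_simp; ring
  have hQΔ : Q * Δ ≤ 1 := by
    have h1 : Q * Δ ≤ Q * (1 / L) := by gcongr
    have h2 : Q * (1 / L) ≤ 1 := by
      rw [mul_one_div, div_le_one hL0]
      have : 0 ≤ R / ε := by positivity
      linarith
    linarith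
  have hRΔ : R * Δ ≤ ε := by
    have h1 : R * Δ ≤ R * (1 / L) := by gcongr
    have h2 : R * (1 / L) ≤ ε := by
      rw [mul_one_div, div_le_iff₀ hL0]
      have : R / ε < L := by linarith
      rw [div_lt_iff₀ hε] at this
      linarith
    linarith
  set p : ℕ → ℝ := fun k => a + k * Δ with hp
  have hpm : Monotone p := fun j k h => by
    have : (j : ℝ) ≤ k := by exact_mod_cast h
    simp only [hp]; gcongr
  have hpa : ∀ k, a ≤ p k := fun k => by simp only [hp]; nlinarith [mul_nonneg (Nat.cast_nonneg (α := ℝ) k) hΔ0]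
  have hpb : ∀ k, k ≤ L → p k ≤ b := fun k hk => (hpm hk).trans hLΔ.le
  have hps : ∀ k, p (k + 1) - p k = Δ := fun k => by simp only [hp]; push_cast; ring
  have hδk : ∀ k, k ≤ L → (r : ℝ) * r * n ^ (r - 2) * (piF F n d Λ (p k)) ≤ δ := by
    intro k hk
    refine le_trans ?_ hδ
    rw [hpi, hpi]
    have h1 := hpb k hk
    have h2 := ha.trans (hpa k)
    gcongr
  have hex : ∀ k, ∃ γ : Finset (Finset (Fin n)) → Finset (FE n) → ℝ, k < L →
      LC u F n (p k) (A * p k ^ s) γ ∧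
      D * (gH F n (A * p k ^ s) - err) ≤ ∑ G, ∑ K, γ G K * ∑ v, ∑ h, ind (Tr F G K h v) := by
    intro k
    by_cases hk : k < L
    · refine Exists.elim (lev_mass hF (hL.mono (ha.trans (hpa k)) (hpb k hk.le)) hD ht
        (hPB _ (hpa k) (hpb k hk.le)) (hδk k hk.le) hδ2) ?_
      rintro γ ⟨h1, h2, h3, h4, h5⟩
      refine ⟨γ, fun _ => ⟨⟨h1, h2, h3, h4⟩, le_trans ?_ h5⟩⟩
      have := herr _ (hpa k) (hpb k hk.le)
      refine mul_le_mul_of_nonneg_left ?_ (by positivity)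
      exact sub_le_sub_left this _
    · exact ⟨fun _ _ => 0, fun h => absurd h hk⟩
  choose γ hγ using hex
  refine Exists.elim (masterA hF p L hpm (by simpa [hp] using ha) (le_trans hLΔ.le hb) hA0 hA1
    (ζ := Q * Δ) hQΔ (fun k _ => by rw [hps]) γ (fun k hk => (hγ k hk).1)) ?_
  rintro μ ⟨m1, m2, m3⟩
  refine ⟨μ, m1, m2, le_trans (ENNReal.ofReal_le_ofReal ?_) m3⟩
  have hb0 : 0 ≤ b := ha.trans hab
  have hxb : A * b ^ s ≤ 1 / 2 := by
    have h1 : b ^ s ≤ b := pow_le_of_le_one hb0 (by linarith) hs.ne'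
    have h2 : A * b ^ s ≤ b ^ s := mul_le_of_le_one_left (by positivity) hA1
    linarith
  have tele := tele_real (f := fH F n) (g := gH F n) (A := A) (a := a) (Δ := Δ)
    (B := (r : ℝ) * r * n ^ (r - 2)) (δ := δ) (s := s) (L := L) (D := D) hs hA0 hA1 ha hΔ0
    (by rw [hLΔ]; linarith) (by rw [hLΔ]; exact hxb) (by positivity) (by rw [hLΔ]; exact hδ)
    (fun x h0 h1 => ⟨gH_nonneg h0 h1, gH_le h0 h1⟩) (fun x τ h0 h1 h2 h3 => f_step hD h0 h1 h2 h3)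
  rw [hLΔ] at tele
  rw [hpi, hpi]
  set w : ℕ → ℝ := fun k => A * Δ * (s * p k ^ (s - 1)) * D with hw
  have hw0 : ∀ k, 0 ≤ w k := fun k => by
    have := ha.trans (hpa k)
    simp only [hw]; positivity
  have hwsum : ∑ k ∈ Finset.range L, w k ≤ W := by
    have : ∀ k ∈ Finset.range L, w k ≤ D * (p (k + 1) ^ s - p k ^ s) := by
      intro k _
      have h0 := ha.trans (hpa k)
      have h1 := pow_sub_ge h0 (hpm (Nat.le_succ k)) hs
      rw [Nat.succ_eq_add_one, hps] at h1
      have h2 : A * (Δ * (s * p k ^ (s - 1)) * D) ≤ Δ * (s * p k ^ (s - 1)) * D :=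
        mul_le_of_le_one_left (by positivity) hA1
      have h3 : D * (s * p k ^ (s - 1) * Δ) ≤ D * (p (k + 1) ^ s - p k ^ s) := by gcongr
      simp only [hw]; linarith
    refine (Finset.sum_le_sum this).trans ?_
    rw [← Finset.mul_sum, Finset.sum_range_sub (fun k => p k ^ s)]
    have z0 : p 0 = a := by simp [hp]
    have zL : p L = b := hLΔ
    rw [z0, zL]
  have hterm : ∀ k ∈ Finset.range L, w k * gH F n (A * p k ^ s) - (Q * Δ) * w k - w k * err ≤
      ((1 - Q * Δ) * A) * (p (k + 1) - p k) *
          p k ^ (s - 1) * (s * ∑ G, ∑ K, γ k G K * ∑ v, ∑ h, ind (Tr F G K h v)) := by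
    intro k hk
    rw [Finset.mem_range] at hk
    have h0 := ha.trans (hpa k)
    have hc : 0 ≤ ((1 - Q * Δ) * A) * Δ * p k ^ (s - 1) * s := by
      have : 0 ≤ 1 - Q * Δ := by linarith
      positivity
    have h1 := mul_le_mul_of_nonneg_left (hγ k hk).2 hc
    rw [hps]
    have hx0 : 0 ≤ A * p k ^ s := by positivity
    have hx1 : A * p k ^ s ≤ 1 := by
      have : A * p k ^ s ≤ A * b ^ s := by have := hpb k hk.le; gcongr
      linarith
    have g0 := gH_nonneg (F := F) (n := n) hx0 hx1
    have g1 := gH_le (F := F) (n := n) hx0 hx1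
    have h2 : (1 - Q * Δ) * (w k * (gH F n (A * p k ^ s) - err)) ≤
      ((1 - Q * Δ) * A) * Δ *
          p k ^ (s - 1) * (s * ∑ G, ∑ K, γ k G K * ∑ v, ∑ h, ind (Tr F G K h v)) := by
      simp only [hw]; linarith
    refine le_trans ?_ h2
    have hq : 0 ≤ Q * Δ := by positivity
    have h3 : Q * Δ * w k * gH F n (A * p k ^ s) ≤ Q * Δ * w k :=
      mul_le_of_le_one_right (mul_nonneg hq (hw0 k)) g1
    have h4 : 0 ≤ Q * Δ * w k * err := mul_nonneg (mul_nonneg hq (hw0 k)) herr0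
    linarith
  refine le_trans ?_ (Finset.sum_le_sum hterm)
  have hsplit : ∑ k ∈ Finset.range L, (w k * gH F n (A * p k ^ s) - (Q * Δ) * w k - w k * err) =
      ∑ k ∈ Finset.range L, w k * gH F n (A * p k ^ s) - (Q * Δ) * ∑ k ∈ Finset.range L, w k -
        (∑ k ∈ Finset.range L, w k) * err := by
    clear_value w
    rw [Finset.sum_sub_distrib, Finset.sum_sub_distrib, ← Finset.mul_sum, ← Finset.sum_mul]
  rw [hsplit]
  have i1 : (Q * Δ) * ∑ k ∈ Finset.range L, w k ≤ Q * Δ * W :=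
    mul_le_mul_of_nonneg_left hwsum (by positivity)
  have i2 : (∑ k ∈ Finset.range L, w k) * err ≤ W * err :=
    mul_le_mul_of_nonneg_right hwsum herr0
  have i3 : R * Δ = Q * Δ * W + (2 * s ^ 2 * D + 4 * D ^ 2 * s ^ 2) * Δ := by rw [hR]; ring
  have tele' : fH F n (A * b ^ s) - fH F n (A * a ^ s) - 2 * (A * b ^ s) * W - 2 * δ
      - (2 * s ^ 2 * D + 4 * D ^ 2 * s ^ 2) * Δ ≤
      ∑ k ∈ Finset.range L, w k * gH F n (A * p k ^ s) := tele
  change fH F n (A * b ^ s) - fH F n (A * a ^ s) - 2 * (A * b ^ s) * W - 2 * δ - W * err - ε ≤ _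
  generalize (∑ k ∈ Finset.range L, w k * gH F n (A * p k ^ s)) = S1 at *
  clear_value W
  linarith

end MasterB

/-! ## Part 15: estimates for fixed `n` inside the window -/

section Window
variable {u r : ℕ} {F : Finset (Finset (Fin r))} {n : ℕ}

lemma one_sub_ge_exp {y : ℝ} (h0 : 0 ≤ y) (h1 : y ≤ 1 / 2) : Real.exp (-(y + 2 * y ^ 2)) ≤ 1 - y := by
  have hp : 0 < 1 - y := by linarith
  have h2 : 1 / (1 - y) ≤ Real.exp (y / (1 - y)) := by
    have := Real.add_one_le_exp (y / (1 - y))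
    refine le_trans (le_of_eq ?_) this
    field_simp; ring
  have h3 : y / (1 - y) ≤ y + 2 * y ^ 2 := by
    rw [div_le_iff₀ hp]; nlinarith [mul_nonneg h0 h0, mul_nonneg (mul_nonneg h0 h0) (by linarith : 0 ≤ 1/2 - y)]
  have h4 : 1 / (1 - y) ≤ Real.exp (y + 2 * y ^ 2) := h2.trans (Real.exp_le_exp.2 h3)
  rw [Real.exp_neg, ← one_div]
  rw [div_le_iff₀ hp] at h4
  rw [div_le_iff₀ (Real.exp_pos _)]
  linarith

lemma one_sub_pow_le_exp {y : ℝ} (h1 : y ≤ 1) (D : ℕ) : (1 - y) ^ D ≤ Real.exp (-(D * y)) := by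
  have : 1 - y ≤ Real.exp (-y) := Real.one_sub_le_exp_neg y
  calc (1 - y) ^ D ≤ (Real.exp (-y)) ^ D := pow_le_pow_left₀ (by linarith) this D
    _ = _ := by rw [← Real.exp_nat_mul]; congr 1; ring

lemma one_sub_pow_ge_exp {y : ℝ} (h0 : 0 ≤ y) (h1 : y ≤ 1 / 2) (D : ℕ) :
    Real.exp (-(D * y + 2 * (D * y ^ 2))) ≤ (1 - y) ^ D := by
  calc _ = (Real.exp (-(y + 2 * y ^ 2))) ^ D := by rw [← Real.exp_nat_mul]; congr 1; ring
    _ ≤ _ := pow_le_pow_left₀ (Real.exp_pos _).le (one_sub_ge_exp h0 h1) D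

set_option maxHeartbeats 1000000 in
/-- The bound for fixed `n`, with explicit smallness hypotheses. -/
theorem masterC (hF : NF u F) {d D : ℕ} {Λ C θ ℓ : ℝ} (hn : 1 ≤ n) (hℓ : ℓ = Real.log n)
    (hC : 1 ≤ C) (hℓC : C ≤ ℓ) (hθ : 0 < θ) (hθ2 : θ ≤ 1 / 2) (hd : 1 ≤ d) (hΛ : 1 ≤ Λ)
    (hD : ∀ v, Dv F n v = D) (hD0 : 0 < D)
    (h1 : (ℓ + C) / D ≤ (θ / (2 * F.card)) ^ F.card)
    (h2 : etaB r F.card d Λ n * (ℓ + C) ≤ θ)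
    (h3 : D * ((ℓ + C) / D) ^ 2 ≤ θ)
    (h4 : (r : ℝ) * r * n ^ (r - 2) * ((ℓ + C) / D) ≤ θ)
    (h5 : n * (Real.exp (ℓ + C) / 2 ^ (d + 1)) +
        (F.card + 2) * ((r + 1) ^ r * Λ) ^ (F.card + 1) / n ≤ θ ^ 2)
    (h6 : (n : ℝ) ^ (r - 1) * ((ℓ + C) / D) ≤ Λ) :
    ∃ μ : PMF ((Fin (Nat.choose n u) → Finset (Fin n)) × (Fin (Mnum F n) → FE n)),
      UniformOn μ Prod.fst (ValidOrdU u n) ∧ UniformOn μ Prod.snd (ValidOrdH F n) ∧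
      ENNReal.ofReal (1 - 2 * Real.exp (1 - C) - θ * (5 + 4 * C +
        2 * C * (2 + 4 * Real.exp (C + 1) + 2 * Real.exp (C + 1) ^ 2))) ≤
        μ.toOuterMeasure
          {ω | ∀ h ∈ proc ω.2 (THit F n ω.2), h.2 ⊆ proc ω.1 (TGHit u F n ω.1)} := by
  have hs := hF.pos
  have hsR : (1 : ℝ) ≤ F.card := by exact_mod_cast hs
  set s := F.card with hsdef
  set η := etaB r s d Λ n with hη
  have hDR : (0 : ℝ) < D := by exact_mod_cast hD0
  have hnR : (0 : ℝ) < n := by exact_mod_cast hn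
  have hη0 : 0 ≤ η := by
    simp only [hη]; unfold etaB
    have : 0 ≤ Λ := by linarith
    positivity
  have hη1 : η ≤ θ / 2 := by nlinarith
  have hexpl : Real.exp ℓ = n := by rw [hℓ, Real.exp_log hnR]
  set ya := (ℓ - C) / D with hya
  set yb := (ℓ + C) / D with hyb
  have hya0 : 0 ≤ ya := div_nonneg (by linarith) hDR.le
  have hyab : ya ≤ yb := by simp only [hya, hyb]; gcongr; linarith
  have hDya : D * ya = ℓ - C := by simp only [hya]; field_simp
  have hDyb : D * yb = ℓ + C := by simp only [hyb]; field_simp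
  have hyb0 : 0 ≤ yb := hya0.trans hyab
  set a := ya ^ (1 / (s : ℝ)) with ha
  set b := yb ^ (1 / (s : ℝ)) with hb
  have has : a ^ s = ya := by
    rw [ha, one_div, Real.rpow_inv_natCast_pow hya0 hs.ne']
  have hbs : b ^ s = yb := by
    rw [hb, one_div, Real.rpow_inv_natCast_pow hyb0 hs.ne']
  have ha0 : 0 ≤ a := Real.rpow_nonneg hya0 _
  have hb0 : 0 ≤ b := Real.rpow_nonneg hyb0 _
  have hab : a ≤ b := Real.rpow_le_rpow hya0 hyab (by positivity)
  have hbθ : b ≤ θ / (2 * s) := by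
    refine le_of_pow_le_pow_left₀ hs.ne' (by positivity) ?_
    rw [hbs]; exact h1
  have hsb : s * b ≤ θ / 2 := by
    have : s * b ≤ s * (θ / (2 * s)) := by gcongr
    refine this.trans (le_of_eq ?_)
    field_simp
  have hbθ' : b ≤ θ / 2 := le_trans (by nlinarith) hsb
  have hybθ : yb ≤ θ / 2 := by
    rw [← hbs]
    exact (pow_le_of_le_one hb0 (by linarith) hs.ne').trans hbθ'
  set E := Real.exp (C + 1) with hE
  have hE0 : 0 < E := Real.exp_pos _
  have hLb : Lev u F n d Λ b := by
    refine ⟨hb0, by linarith, hΛ, ?_, by linarith, hd, hn⟩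
    rw [hbs]; exact h6
  have hA0 : 0 ≤ 1 - η := by linarith
  -- window estimates
  have hwin : ∀ p, a ≤ p → p ≤ b → ya ≤ p ^ s ∧ p ^ s ≤ yb := by
    intro p h h'
    rw [← has, ← hbs]
    exact ⟨pow_le_pow_left₀ ha0 h s, pow_le_pow_left₀ (ha0.trans h) h' s⟩
  have hpi : ∀ p, piF F n d Λ p = (1 - η) * p ^ s := fun p => rfl
  have hpile : ∀ p, a ≤ p → p ≤ b → 0 ≤ piF F n d Λ p ∧ piF F n d Λ p ≤ p ^ s := by
    intro p h h'
    have hp0 : 0 ≤ p ^ s := pow_nonneg (ha0.trans h) s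
    rw [hpi]
    exact ⟨mul_nonneg hA0 hp0, mul_le_of_le_one_left hp0 (by linarith)⟩
  have hEXgen : ∀ p, a ≤ p → p ≤ b → (n : ℝ) * (1 - piF F n d Λ p) ^ D ≤
      Real.exp (ℓ - D * p ^ s + 1) := by
    intro p h h'
    obtain ⟨q1, q2⟩ := hwin p h h'
    obtain ⟨q3, q4⟩ := hpile p h h'
    have := one_sub_pow_le_exp (y := piF F n d Λ p) (by linarith) D
    calc (n : ℝ) * (1 - piF F n d Λ p) ^ D ≤ Real.exp ℓ * Real.exp (-(D * piF F n d Λ p)) := by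
          rw [hexpl]; gcongr
      _ = Real.exp (ℓ - D * p ^ s + η * (D * p ^ s)) := by
          rw [← Real.exp_add, hpi]; congr 1; ring
      _ ≤ _ := by
          apply Real.exp_le_exp.2
          have : D * p ^ s ≤ ℓ + C := by rw [← hDyb]; gcongr
          have : η * (D * p ^ s) ≤ η * (ℓ + C) := by gcongr
          linarith
  have hEX : ∀ p, a ≤ p → p ≤ b → (n : ℝ) * (1 - piF F n d Λ p) ^ D ≤ E := by
    intro p h h'
    refine (hEXgen p h h').trans (Real.exp_le_exp.2 ?_)
    have : D * ya ≤ D * p ^ s := by have := (hwin p h h').1; gcongr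
    linarith
  have hEXb : (n : ℝ) * (1 - piF F n d Λ b) ^ D ≤ Real.exp (1 - C) := by
    refine (hEXgen b hab le_rfl).trans (Real.exp_le_exp.2 ?_)
    rw [hbs, hDyb]; linarith
  have hEXa : Real.exp (C - 1) ≤ (n : ℝ) * (1 - piF F n d Λ a) ^ D := by
    obtain ⟨q3, q4⟩ := hpile a le_rfl hab
    have e1 := one_sub_pow_ge_exp (y := ya) hya0 (by linarith) D
    have e2 : (1 - ya) ^ D ≤ (1 - piF F n d Λ a) ^ D := by
      rw [has] at q4
      exact pow_le_pow_left₀ (by linarith) (by linarith) D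
    calc Real.exp (C - 1) ≤ Real.exp (ℓ + -(D * ya + 2 * (D * ya ^ 2))) := by
          apply Real.exp_le_exp.2
          have : D * ya ^ 2 ≤ D * yb ^ 2 := by gcongr
          linarith
      _ = n * Real.exp (-(D * ya + 2 * (D * ya ^ 2))) := by rw [Real.exp_add, hexpl]
      _ ≤ n * (1 - piF F n d Λ a) ^ D := by gcongr; exact e1.trans e2
  -- the bad event
  have hPB : ∀ p, a ≤ p → p ≤ b →
      ex (qJ (allFEdges F n) (piF F n d Λ p)) (fun H => ind (¬ Good F d H)) ≤ θ ^ 2 := by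
    intro p h h'
    obtain ⟨q1, q2⟩ := hwin p h h'
    obtain ⟨q3, q4⟩ := hpile p h h'
    have q5 : piF F n d Λ p ≤ yb := q4.trans q2
    refine le_trans (bad_le hF q3 (by linarith) hn hΛ ?_ d (X := ℓ + C) ?_) h5
    · refine le_trans ?_ h6
      rw [mul_comm]; gcongr
    · intro v
      rw [hD, ← hDyb, mul_comm]; gcongr
  have hδ : (r : ℝ) * r * n ^ (r - 2) * (piF F n d Λ b) ≤ θ := by
    refine le_trans ?_ h4
    have := (hpile b hab le_rfl).2
    rw [hbs] at this
    gcongr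
  have hE1 : 0 ≤ 2 + 4 * E + 2 * E ^ 2 := by positivity
  have herr : ∀ p, a ≤ p → p ≤ b →
      errL F n d D Λ p (θ ^ 2) θ θ ≤ θ * (2 + 4 * E + 2 * E ^ 2) := by
    intro p h h'
    obtain ⟨q1, q2⟩ := hwin p h h'
    obtain ⟨q3, q4⟩ := hpile p h h'
    have hX := hEX p h h'
    have hp0 : 0 ≤ p := ha0.trans h
    unfold errL
    set π := piF F n d Λ p with hπ
    have hπ2 : π ≤ 1 / 2 := by linarith
    have hX0 : 0 ≤ (n : ℝ) * (1 - π) ^ D := by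
      have : 0 ≤ 1 - π := by linarith
      positivity
    have d1 : (n : ℝ) * (1 - π) ^ D - n * (1 - p ^ s) ^ D ≤ 2 * E * θ := by
      have e1 := pow_sub_le (a := 1 - p ^ s) (b := 1 - π) (by linarith) (by linarith) hD0
      have e2 : (1 - π) - (1 - p ^ s) = η * p ^ s := by rw [hπ, hpi]; ring
      rw [e2] at e1
      have e3 : (1 - π) ^ (D - 1) ≤ 2 * (1 - π) ^ D := by
        obtain ⟨D', rfl⟩ := Nat.exists_eq_add_of_le' hD0
        rw [Nat.add_sub_cancel, pow_succ]
        have : 0 ≤ (1 - π) ^ D' := pow_nonneg (by linarith) _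
        nlinarith
      have e4 : D * (1 - π) ^ (D - 1) * (η * p ^ s) ≤ D * (2 * (1 - π) ^ D) * (η * yb) := by
        have : 0 ≤ 1 - π := by linarith
        gcongr
      calc (n : ℝ) * (1 - π) ^ D - n * (1 - p ^ s) ^ D =
          n * ((1 - π) ^ D - (1 - p ^ s) ^ D) := by ring
        _ ≤ n * (D * (2 * (1 - π) ^ D) * (η * yb)) := by
            have := e1.trans e4
            gcongr
        _ = 2 * (n * (1 - π) ^ D) * (η * (D * yb)) := by ring
        _ ≤ 2 * E * θ := by
            rw [hDyb]
            have : 0 ≤ η * (ℓ + C) := mul_nonneg hη0 (by linarith)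
            gcongr
    have d2 : (n : ℝ) ^ 2 * ((1 - π) ^ D * (1 - π) ^ D * (1 + 2 * θ)) ≤ 2 * E ^ 2 := by
      calc (n : ℝ) ^ 2 * ((1 - π) ^ D * (1 - π) ^ D * (1 + 2 * θ)) =
          (n * (1 - π) ^ D) ^ 2 * (1 + 2 * θ) := by ring
        _ ≤ E ^ 2 * 2 := by gcongr; linarith
        _ = _ := by ring
    have d3 : θ ^ 2 / θ = θ := by field_simp
    have d4 : (n : ℝ) * (1 - π) ^ D * (s * p + η) ≤ E * θ := by
      have : s * p ≤ s * b := by gcongr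
      have h0 : 0 ≤ s * p + η := by positivity
      calc _ ≤ E * (s * p + η) := by gcongr
        _ ≤ E * θ := by gcongr; linarith
    have d5 : θ * (n * (1 - π) ^ D + n ^ 2 * ((1 - π) ^ D * (1 - π) ^ D * (1 + 2 * θ))) ≤
        θ * (E + 2 * E ^ 2) := by gcongr
    have d6 : θ ^ 2 ≤ θ := by nlinarith
    rw [d3]
    linarith
  refine Exists.elim (masterB hF (t := θ) (PB := θ ^ 2) (δ := θ) (err := θ * (2 + 4 * E + 2 * E ^ 2))
    (ε := θ) ha0 hab (by linarith) hLb hD hθ hPB hδ hθ2 herr (by positivity) hθ) ?_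
  rintro μ ⟨m1, m2, m3⟩
  refine ⟨μ, m1, m2, le_trans (ENNReal.ofReal_le_ofReal ?_) m3⟩
  have hW : D * (b ^ s - a ^ s) = 2 * C := by rw [has, hbs, mul_sub, hDya, hDyb]; ring
  rw [hW]
  obtain ⟨q3, q4⟩ := hpile b hab le_rfl
  obtain ⟨q5, q6⟩ := hpile a le_rfl hab
  rw [hbs] at q4
  rw [has] at q6
  have f1 := f_end hD q3 (by linarith)
  have f2 := f_start hD (δ := θ) q5 (by linarith) hn (le_trans (by
    have : piF F n d Λ a ≤ piF F n d Λ b := by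
      rw [hpi, hpi]; gcongr
    gcongr) hδ) hθ2
  have f3 : 1 / ((n : ℝ) * (1 - piF F n d Λ a) ^ D) ≤ Real.exp (1 - C) := by
    calc _ ≤ 1 / Real.exp (C - 1) := by gcongr
      _ = _ := by rw [one_div, ← Real.exp_neg]; congr 1; ring
  have f4 : 2 * piF F n d Λ b * (2 * C) ≤ θ * (4 * C) := by
    have : piF F n d Λ b ≤ θ := by linarith
    nlinarith
  linarith

end Window

/-! ## Part 16: asymptotics -/

section Asymp
variable {u r : ℕ} {F : Finset (Finset (Fin r))}

lemma logpow_tendsto (K : ℝ) (k : ℕ) {α : ℝ} (hα : 0 < α) :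
    Tendsto (fun n : ℕ => K * (Real.log n ^ k * (n : ℝ) ^ (-α))) atTop (nhds 0) := by
  have h := (isLittleO_log_rpow_rpow_atTop (k : ℝ) hα).tendsto_div_nhds_zero
  have h2 := (h.comp tendsto_natCast_atTop_atTop).const_mul K
  rw [mul_zero] at h2
  refine h2.congr (fun n => ?_)
  simp only [Function.comp]
  rw [Real.rpow_natCast, Real.rpow_neg (Nat.cast_nonneg n), div_eq_mul_inv]

lemma logpow_div_tendsto (K : ℝ) (k : ℕ) :
    Tendsto (fun n : ℕ => K * (Real.log n ^ k / (n : ℝ))) atTop (nhds 0) := by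
  refine (logpow_tendsto K k one_pos).congr (fun n => ?_)
  rw [Real.rpow_neg_one, div_eq_mul_inv]

set_option maxHeartbeats 1000000 in
theorem masterD (hF : NF u F) {ε : ℝ} (hε : 0 < ε) : ∀ᶠ n : ℕ in atTop,
    ∃ μ : PMF ((Fin (Nat.choose n u) → Finset (Fin n)) × (Fin (Mnum F n) → FE n)),
      UniformOn μ Prod.fst (ValidOrdU u n) ∧ UniformOn μ Prod.snd (ValidOrdH F n) ∧
      ENNReal.ofReal (1 - ε) ≤ μ.toOuterMeasure
          {ω | ∀ h ∈ proc ω.2 (THit F n ω.2), h.2 ⊆ proc ω.1 (TGHit u F n ω.1)} := by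
  have hs := hF.pos
  have hr := hF.hr
  obtain ⟨C, hC, hCε⟩ : ∃ C : ℝ, 1 ≤ C ∧ Real.exp (1 - C) ≤ ε / 4 := by
    refine ⟨1 + |Real.log (ε / 4)|, by linarith [abs_nonneg (Real.log (ε / 4))], ?_⟩
    calc Real.exp (1 - (1 + |Real.log (ε / 4)|)) ≤ Real.exp (Real.log (ε / 4)) := by
          apply Real.exp_le_exp.2
          linarith [neg_abs_le (Real.log (ε / 4))]
      _ = ε / 4 := Real.exp_log (by positivity)
  set K : ℝ := 5 + 4 * C + 2 * C * (2 + 4 * Real.exp (C + 1) + 2 * Real.exp (C + 1) ^ 2) with hK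
  have hK0 : 0 < K := by
    have := Real.exp_pos (C + 1)
    have : 0 < C := by linarith
    positivity
  set θ : ℝ := min (1 / 2) (ε / 2 / K) with hθd
  have hθ : 0 < θ := lt_min (by norm_num) (by positivity)
  have hθ2 : θ ≤ 1 / 2 := min_le_left _ _
  have hθK : θ * K ≤ ε / 2 := by
    have : θ ≤ ε / 2 / K := min_le_right _ _
    rwa [le_div_iff₀ hK0] at this
  set s := F.card with hsd
  have hsR : (0 : ℝ) < s := by exact_mod_cast hs
  have hrR : (4 : ℝ) ≤ r := by exact_mod_cast hr
  set B : ℝ := (2 * r) ^ r with hB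
  have hB1 : 1 ≤ B := one_le_pow₀ (by linarith)
  have hlog : Tendsto (fun n : ℕ => Real.log n) atTop atTop :=
    Real.tendsto_log_atTop.comp tendsto_natCast_atTop_atTop
  have v1 : (0 : ℝ) < (θ / (2 * s)) ^ s := by positivity
  have v2 : (0 : ℝ) < θ ^ 2 / 2 := by positivity
  have E1 := (logpow_div_tendsto (2 * B) 1).eventually (eventually_le_nhds v1)
  have E2 := (logpow_tendsto (2 ^ s * (r * r * (((12 * r) ^ r) ^ (r + 1))) * (2 * B) * 2)
    (r * (r + 1) + 2) (α := 1 / (s : ℝ)) (by positivity)).eventually (eventually_le_nhds hθ)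
  have E3 := (logpow_div_tendsto (2 * (2 * B)) 2).eventually (eventually_le_nhds hθ)
  have E4 := (logpow_div_tendsto (r * r * (2 * B)) 1).eventually (eventually_le_nhds hθ)
  have E5 := (logpow_div_tendsto (Real.exp C) 0).eventually (eventually_le_nhds v2)
  have E6 := (logpow_div_tendsto ((s + 2) * ((r + 1) ^ r * (2 * B)) ^ (s + 1)) (s + 1)).eventually
    (eventually_le_nhds v2)
  filter_upwards [E1, E2, E3, E4, E5, E6, hlog.eventually_ge_atTop C,
    eventually_ge_atTop (2 * r)] with n e1 e2 e3 e4 e5 e6 e7 e8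
  have hn : 1 ≤ n := by omega
  have hnR : (1 : ℝ) ≤ n := by exact_mod_cast hn
  have hn0 : (0 : ℝ) < n := by linarith
  set ℓ := Real.log n with hℓ
  have hℓ1 : 1 ≤ ℓ := hC.trans e7
  set D := Dv F n ⟨0, hn⟩ with hDd
  have hD : ∀ v, Dv F n v = D := fun v => Dv_eq F v _
  have hDge : (n : ℝ) ^ (r - 1) / B ≤ D := Dv_ge F hr e8 _
  have hDR : (0 : ℝ) < D := lt_of_lt_of_le (by positivity) hDge
  have hD0 : 0 < D := by exact_mod_cast hDR
  set y := (ℓ + C) / D with hy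
  have hy0 : 0 ≤ y := div_nonneg (by linarith) hDR.le
  have hDy : D * y = ℓ + C := by rw [hy]; field_simp
  have h6 : (n : ℝ) ^ (r - 1) * y ≤ 2 * B * ℓ := by
    have : (n : ℝ) ^ (r - 1) ≤ B * D := by
      rw [div_le_iff₀ (by linarith)] at hDge; linarith
    calc (n : ℝ) ^ (r - 1) * y ≤ (B * D) * y := by gcongr
      _ = B * (ℓ + C) := by rw [mul_assoc, hDy]
      _ ≤ B * (2 * ℓ) := by gcongr; linarith
      _ = _ := by ring
  have hnn : (n : ℝ) ^ (r - 1) = n * n ^ (r - 2) := by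
    rw [← pow_succ']; congr 1; omega
  have h7 : (n : ℝ) ^ (r - 2) * y ≤ 2 * B * (ℓ ^ 1 / n) := by
    rw [pow_one, ← mul_div_assoc (2 * B) ℓ, le_div_iff₀ hn0]
    rw [hnn] at h6
    linarith
  have h8 : y ≤ 2 * B * (ℓ ^ 1 / n) := by
    refine le_trans ?_ h7
    exact le_mul_of_one_le_left hy0 (one_le_pow₀ hnR)
  set d := ⌈10 * ℓ⌉₊ with hd
  have hd1 : 10 * ℓ ≤ d := Nat.le_ceil _
  have hd2 : (d : ℝ) < 10 * ℓ + 1 := Nat.ceil_lt_add_one (by linarith)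
  have hexpl : Real.exp ℓ = n := by rw [hℓ, Real.exp_log hn0]
  have h2d : (n : ℝ) ^ 3 ≤ 2 ^ (d + 1) := by
    have l2 := Real.log_two_gt_d9
    have : (2 : ℝ) ^ (d + 1) = Real.exp ((d + 1 : ℕ) * Real.log 2) := by
      rw [Real.exp_nat_mul, Real.exp_log two_pos]
    rw [this, ← hexpl, ← Real.exp_nat_mul]
    apply Real.exp_le_exp.2
    push_cast
    nlinarith
  refine Exists.elim (masterC hF (d := d) (Λ := 2 * B * ℓ) (C := C) (θ := θ) hn hℓ hC e7 hθ hθ2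
    (by have : (1 : ℝ) ≤ d := by linarith
        exact_mod_cast this) (by nlinarith) hD hD0 ?_ ?_ ?_ ?_ ?_ h6) ?_
  · exact h8.trans e1
  · refine le_trans ?_ e2
    have q1 : (((r * d + 1) ^ r) ^ (r + 1) : ℝ) ≤ ((12 * r * ℓ) ^ r) ^ (r + 1) := by
      have : (r : ℝ) * d + 1 ≤ 12 * r * ℓ := by
        have : (r : ℝ) * d ≤ r * (10 * ℓ + 1) := by gcongr
        nlinarith
      gcongr
    unfold etaB
    push_cast
    have hnp : 0 ≤ (n : ℝ) ^ (-(1 / (s : ℝ))) := Real.rpow_nonneg hn0.le _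
    have hB0 : 0 ≤ B := by linarith
    have hℓ0 : 0 ≤ ℓ := by linarith
    calc 2 ^ s * (r * r * (((r * d + 1) ^ r) ^ (r + 1) : ℝ)) *
          (2 * B * ℓ * (n : ℝ) ^ (-(1 / (s : ℝ)))) * (ℓ + C)
        ≤ 2 ^ s * (r * r * (((12 * r * ℓ) ^ r) ^ (r + 1) : ℝ)) *
          (2 * B * ℓ * (n : ℝ) ^ (-(1 / (s : ℝ)))) * (2 * ℓ) := by
          have : 0 ≤ ℓ + C := by linarith
          gcongr
          linarith
      _ = _ := by
          rw [← pow_mul, ← pow_mul, mul_pow _ ℓ, pow_add ℓ]; ring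
  · calc D * y ^ 2 = (ℓ + C) * y := by rw [← hDy]; ring
      _ ≤ (2 * ℓ) * (2 * B * (ℓ ^ 1 / n)) := by
          gcongr
          linarith
      _ = 2 * (2 * B) * (ℓ ^ 2 / n) := by ring
      _ ≤ θ := e3
  · calc (r : ℝ) * r * n ^ (r - 2) * y = r * r * (n ^ (r - 2) * y) := by ring
      _ ≤ r * r * (2 * B * (ℓ ^ 1 / n)) := by gcongr
      _ = r * r * (2 * B) * (ℓ ^ 1 / n) := by ring
      _ ≤ θ := e4
  · have w1 : n * (Real.exp (ℓ + C) / 2 ^ (d + 1)) ≤ θ ^ 2 / 2 := by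
      refine le_trans ?_ e5
      rw [Real.exp_add, hexpl, pow_zero]
      calc (n : ℝ) * (n * Real.exp C / 2 ^ (d + 1)) ≤ n * (n * Real.exp C / n ^ 3) := by gcongr
        _ = _ := by field_simp
    have w2 : (s + 2) * ((r + 1) ^ r * (2 * B * ℓ)) ^ (s + 1) / n ≤ θ ^ 2 / 2 := by
      refine le_trans (le_of_eq ?_) e6
      rw [← mul_assoc, mul_pow _ ℓ]; ring
    linarith
  · rintro μ ⟨m1, m2, m3⟩
    refine ⟨μ, m1, m2, le_trans (ENNReal.ofReal_le_ofReal ?_) m3⟩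
    linarith

/-- Existence of some coupling, for every `n`. -/
lemma exists_coupling (hF : NF u F) (n : ℕ) :
    ∃ μ : PMF ((Fin (Nat.choose n u) → Finset (Fin n)) × (Fin (Mnum F n) → FE n)),
      UniformOn μ Prod.fst (ValidOrdU u n) ∧ UniformOn μ Prod.snd (ValidOrdH F n) := by
  refine Exists.elim (masterA hF (n := n) (fun _ => 0) 0 monotone_const le_rfl (by norm_num) (A := 0) (ζ := 0)
    le_rfl zero_le_one zero_le_one (fun k hk => absurd hk (Nat.not_lt_zero k)) (fun _ _ _ => 0)
    (fun k hk => absurd hk (Nat.not_lt_zero k))) ?_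
  rintro μ ⟨m1, m2, _⟩
  exact ⟨μ, m1, m2⟩

end Asymp

/-- The process coupling: for a fixed nice `u`-graph `F` with `r ≥ 4`
vertices, one may couple the random `u`-graph process with the random `F`-graph process
so that whp every `F`-edge of `H_{T_H}` is present as a copy of `F` in `G_{T_G}`. -/
theorem statement_0 (u r : ℕ) (hu : 2 ≤ u) (hr : 4 ≤ r)
    (F : Finset (Finset (Fin r))) (hFcard : ∀ e ∈ F, e.card = u) (hF : Nice u F) :
    ∃ μ : (n : ℕ) →
        PMF ((Fin (Nat.choose n u) → Finset (Fin n)) × (Fin (Mnum F n) → FE n)),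
      (∀ n, UniformOn (μ n) Prod.fst (ValidOrdU u n)) ∧
      (∀ n, UniformOn (μ n) Prod.snd (ValidOrdH F n)) ∧
      Tendsto (fun n => (μ n).toOuterMeasure
          {ω | ∀ h ∈ proc ω.2 (THit F n ω.2), h.2 ⊆ proc ω.1 (TGHit u F n ω.1)})
        atTop (nhds 1) := by
  have hNF : NF u F := ⟨hu, hr, hFcard, hF⟩
  let ev : (n : ℕ) → Set ((Fin (Nat.choose n u) → Finset (Fin n)) × (Fin (Mnum F n) → FE n)) :=
    fun n => {ω | ∀ h ∈ proc ω.2 (THit F n ω.2), h.2 ⊆ proc ω.1 (TGHit u F n ω.1)}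
  let val : (n : ℕ) → Set ℝ≥0∞ := fun n => {x | ∃ μ : PMF ((Fin (Nat.choose n u) → Finset (Fin n)) ×
      (Fin (Mnum F n) → FE n)), UniformOn μ Prod.fst (ValidOrdU u n) ∧
      UniformOn μ Prod.snd (ValidOrdH F n) ∧ x = μ.toOuterMeasure (ev n)}
  have hle1 : ∀ n (μ : PMF ((Fin (Nat.choose n u) → Finset (Fin n)) ×
      (Fin (Mnum F n) → FE n))), μ.toOuterMeasure (ev n) ≤ 1 := by
    intro n μ
    rw [PMF.toOuterMeasure_apply, ← PMF.tsum_coe μ]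
    exact ENNReal.tsum_le_tsum (fun ω => Set.indicator_le_self _ _ ω)
  have hpick : ∀ n : ℕ, ∃ μ : PMF ((Fin (Nat.choose n u) → Finset (Fin n)) ×
      (Fin (Mnum F n) → FE n)), UniformOn μ Prod.fst (ValidOrdU u n) ∧
      UniformOn μ Prod.snd (ValidOrdH F n) ∧
      sSup (val n) - ((n : ℝ≥0∞) + 1)⁻¹ ≤ μ.toOuterMeasure (ev n) := by
    intro n
    obtain ⟨μ0, a1, a2⟩ := exists_coupling hNF n
    rcases eq_or_ne (sSup (val n)) 0 with h0 | h0
    · exact ⟨μ0, a1, a2, by rw [h0]; simp⟩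
    · have hS1 : sSup (val n) ≤ 1 := sSup_le (by rintro x ⟨μ, _, _, rfl⟩; exact hle1 n μ)
      have hlt : sSup (val n) - ((n : ℝ≥0∞) + 1)⁻¹ < sSup (val n) := by
        refine ENNReal.sub_lt_self (ne_top_of_le_ne_top ENNReal.one_ne_top hS1) h0 ?_
        exact ENNReal.inv_ne_zero.2 (by simp)
      obtain ⟨x, ⟨μ, b1, b2, rfl⟩, hx⟩ := lt_sSup_iff.1 hlt
      exact ⟨μ, b1, b2, hx.le⟩
  choose μ hμ1 hμ2 hμ3 using hpick
  refine ⟨μ, hμ1, hμ2, ?_⟩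
  change Tendsto (fun n => (μ n).toOuterMeasure (ev n)) atTop (nhds 1)
  have hinv : Tendsto (fun n : ℕ => ((n : ℝ≥0∞) + 1)⁻¹) atTop (nhds 0) := by
    have h := ENNReal.tendsto_inv_nat_nhds_zero.comp (tendsto_add_atTop_nat 1)
    refine h.congr (fun n => ?_)
    simp
  refine tendsto_order.2 ⟨fun a ha => ?_, fun a ha => Eventually.of_forall
    (fun n => lt_of_le_of_lt (hle1 n (μ n)) ha)⟩
  have hatop : a ≠ ⊤ := ne_top_of_lt ha
  set α := a.toReal with hα
  have hα1 : α < 1 := by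
    have := (ENNReal.toReal_lt_toReal hatop ENNReal.one_ne_top).2 ha
    simpa using this
  have hα0 : 0 ≤ α := ENNReal.toReal_nonneg
  have haα : a = ENNReal.ofReal α := (ENNReal.ofReal_toReal hatop).symm
  set ε := (1 - α) / 3 with hε
  have hε0 : 0 < ε := by rw [hε]; linarith
  filter_upwards [masterD hNF hε0, hinv.eventually (gt_mem_nhds (ENNReal.ofReal_pos.2 hε0))]
    with n hn1 hn2
  obtain ⟨ν, c1, c2, c3⟩ := hn1
  have hS : ENNReal.ofReal (1 - ε) ≤ sSup (val n) := c3.trans (le_sSup ⟨ν, c1, c2, rfl⟩)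
  refine lt_of_lt_of_le ?_ (hμ3 n)
  calc a < ENNReal.ofReal (1 - ε - ε) := by
        rw [haα]
        refine (ENNReal.ofReal_lt_ofReal_iff (by linarith)).2 (by linarith)
    _ = ENNReal.ofReal (1 - ε) - ENNReal.ofReal ε := ENNReal.ofReal_sub _ hε0.le
    _ ≤ sSup (val n) - ((n : ℝ≥0∞) + 1)⁻¹ := tsub_le_tsub hS hn2.le
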